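/- Let p and q be prime numbers with p ≡ 5 (mod 8), q ≡ 3 (mod 8), and Legendre symbol (p/q) = 1, and let m be the natural number with 2^m equal to the 2-class number of ℚ(√(−pq)). Then the 2-class group of the field L = ℚ(√2, √(pq), i) is cyclic of order 2^{m+1}, i.e. isomorphic to ℤ/2^{m+1}ℤ. -/

import Mathlib

/-- The class number of a subfield `K` of `ℂ` (the cardinality of the class
group of its ring of integers). -/
noncomputable def classNum (K : IntermediateField ℚ ℂ) : ℕ :=
  Nat.card (ClassGroup (integralClosure ℤ K))

/-- The 2-class number of a subfield `K` of `ℂ`: the largest power of `2`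
dividing its class number. -/
noncomputable def twoClassNum (K : IntermediateField ℚ ℂ) : ℕ :=
  2 ^ ((classNum K).factorization 2)

/-- The 2-class group of a subfield `K` of `ℂ` (i.e. the 2-Sylow subgroup of
the class group of its ring of integers) is cyclic of order `N`. -/
def TwoClassGroupIsCyclicOfOrder (K : IntermediateField ℚ ℂ) (N : ℕ) : Prop :=
  ∀ P : Sylow 2 (ClassGroup (integralClosure ℤ K)),
    Nonempty (P ≃* Multiplicative (ZMod N))

open scoped nonZeroDivisors

universe u v

set_option linter.unusedSectionVars false

theorem Int.exists_sq_of_coprime_mul_eq_sq {a b c : ℤ} (ha : 0 ≤ a) (hab : IsCoprime a b)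
    (h : a * b = c ^ 2) : ∃ s, a = s ^ 2 := by
  obtain ⟨s, hs | hs⟩ := Int.sq_of_isCoprime hab h
  · exact ⟨s, hs⟩
  · exact ⟨0, by nlinarith [sq_nonneg s]⟩

theorem not_isSquare_mul_of_prime {p : ℕ} (hp : p.Prime) {n : ℕ} (hn : ¬ p ∣ n) :
    ¬ IsSquare ((p * n : ℕ) : ℤ) := by
  rintro ⟨r, hr⟩
  have h1 : (p : ℤ) ∣ r := by
    have : (p : ℤ) ∣ r * r := by rw [← hr]; push_cast; exact dvd_mul_right _ _
    exact (Nat.prime_iff_prime_int.1 hp).dvd_or_dvd this |>.elim id id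
  obtain ⟨t, rfl⟩ := h1
  apply hn
  have hp0 : (p : ℤ) ≠ 0 := by exact_mod_cast hp.ne_zero
  have : (n : ℤ) = p * (t * t) := by
    apply mul_left_cancel₀ hp0; push_cast at hr; linarith
  exact_mod_cast (Dvd.intro _ this.symm)

/-- In the ring of integers modulo a prime `p`, a relation `d * t ^ 2 = c + p * k`
with `p ∤ c` determines the Legendre symbol of `d * c`. -/
theorem legendreSym_mul_eq_one_of_mul_sq {p : ℕ} [Fact p.Prime] {c d t k : ℤ}
    (hc : ¬ (p : ℤ) ∣ c) (h : d * t ^ 2 = c + p * k) : legendreSym p (d * c) = 1 := by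
  have hz : ((c : ℤ) : ZMod p) ≠ 0 := by
    rwa [Ne, ZMod.intCast_zmod_eq_zero_iff_dvd]
  have h' : (d : ZMod p) * t ^ 2 = c := by
    have := congrArg (Int.cast : ℤ → ZMod p) h
    push_cast at this
    simpa using this
  have ht : (t : ZMod p) ≠ 0 := by
    rintro h0; rw [h0] at h'; apply hz; rw [← h']; ring
  rw [legendreSym.eq_one_iff]
  · refine ⟨c * (t : ZMod p)⁻¹, ?_⟩
    push_cast
    rw [← h']; field_simp
  · push_cast
    refine mul_ne_zero ?_ hz
    rintro h0; rw [h0] at h'; apply hz; rw [← h']; ring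

/-- Two coprime positive factors of `n * Z ^ 2` are squares up to complementary divisors of `n`. -/
theorem Int.exists_eq_mul_sq_of_coprime (n : ℕ) (hn : n ≠ 0) : ∀ {u v Z : ℤ}, 0 < u → 0 < v →
    IsCoprime u v → u * v = n * Z ^ 2 →
    ∃ (d e : ℕ) (s t : ℤ), d * e = n ∧ u = d * s ^ 2 ∧ v = e * t ^ 2 := by
  induction n using induction_on_primes with
  | zero => exact absurd rfl hn
  | one =>
    intro u v Z hu hv huv h
    rw [Nat.cast_one, one_mul] at h
    obtain ⟨s, rfl⟩ := Int.exists_sq_of_coprime_mul_eq_sq hu.le huv h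
    obtain ⟨t, rfl⟩ := Int.exists_sq_of_coprime_mul_eq_sq hv.le huv.symm (by rw [mul_comm]; exact h)
    exact ⟨1, 1, s, t, by simp, by simp, by simp⟩
  | prime_mul l n hl ih =>
    intro u v Z hu hv huv h
    have hn' : n ≠ 0 := by rintro rfl; simp at hn
    have hl0 : (0 : ℤ) < l := by exact_mod_cast hl.pos
    have hd : (l : ℤ) ∣ u * v := ⟨n * Z ^ 2, by rw [h]; push_cast; ring⟩
    rcases (Nat.prime_iff_prime_int.1 hl).dvd_or_dvd hd with ⟨w, hw⟩ | ⟨w, hw⟩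
    · have hw0 : 0 < w := by rw [hw] at hu; exact pos_of_mul_pos_right hu hl0.le
      obtain ⟨d, e, s, t, h1, h2, h3⟩ := ih (Z := Z) hn' hw0 hv
        (by rw [hw] at huv; exact huv.of_mul_left_right)
        (mul_left_cancel₀ hl0.ne' (by rw [← mul_assoc, ← hw, h]; push_cast; ring))
      exact ⟨l * d, e, s, t, by rw [← h1]; ring, by rw [hw, h2]; push_cast; ring, h3⟩
    · have hw0 : 0 < w := by rw [hw] at hv; exact pos_of_mul_pos_right hv hl0.le
      obtain ⟨d, e, s, t, h1, h2, h3⟩ := ih (Z := Z) hn' hu hw0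
        (by rw [hw] at huv; exact huv.of_mul_right_right)
        (mul_left_cancel₀ hl0.ne' (by rw [mul_left_comm, ← hw, h]; push_cast; ring))
      exact ⟨d, l * e, s, t, by rw [← h1]; ring, h2, by rw [hw, h3]; push_cast; ring⟩

theorem Nat.eq_or_eq_of_mul_eq_prime_mul {l m d e : ℕ} (hl : l.Prime) (h : d * e = l * m) :
    (∃ d', d = l * d' ∧ d' * e = m) ∨ (∃ e', e = l * e' ∧ d * e' = m) := by
  have hd : l ∣ d * e := ⟨m, h⟩
  rcases hl.dvd_mul.1 hd with ⟨w, rfl⟩ | ⟨w, rfl⟩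
  · exact Or.inl ⟨w, rfl, Nat.eq_of_mul_eq_mul_left hl.pos (by rw [← h]; ring)⟩
  · exact Or.inr ⟨w, rfl, Nat.eq_of_mul_eq_mul_left hl.pos (by rw [← h]; ring)⟩

/-- The fundamental solution of Pell's equation is not the double of a solution. -/
theorem Pell.IsFundamental.ne_two_mul_sq_sub_one {d : ℤ} {a : Pell.Solution₁ d}
    (ha : Pell.IsFundamental a) {s t : ℤ} (h : t ^ 2 - d * s ^ 2 = 1) :
    a.x ≠ 2 * t ^ 2 - 1 := by
  intro hx
  have hX := ha.1
  have h1 : 1 < |t| := by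
    by_contra hle
    have : t ^ 2 ≤ 1 := by rw [← sq_abs]; nlinarith [abs_nonneg t, not_lt.1 hle]
    linarith
  have h2 : a.x ≤ (Pell.Solution₁.mk |t| s (by rw [sq_abs]; exact h) : Pell.Solution₁ d).x :=
    ha.2.2 (by simpa using h1)
  simp only [Pell.Solution₁.x_mk] at h2
  rw [hx, ← sq_abs] at h2
  nlinarith

section
variable {p q : ℕ} [Fact p.Prime] [Fact q.Prime]

theorem legendreSym_two_of_five (hp : p % 8 = 5) : legendreSym p 2 = -1 := by
  rw [legendreSym.at_two (by rintro rfl; omega), ZMod.χ₈_nat_mod_eight, hp]; rfl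

theorem legendreSym_neg_one_of_five (hp : p % 8 = 5) : legendreSym p (-1) = 1 := by
  rw [legendreSym.at_neg_one (by rintro rfl; omega), ZMod.χ₄_nat_mod_four,
    show p % 4 = 1 by omega]; rfl

theorem legendreSym_two_of_three (hq : q % 8 = 3) : legendreSym q 2 = -1 := by
  rw [legendreSym.at_two (by rintro rfl; omega), ZMod.χ₈_nat_mod_eight, hq]; rfl

theorem legendreSym_neg_one_of_three (hq : q % 8 = 3) : legendreSym q (-1) = -1 := by
  rw [legendreSym.at_neg_one (by rintro rfl; omega), ZMod.χ₄_nat_mod_four,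
    show q % 4 = 3 by omega]; rfl

theorem legendreSym_swap (hp : p % 8 = 5) (hq : q % 8 = 3) (hleg : legendreSym q (p : ℤ) = 1) :
    legendreSym p (q : ℤ) = 1 := by
  rw [← hleg]
  exact (legendreSym.quadratic_reciprocity_one_mod_four (by omega) (by rintro rfl; omega)).symm

theorem Int.not_dvd_of_abs_lt {l : ℕ} {c : ℤ} (hc : c ≠ 0) (h : |c| < l) : ¬ (l : ℤ) ∣ c :=
  fun hd => hc (Int.eq_zero_of_abs_lt_dvd hd h)

theorem exists_mul_sq_sub_mul_sq_eq_one (hp : p % 8 = 5) (hq : q % 8 = 3)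
    (hleg : legendreSym q (p : ℤ) = 1) : ∃ x y : ℤ, (p : ℤ) * x ^ 2 - q * y ^ 2 = 1 := by
  have hpP := Fact.out (p := p.Prime)
  have hqP := Fact.out (p := q.Prime)
  have hp5 : 5 ≤ p := by omega
  have hq3 : 3 ≤ q := by omega
  have hpq : legendreSym p (q : ℤ) = 1 := legendreSym_swap hp hq hleg
  have hd : ¬ IsSquare ((p : ℤ) * q) := by
    have := not_isSquare_mul_of_prime hpP (n := q)
      (fun h => by have := (Nat.prime_dvd_prime_iff_eq hpP hqP).1 h; omega)
    simpa using this
  have p2 := legendreSym_two_of_five hp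
  have p1 := legendreSym_neg_one_of_five hp
  have q1 := legendreSym_neg_one_of_three hq
  obtain ⟨a, ha⟩ := Pell.IsFundamental.exists_of_not_isSquare
    (d := (p : ℤ) * q) (by positivity) hd
  have hX := ha.1
  have hrel := a.prop
  have hne := fun {s t : ℤ} => ha.ne_two_mul_sq_sub_one (s := s) (t := t)
  generalize a.x = X at *
  generalize a.y = Y at *
  have np : ∀ c : ℤ, c ≠ 0 → |c| < 5 → ¬ (p : ℤ) ∣ c := fun c hc h =>
    Int.not_dvd_of_abs_lt hc (lt_of_lt_of_le h (by exact_mod_cast hp5))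
  have nq : ∀ c : ℤ, c ≠ 0 → |c| < 3 → ¬ (q : ℤ) ∣ c := fun c hc h =>
    Int.not_dvd_of_abs_lt hc (lt_of_lt_of_le h (by exact_mod_cast hq3))
  have sp : ∀ {d e : ℕ}, d * e = p * q → (d = p * q ∧ e = 1) ∨ (d = p ∧ e = q) ∨
      (d = q ∧ e = p) ∨ (d = 1 ∧ e = p * q) := by
    intro d e h
    rcases Nat.eq_or_eq_of_mul_eq_prime_mul hpP h with ⟨d', rfl, h1⟩ | ⟨e', rfl, h1⟩ <;>
    rcases Nat.eq_or_eq_of_mul_eq_prime_mul hqP (h1.trans (mul_one q).symm)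
      with ⟨d'', rfl, h2⟩ | ⟨e'', rfl, h2⟩ <;>
    obtain ⟨rfl, rfl⟩ := mul_eq_one.1 h2 <;> simp
  have cast : (p : ℤ) * q = (p * q : ℕ) := by push_cast; rfl
  rcases Int.even_or_odd' X with ⟨k, hXk | hXk⟩
  · exfalso
    have hc : IsCoprime (X - 1) (X + 1) := ⟨k, 1 - k, by rw [hXk]; ring⟩
    obtain ⟨d, e, s, t, hde, h1, h2⟩ := Int.exists_eq_mul_sq_of_coprime (p * q)
      (Nat.mul_ne_zero hpP.ne_zero hqP.ne_zero) (by linarith) (by linarith) hc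
      (Z := Y) (by rw [← cast]; linarith)
    have h3 : (e : ℤ) * t ^ 2 - d * s ^ 2 = 2 := by linarith
    rcases sp hde with ⟨rfl, rfl⟩ | ⟨rfl, rfl⟩ | ⟨rfl, rfl⟩ | ⟨rfl, rfl⟩ <;> push_cast at h3
    · have := legendreSym_mul_eq_one_of_mul_sq (p := p) (d := 1) (c := 2) (t := t)
        (k := q * s ^ 2) (np 2 (by norm_num) (by norm_num)) (by linarith)
      rw [one_mul, p2] at this; norm_num at this
    · have := legendreSym_mul_eq_one_of_mul_sq (p := d) (d := e) (c := 2) (t := t)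
        (k := s ^ 2) (np 2 (by norm_num) (by norm_num)) (by linarith)
      rw [legendreSym.mul, p2, hpq] at this; norm_num at this
    · have := legendreSym_mul_eq_one_of_mul_sq (p := e) (d := -1 * d) (c := 2) (t := s)
        (k := -t ^ 2) (np 2 (by norm_num) (by norm_num)) (by linarith)
      rw [legendreSym.mul, legendreSym.mul, p2, hpq, p1] at this; norm_num at this
    · have := legendreSym_mul_eq_one_of_mul_sq (p := p) (d := -1) (c := 2) (t := s)
        (k := -q * t ^ 2) (np 2 (by norm_num) (by norm_num)) (by linarith)
      rw [legendreSym.mul, p2, p1] at this; norm_num at this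
  · have hk : 0 < k := by linarith
    obtain ⟨Z, hZ⟩ : ∃ Z, Y = 2 * Z := by
      rcases Int.even_or_odd' Y with ⟨Z, h | h⟩
      · exact ⟨Z, h⟩
      · exfalso
        have h8 := hrel
        obtain ⟨P, hP⟩ : ∃ P : ℕ, p = 8 * P + 5 := ⟨p / 8, by omega⟩
        obtain ⟨Q, hQ⟩ : ∃ Q : ℕ, q = 8 * Q + 3 := ⟨q / 8, by omega⟩
        rw [hXk, h, hP, hQ] at h8
        push_cast at h8
        have : (2 : ℤ) ∣ 1 := by
          refine ⟨2 * k ^ 2 + 2 * k - 32 * P * Q - 12 * P - 20 * Q - 8 +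
             1 - (8 * P + 5) * (8 * Q + 3) * (2 * Z ^ 2 + 2 * Z), ?_⟩
          linarith
        norm_num at this
    obtain ⟨d, e, s, t, hde, h1, h2⟩ := Int.exists_eq_mul_sq_of_coprime (p * q)
      (Nat.mul_ne_zero hpP.ne_zero hqP.ne_zero) hk (by linarith : 0 < k + 1) ⟨-1, 1, by ring⟩
      (Z := Z) (by rw [← cast]; rw [hXk, hZ] at hrel; linarith)
    have h3 : (e : ℤ) * t ^ 2 - d * s ^ 2 = 1 := by linarith
    rcases sp hde with ⟨rfl, rfl⟩ | ⟨rfl, rfl⟩ | ⟨rfl, rfl⟩ | ⟨rfl, rfl⟩ <;> push_cast at h3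
    · exfalso
      exact hne (s := s) (t := t) (by linarith) (by push_cast at h2; linarith)
    · exfalso
      have := legendreSym_mul_eq_one_of_mul_sq (p := e) (d := -1 * d) (c := 1) (t := s)
        (k := -t ^ 2) (nq 1 (by norm_num) (by norm_num)) (by linarith)
      rw [mul_one, legendreSym.mul, hleg, q1] at this; norm_num at this
    · exact ⟨t, s, h3⟩
    · exfalso
      have := legendreSym_mul_eq_one_of_mul_sq (p := q) (d := -1) (c := 1) (t := s)
        (k := -p * t ^ 2) (nq 1 (by norm_num) (by norm_num)) (by linarith)
      rw [mul_one, q1] at this; norm_num at this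

theorem exists_mul_sq_sub_two_mul_sq_eq_one (hp : p % 8 = 5) (hq : q % 8 = 3)
    (hleg : legendreSym q (p : ℤ) = 1) : ∃ x y : ℤ, (q : ℤ) * x ^ 2 - 2 * p * y ^ 2 = 1 := by
  have hpP := Fact.out (p := p.Prime)
  have hqP := Fact.out (p := q.Prime)
  have hp5 : 5 ≤ p := by omega
  have hq3 : 3 ≤ q := by omega
  have hpq : legendreSym p (q : ℤ) = 1 := legendreSym_swap hp hq hleg
  have hd : ¬ IsSquare ((2 : ℤ) * (p * q)) := by
    have := not_isSquare_mul_of_prime Nat.prime_two (n := p * q)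
      (fun h => by rcases (Nat.Prime.dvd_mul Nat.prime_two).1 h with h | h <;> omega)
    simpa using this
  have p2 := legendreSym_two_of_five hp
  have p1 := legendreSym_neg_one_of_five hp
  have q1 := legendreSym_neg_one_of_three hq
  have q2 := legendreSym_two_of_three hq
  obtain ⟨a, ha⟩ := Pell.IsFundamental.exists_of_not_isSquare
    (d := (2 : ℤ) * (p * q)) (by positivity) hd
  have hX := ha.1
  have hrel := a.prop
  have hne := fun {s t : ℤ} => ha.ne_two_mul_sq_sub_one (s := s) (t := t)
  generalize a.x = X at *
  generalize a.y = Y at *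
  have np : ∀ c : ℤ, c ≠ 0 → |c| < 5 → ¬ (p : ℤ) ∣ c := fun c hc h =>
    Int.not_dvd_of_abs_lt hc (lt_of_lt_of_le h (by exact_mod_cast hp5))
  have nq : ∀ c : ℤ, c ≠ 0 → |c| < 3 → ¬ (q : ℤ) ∣ c := fun c hc h =>
    Int.not_dvd_of_abs_lt hc (lt_of_lt_of_le h (by exact_mod_cast hq3))
  have cast : (2 : ℤ) * (p * q) = (2 * (p * q) : ℕ) := by push_cast; rfl
  have sp : ∀ {d e : ℕ}, d * e = 2 * (p * q) →
      (d = 2 * (p * q) ∧ e = 1) ∨ (d = 2 * p ∧ e = q) ∨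
      (d = 2 * q ∧ e = p) ∨ (d = 2 ∧ e = p * q) ∨ (d = p * q ∧ e = 2) ∨ (d = p ∧ e = 2 * q) ∨
      (d = q ∧ e = 2 * p) ∨ (d = 1 ∧ e = 2 * (p * q)) := by
    intro d e h
    rcases Nat.eq_or_eq_of_mul_eq_prime_mul Nat.prime_two h with ⟨d', rfl, h0⟩ | ⟨e', rfl, h0⟩ <;>
    rcases Nat.eq_or_eq_of_mul_eq_prime_mul hpP h0 with ⟨d', rfl, h1⟩ | ⟨e', rfl, h1⟩ <;>
    rcases Nat.eq_or_eq_of_mul_eq_prime_mul hqP (h1.trans (mul_one q).symm)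
      with ⟨d'', rfl, h2⟩ | ⟨e'', rfl, h2⟩ <;>
    obtain ⟨rfl, rfl⟩ := mul_eq_one.1 h2 <;> simp
  obtain ⟨k, hXk⟩ : ∃ k, X = 2 * k + 1 := by
    rcases Int.even_or_odd' X with ⟨k, h | h⟩
    · exfalso
      have : (2 : ℤ) ∣ 1 := ⟨2 * k ^ 2 - p * q * Y ^ 2, by rw [h] at hrel; linarith⟩
      norm_num at this
    · exact ⟨k, h⟩
  obtain ⟨Z, hZ⟩ : ∃ Z, Y = 2 * Z := by
    rcases Int.even_or_odd' Y with ⟨Z, h | h⟩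
    · exact ⟨Z, h⟩
    · exfalso
      obtain ⟨P, hP⟩ : ∃ P : ℕ, p = 2 * P + 1 := ⟨p / 2, by omega⟩
      obtain ⟨Q, hQ⟩ : ∃ Q : ℕ, q = 2 * Q + 1 := ⟨q / 2, by omega⟩
      rw [hXk, h, hP, hQ] at hrel
      push_cast at hrel
      have : (2 : ℤ) ∣ 1 := ⟨k ^ 2 + k - (2 * P * Q + P + Q)
        - (2 * P + 1) * (2 * Q + 1) * (2 * Z ^ 2 + 2 * Z), by linarith⟩
      norm_num at this
  obtain ⟨d, e, s, t, hde, h1, h2⟩ := Int.exists_eq_mul_sq_of_coprime (2 * (p * q))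
    (Nat.mul_ne_zero two_ne_zero (Nat.mul_ne_zero hpP.ne_zero hqP.ne_zero))
    (by linarith : 0 < k) (by linarith : 0 < k + 1) ⟨-1, 1, by ring⟩
    (Z := Z) (by rw [← cast]; rw [hXk, hZ] at hrel; linarith)
  have h3 : (e : ℤ) * t ^ 2 - d * s ^ 2 = 1 := by linarith
  rcases sp hde with ⟨rfl, rfl⟩ | ⟨rfl, rfl⟩ | ⟨rfl, rfl⟩ | ⟨rfl, rfl⟩ |
    ⟨rfl, rfl⟩ | ⟨rfl, rfl⟩ | ⟨rfl, rfl⟩ | ⟨rfl, rfl⟩ <;> push_cast at h3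
  · exfalso
    exact hne (s := s) (t := t) (by linarith) (by push_cast at h2; linarith)
  · exact ⟨t, s, h3⟩
  · exfalso
    have := legendreSym_mul_eq_one_of_mul_sq (p := e) (d := -1 * (2 * q)) (c := 1) (t := s)
      (k := -t ^ 2) (np 1 (by norm_num) (by norm_num)) (by linarith)
    rw [mul_one, legendreSym.mul, legendreSym.mul, hpq, p1, p2] at this; norm_num at this
  · exfalso
    have := legendreSym_mul_eq_one_of_mul_sq (p := p) (d := -1 * 2) (c := 1) (t := s)
      (k := -q * t ^ 2) (np 1 (by norm_num) (by norm_num)) (by linarith)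
    rw [mul_one, legendreSym.mul, p1, p2] at this; norm_num at this
  · exfalso
    have := legendreSym_mul_eq_one_of_mul_sq (p := p) (d := 2) (c := 1) (t := t)
      (k := q * s ^ 2) (np 1 (by norm_num) (by norm_num)) (by linarith)
    rw [mul_one, p2] at this; norm_num at this
  · exfalso
    have := legendreSym_mul_eq_one_of_mul_sq (p := d) (d := 2 * q) (c := 1) (t := t)
      (k := s ^ 2) (np 1 (by norm_num) (by norm_num)) (by linarith)
    rw [mul_one, legendreSym.mul, hpq, p2] at this; norm_num at this
  · exfalso
    have := legendreSym_mul_eq_one_of_mul_sq (p := d) (d := 2 * p) (c := 1) (t := t)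
      (k := s ^ 2) (nq 1 (by norm_num) (by norm_num)) (by linarith)
    rw [mul_one, legendreSym.mul, hleg, q2] at this; norm_num at this
  · exfalso
    have := legendreSym_mul_eq_one_of_mul_sq (p := q) (d := -1) (c := 1) (t := s)
      (k := -2 * p * t ^ 2) (nq 1 (by norm_num) (by norm_num)) (by linarith)
    rw [mul_one, q1] at this; norm_num at this
end

section QuadraticConjugation

variable {R S : Type*} [CommRing R] [IsDomain R] [IsPrincipalIdealRing R]
  [CommRing S] [IsDedekindDomain S] [Algebra R S]

theorem dvd_of_sq_eq_of_isIntegrallyClosed {A : Type*} [CommRing A] [IsDomain A]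
    [IsIntegrallyClosed A] {t r a b : A} (hr : r ≠ 0)
    (h : t ^ 2 - r * a * t + r ^ 2 * b = 0) : r ∣ t := by
  have hr' : algebraMap A (FractionRing A) r ≠ 0 := by simpa using hr
  have hxint : IsIntegral A (algebraMap A (FractionRing A) t / algebraMap A (FractionRing A) r) := by
    refine ⟨Polynomial.X ^ 2 - Polynomial.C a * Polynomial.X + Polynomial.C b, ?_, ?_⟩
    · monicity!
    · have := congrArg (algebraMap A (FractionRing A)) h
      simp only [map_add, map_sub, map_mul, map_pow, map_zero] at this
      simp only [Polynomial.eval₂_add, Polynomial.eval₂_sub, Polynomial.eval₂_mul,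
        Polynomial.eval₂_X_pow, Polynomial.eval₂_C, Polynomial.eval₂_X]
      field_simp
      linear_combination this
  obtain ⟨y, hy⟩ := IsIntegrallyClosed.isIntegral_iff.1 hxint
  refine ⟨y, ?_⟩
  apply IsFractionRing.injective A (FractionRing A)
  rw [map_mul, hy]; field_simp

omit [IsDomain R] [IsPrincipalIdealRing R] [IsDedekindDomain S] in
theorem Ideal.mem_map_of_involutive {σ : S ≃ₐ[R] S} (hσ : ∀ x, σ (σ x) = x) {I : Ideal S} {x : S} :
    x ∈ I.map σ ↔ σ x ∈ I := by
  constructor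
  · intro h
    obtain ⟨y, hy, rfl⟩ := (Ideal.mem_map_iff_of_surjective σ σ.surjective).1 h
    rwa [hσ]
  · intro h
    have := Ideal.mem_map_of_mem σ h
    rwa [hσ] at this

omit [IsDomain R] [IsPrincipalIdealRing R] [IsDedekindDomain S] in
theorem Ideal.map_map_of_involutive {σ : S ≃ₐ[R] S} (hσ : ∀ x, σ (σ x) = x) (I : Ideal S) :
    (I.map σ).map σ = I := by
  ext x
  rw [mem_map_of_involutive hσ, mem_map_of_involutive hσ, hσ]

variable [FaithfulSMul R S] {σ : S ≃ₐ[R] S} (hσ : ∀ x, σ (σ x) = x)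
  (hfix : ∀ x, σ x = x → ∃ r, algebraMap R S r = x)

include hσ hfix

omit [IsDomain R] in
/-- The product of an ideal and its conjugate is generated by an element of the base ring. -/
theorem Ideal.exists_mul_map_eq_span (I : Ideal S) :
    ∃ r : R, I * I.map σ = Ideal.span {algebraMap R S r} := by
  let J : Ideal R := Ideal.span {r | ∃ z ∈ I, algebraMap R S r = z * σ z}
  obtain ⟨r, hr⟩ := (IsPrincipalIdealRing.principal J).principal
  have hr : J = Ideal.span {r} := hr
  have hinj := FaithfulSMul.algebraMap_injective R S
  have hdvd : ∀ z ∈ I, ∃ c : R, algebraMap R S (r * c) = z * σ z := by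
    intro z hz
    obtain ⟨c, hc⟩ := hfix (z * σ z) (by rw [map_mul, hσ, mul_comm])
    have : c ∈ J := Ideal.subset_span ⟨z, hz, hc⟩
    rw [hr, Ideal.mem_span_singleton] at this
    obtain ⟨d, rfl⟩ := this
    exact ⟨d, hc⟩
  refine ⟨r, le_antisymm ?_ ?_⟩
  · rw [Ideal.mul_le]
    intro x hx y hy
    rw [Ideal.mem_map_of_involutive hσ] at hy
    obtain ⟨a, ha⟩ := hdvd x hx
    obtain ⟨b, hb⟩ := hdvd _ hy
    obtain ⟨c, hc⟩ := hdvd (x + σ y) (I.add_mem hx hy)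
    rw [hσ] at hb
    rw [map_add, hσ] at hc
    simp only [map_mul] at ha hb hc
    rw [Ideal.mem_span_singleton]
    by_cases hr0 : r = 0
    · rw [hr0, map_zero, zero_mul] at ha hb
      rcases mul_eq_zero.1 ha.symm with h | h
      · simp [h]
      · rw [show x = σ (σ x) from (hσ x).symm, h]; simp
    · apply dvd_of_sq_eq_of_isIntegrallyClosed (a := algebraMap R S (c - a - b))
        (b := algebraMap R S (a * b)) (by simpa using fun h => hr0 h)
      simp only [map_sub, map_mul]
      linear_combination (-x * y) * hc + (algebraMap R S r * algebraMap R S b + x * y) * ha +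
        (x * y + x * σ x) * hb
  · rw [Ideal.span_singleton_le_iff_mem]
    have : r ∈ J := by rw [hr]; exact Ideal.mem_span_singleton_self r
    have h2 : algebraMap R S r ∈ J.map (algebraMap R S) := Ideal.mem_map_of_mem _ this
    refine (?_ : J.map (algebraMap R S) ≤ _) h2
    rw [Ideal.map_span, Ideal.span_le]
    rintro _ ⟨_, ⟨z, hz, h⟩, rfl⟩
    rw [SetLike.mem_coe, h]
    exact Ideal.mul_mem_mul hz (Ideal.mem_map_of_mem _ hz)

/-- A conjugation-invariant prime with nontrivial action on the residue ring comes from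
the base ring. -/
theorem Ideal.exists_eq_span_of_map_eq {P : Ideal S} (hP : P.IsPrime) (hP0 : P ≠ ⊥)
    (hPσ : P.map σ = P) {s : S} (hs : s - σ s ∉ P) :
    ∃ r : R, P = Ideal.span {algebraMap R S r} := by
  obtain ⟨ϖ, hϖ, hϖ2⟩ : ∃ ϖ ∈ P, ϖ ∉ P ^ 2 := by
    have := Ideal.pow_succ_lt_pow (P := P) hP0 1
    rw [pow_one] at this
    exact Set.exists_of_ssubset this
  have memσ : ∀ x, x ∈ P → σ x ∈ P := fun x hx => by rw [← hPσ]; exact Ideal.mem_map_of_mem _ hx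
  have hc : ∃ c : R, algebraMap R S c ∈ P ∧ algebraMap R S c ∉ P ^ 2 := by
    obtain ⟨c1, h1⟩ := hfix (ϖ + σ ϖ) (by rw [map_add, hσ, add_comm])
    obtain ⟨c2, h2⟩ := hfix (s * ϖ + σ (s * ϖ)) (by rw [map_add, hσ, add_comm])
    have hm1 : algebraMap R S c1 ∈ P := by rw [h1]; exact P.add_mem hϖ (memσ _ hϖ)
    have hm2 : algebraMap R S c2 ∈ P := by
      rw [h2]; exact P.add_mem (P.mul_mem_left _ hϖ) (memσ _ (P.mul_mem_left _ hϖ))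
    by_cases h1' : algebraMap R S c1 ∈ P ^ 2
    · refine ⟨c2, hm2, fun h2' => hϖ2 ?_⟩
      have : (s - σ s) * σ ϖ ∈ P ^ 2 := by
        have := (P ^ 2).sub_mem ((P ^ 2).mul_mem_left s h1') h2'
        rw [h1, h2, map_mul] at this
        convert this using 1; ring
      have h3 := (hP.mul_mem_pow _ this).resolve_left hs
      rw [← hPσ, ← Ideal.map_pow, Ideal.mem_map_of_involutive hσ, hσ] at h3
      exact h3
    · exact ⟨c1, hm1, h1'⟩
  obtain ⟨c, hcP, hcP2⟩ := hc
  obtain ⟨π, hπ⟩ := (IsPrincipalIdealRing.principal (P.comap (algebraMap R S))).principal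
  have hπ : P.comap (algebraMap R S) = Ideal.span {π} := hπ
  have hmem : ∀ x : R, algebraMap R S x ∈ P ↔ π ∣ x := fun x => by
    rw [← Ideal.mem_comap, hπ, Ideal.mem_span_singleton]
  have hπP : algebraMap R S π ∈ P := (hmem π).2 dvd_rfl
  have hπP2 : algebraMap R S π ∉ P ^ 2 := by
    obtain ⟨c', rfl⟩ := (hmem c).1 hcP
    intro h; apply hcP2; rw [map_mul]; exact (P ^ 2).mul_mem_right _ h
  have hπ0 : π ≠ 0 := by rintro rfl; apply hπP2; simp
  have hinj := FaithfulSMul.algebraMap_injective R S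
  have hπprime : Prime π := by
    rw [← Ideal.span_singleton_prime hπ0, ← hπ]
    exact Ideal.comap_isPrime _ _
  obtain ⟨r, hr⟩ := Ideal.exists_mul_map_eq_span hσ hfix P
  rw [hPσ, ← sq] at hr
  have hrP : algebraMap R S r ∈ P ^ 2 := by rw [hr]; exact Ideal.mem_span_singleton_self _
  obtain ⟨k, rfl⟩ := (hmem r).1 (Ideal.pow_le_self two_ne_zero hrP)
  have hk0 : k ≠ 0 := by
    rintro rfl
    rw [mul_zero, map_zero] at hr
    exact hP0 (pow_eq_zero_iff two_ne_zero |>.1 (by simpa using hr))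
  have hkπ : k ∣ π := by
    have : algebraMap R S π ^ 2 ∈ P ^ 2 := Ideal.pow_mem_pow hπP 2
    rw [hr, Ideal.mem_span_singleton] at this
    obtain ⟨y, hy⟩ := this
    have hπS : algebraMap R S π ≠ 0 := by simpa using hπ0
    have hkS : algebraMap R S k ≠ 0 := by simpa using hk0
    have hy' : algebraMap R S π = algebraMap R S k * y := by
      apply mul_left_cancel₀ hπS
      rw [← sq, hy, map_mul]; ring
    obtain ⟨y', rfl⟩ := hfix y (by
      apply mul_left_cancel₀ hkS
      have := congrArg σ hy'
      rw [map_mul, AlgEquiv.commutes, AlgEquiv.commutes] at this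
      rw [← this, hy'])
    exact ⟨y', hinj (by rw [map_mul, hy'])⟩
  obtain ⟨j, hj⟩ := hkπ
  rcases (hπprime.irreducible.isUnit_or_isUnit hj) with hu | hu
  · exfalso
    apply hπP2
    obtain ⟨u, rfl⟩ := hu
    have := (P ^ 2).mul_mem_right (algebraMap R S (↑u⁻¹ : R)) hrP
    rwa [← map_mul, mul_assoc, Units.mul_inv, mul_one] at this
  · have h2 : P ^ 2 = Ideal.span {algebraMap R S π} ^ 2 := by
      rw [hr, Ideal.span_singleton_pow, Ideal.span_singleton_eq_span_singleton]
      obtain ⟨u, rfl⟩ := hu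
      refine ⟨Units.map (algebraMap R S).toMonoidHom u, ?_⟩
      show _ * algebraMap R S u = _
      rw [← map_pow, ← map_mul, mul_assoc, ← hj, sq]
    obtain ⟨Q, hQ⟩ := Ideal.dvd_iff_le.2 ((Ideal.span_singleton_le_iff_mem _).2 hπP)
    refine ⟨π, ?_⟩
    rw [hQ, mul_pow] at h2
    have : Q ^ 2 = 1 := by
      apply mul_left_cancel₀ (pow_ne_zero 2 hP0); rw [← h2, mul_one]
    have hQ1 : Q = 1 := by
      rw [Ideal.one_eq_top, Ideal.eq_top_iff_one] at this ⊢
      exact Ideal.pow_le_self two_ne_zero this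
    rw [hQ, hQ1, mul_one]

omit hσ hfix [IsDomain R] [IsPrincipalIdealRing R] [FaithfulSMul R S] [IsDedekindDomain S] in
/-- The nonzero primes on whose residue ring the conjugation acts trivially. -/
theorem Ideal.map_eq_of_forall_sub_mem (hσ : ∀ x, σ (σ x) = x) {P : Ideal S}
    (hT : ∀ s, s - σ s ∈ P) : P.map σ = P := by
  ext x
  rw [mem_map_of_involutive hσ]
  constructor <;> intro h
  · simpa using P.add_mem (hT x) h
  · simpa using P.sub_mem h (hT x)

theorem Ideal.exists_eq_span_mul_prod (I : Ideal S) (hI0 : I ≠ ⊥) (hIσ : I.map σ = I) :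
    ∃ γ : R, γ ≠ 0 ∧ ∃ M : Multiset (Ideal S),
      (∀ P ∈ M, P.IsPrime ∧ P ≠ ⊥ ∧ ∀ s, s - σ s ∈ P) ∧
      I = Ideal.span {algebraMap R S γ} * M.prod := by
  induction I using WellFoundedGT.induction with
  | ind I ih =>
  have step : ∀ A I' : Ideal S, I = A * I' → A ≠ ⊤ → A.map σ = A → I < I' ∧ I' ≠ ⊥ ∧ I'.map σ = I' := by
    rintro A I' rfl hA hAσ
    have hA0 : A ≠ ⊥ := by rintro rfl; simp at hI0
    have hI'0 : I' ≠ ⊥ := by rintro rfl; simp at hI0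
    refine ⟨lt_of_le_of_ne Ideal.mul_le_right ?_, hI'0, ?_⟩
    · intro h
      apply hA
      rw [← Ideal.one_eq_top]
      apply mul_right_cancel₀ hI'0
      rw [one_mul]; exact h
    · rw [Ideal.map_mul, hAσ] at hIσ
      exact mul_left_cancel₀ hA0 hIσ
  by_cases htop : I = ⊤
  · refine ⟨1, one_ne_zero, 0, by simp, by simp [htop]⟩
  have viaSpan : ∀ (r : R) (I' : Ideal S), I = Ideal.span {algebraMap R S r} * I' →
      Ideal.span {algebraMap R S r} ≠ ⊤ → ∃ γ : R, γ ≠ 0 ∧ ∃ M : Multiset (Ideal S),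
      (∀ P ∈ M, P.IsPrime ∧ P ≠ ⊥ ∧ ∀ s, s - σ s ∈ P) ∧
      I = Ideal.span {algebraMap R S γ} * M.prod := by
    intro r I' h hr
    obtain ⟨h1, h2, h3⟩ := step _ I' h hr (by rw [Ideal.map_span]; simp)
    obtain ⟨γ, hγ, M, hM, hM2⟩ := ih I' h1 h2 h3
    refine ⟨r * γ, mul_ne_zero ?_ hγ, M, hM, ?_⟩
    · rintro rfl; simp at h; exact hI0 h
    · rw [h, hM2, ← mul_assoc, Ideal.span_singleton_mul_span_singleton, map_mul]
  obtain ⟨P, hPmax, hPI⟩ := Ideal.exists_le_maximal I htop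
  have hP := hPmax.isPrime
  have hP0 : P ≠ ⊥ := by rintro rfl; exact hI0 (le_bot_iff.1 hPI)
  obtain ⟨J, hJ⟩ := Ideal.dvd_iff_le.2 hPI
  by_cases hPσ : P.map σ = P
  · by_cases hT : ∀ s, s - σ s ∈ P
    · obtain ⟨h1, h2, h3⟩ := step P J hJ hP.ne_top hPσ
      obtain ⟨γ, hγ, M, hM, hM2⟩ := ih J h1 h2 h3
      refine ⟨γ, hγ, P ::ₘ M, ?_, ?_⟩
      · intro Q hQ
        rcases Multiset.mem_cons.1 hQ with rfl | hQ
        · exact ⟨hP, hP0, hT⟩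
        · exact hM Q hQ
      · rw [hJ, hM2, Multiset.prod_cons]; ring
    · push Not at hT
      obtain ⟨s, hs⟩ := hT
      obtain ⟨r, hr⟩ := Ideal.exists_eq_span_of_map_eq hσ hfix hP hP0 hPσ hs
      exact viaSpan r J (by rw [← hr, hJ]) (by rw [← hr]; exact hP.ne_top)
  · have hmax' : (P.map σ).IsMaximal := by
      have := Ideal.map_eq_top_or_isMaximal_of_surjective σ.toRingEquiv.toRingHom σ.surjective hPmax
      rcases this with h | h
      · exfalso
        apply hP.ne_top
        have h : P.map σ = ⊤ := h
        rw [← Ideal.map_map_of_involutive hσ P, h, Ideal.map_top]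
      · exact h
    have hle : I ≤ P.map σ := by rw [← hIσ]; exact Ideal.map_mono hPI
    have hσP0 : P.map σ ≠ ⊥ := by rintro h; exact hI0 (le_bot_iff.1 (h ▸ hle))
    have hpr : Prime (P.map σ) := Ideal.prime_of_isPrime hσP0 hmax'.isPrime
    have hd : P.map σ ∣ P * J := by rw [← hJ]; exact Ideal.dvd_iff_le.2 hle
    rcases hpr.dvd_or_dvd hd with h | ⟨J', rfl⟩
    · exact absurd (hPmax.eq_of_le hmax'.ne_top (Ideal.dvd_iff_le.1 h)).symm hPσ
    · obtain ⟨r, hr⟩ := Ideal.exists_mul_map_eq_span hσ hfix P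
      refine viaSpan r J' (by rw [← hr, hJ]; ring) ?_
      rw [← hr]
      intro h
      exact hP.ne_top (top_le_iff.1 (h ▸ Ideal.mul_le_left))

end QuadraticConjugation

section ClassRepresentatives

variable {S : Type*} [CommRing S] [IsDedekindDomain S]

/-- Every ideal class contains an integral ideal prime to a given one. -/
theorem ClassGroup.exists_mk0_eq_sup_eq_top (c : ClassGroup S) {N : Ideal S} (hN : N ≠ ⊥) :
    ∃ I : (Ideal S)⁰, ClassGroup.mk0 I = c ∧ (I : Ideal S) ⊔ N = ⊤ := by
  by_cases hNt : N = ⊤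
  · obtain ⟨I, hI⟩ := ClassGroup.mk0_surjective c
    exact ⟨I, hI, by rw [hNt, sup_top_eq]⟩
  obtain ⟨A, hA⟩ := ClassGroup.mk0_surjective c⁻¹
  have hA0 : (A : Ideal S) ≠ 0 := nonZeroDivisors.coe_ne_zero A
  obtain ⟨a, ha⟩ := IsDedekindDomain.exists_sup_span_eq (I := (A : Ideal S) * N) (J := A) Ideal.mul_le_left
    (mul_ne_zero hA0 hN)
  have ha0 : a ≠ 0 := by
    rintro rfl
    rw [Ideal.span_singleton_eq_bot.2 rfl, sup_bot_eq] at ha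
    apply hNt
    rw [← Ideal.one_eq_top]
    exact mul_left_cancel₀ hA0 (by rw [ha, mul_one])
  obtain ⟨B, hB⟩ := Ideal.dvd_iff_le.2 (le_sup_right.trans ha.le : Ideal.span {a} ≤ A)
  have hB0 : B ≠ 0 := by
    rintro rfl
    rw [mul_zero] at hB
    exact ha0 (Ideal.span_singleton_eq_bot.1 hB)
  refine ⟨⟨B, mem_nonZeroDivisors_of_ne_zero hB0⟩, ?_, ?_⟩
  · rw [← inv_inv c, ← hA, eq_inv_iff_mul_eq_one, ← map_mul, ClassGroup.mk0_eq_one_iff,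
      Submonoid.coe_mul, mul_comm, ← hB]
    exact ⟨⟨a, rfl⟩⟩
  · rw [hB, ← Ideal.add_eq_sup, ← mul_add] at ha
    rw [← Ideal.one_eq_top, ← Ideal.add_eq_sup, add_comm]
    exact mul_left_cancel₀ hA0 (by rw [ha, mul_one])

theorem ClassGroup.mk0_eq_one_iff_exists {I : (Ideal S)⁰} :
    ClassGroup.mk0 I = 1 ↔ ∃ z, z ≠ 0 ∧ (I : Ideal S) = Ideal.span {z} := by
  rw [ClassGroup.mk0_eq_one_iff]
  constructor
  · rintro ⟨z, hz⟩
    refine ⟨z, ?_, hz⟩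
    rintro rfl
    exact nonZeroDivisors.coe_ne_zero I (by rw [hz]; simp)
  · rintro ⟨z, -, hz⟩
    exact ⟨z, hz⟩

end ClassRepresentatives

section Ambiguous

variable {R S : Type*} [CommRing R] [IsDomain R] [IsPrincipalIdealRing R]
  [CommRing S] [IsDedekindDomain S] [Algebra R S] [FaithfulSMul R S]
  {σ : S ≃ₐ[R] S} (hσ : ∀ x, σ (σ x) = x)
  (hfix : ∀ x, σ x = x → ∃ r, algebraMap R S r = x)

include hσ hfix

omit [IsDomain R] in
theorem ClassGroup.exists_map_eq_of_sq_eq_one {d : S} (hd0 : d ≠ 0) (hd : σ d = -d)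
    {N : Ideal S} (hN : N ≠ ⊥)
    (hUC : ∀ (η : Rˣ) (z : S) (r : R), z * σ z = algebraMap R S (η * r ^ 2) →
      Ideal.span {z} ⊔ N = ⊤ → ∃ v : Sˣ, (v * σ v : S) = algebraMap R S η)
    {c : ClassGroup S} (hc : c ^ 2 = 1) :
    ∃ J : (Ideal S)⁰, ClassGroup.mk0 J = c ∧ (J : Ideal S).map σ = J := by
  obtain ⟨I, rfl, hIN⟩ := ClassGroup.exists_mk0_eq_sup_eq_top c hN
  have hI0 : (I : Ideal S) ≠ 0 := nonZeroDivisors.coe_ne_zero I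
  rw [← map_pow, ClassGroup.mk0_eq_one_iff_exists] at hc
  obtain ⟨z, hz0, hz⟩ := hc
  rw [SubmonoidClass.coe_pow] at hz
  obtain ⟨r, hr⟩ := Ideal.exists_mul_map_eq_span hσ hfix (I : Ideal S)
  have hinj := FaithfulSMul.algebraMap_injective R S
  have hr0 : r ≠ 0 := by
    rintro rfl
    rw [map_zero, Ideal.span_singleton_eq_bot.2 rfl] at hr
    rcases mul_eq_zero.1 hr with h | h
    · exact hI0 h
    · apply hI0
      rw [← Ideal.map_map_of_involutive hσ (I : Ideal S), h]
      exact Ideal.map_bot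
  have hrS : algebraMap R S r ≠ 0 := by simpa using hr0
  have hzN : Ideal.span {z} ⊔ N = ⊤ := by
    rw [← hz]; exact Ideal.isCoprime_iff_sup_eq.1 ((Ideal.isCoprime_iff_sup_eq.2 hIN).pow_left)
  have hass : Associated (algebraMap R S (r ^ 2)) (z * σ z) := by
    rw [← Ideal.span_singleton_eq_span_singleton, map_pow, ← Ideal.span_singleton_pow, ← hr,
      mul_pow, ← Ideal.map_pow, hz, Ideal.map_span, Set.image_singleton,
      Ideal.span_singleton_mul_span_singleton]
  obtain ⟨u, hu⟩ := hass
  have hfixu : σ (u : S) = u := by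
    apply mul_left_cancel₀ (show algebraMap R S (r ^ 2) ≠ 0 by rw [map_pow]; exact pow_ne_zero 2 hrS)
    rw [hu]
    have := congrArg σ hu
    rw [map_mul, AlgEquiv.commutes, map_mul, hσ] at this
    rw [this, mul_comm]
  have hfixu' : σ (↑u⁻¹ : S) = ↑u⁻¹ := by
    have h1 : (u : S) * σ (↑u⁻¹ : S) = 1 := by
      rw [← hfixu, ← map_mul, Units.mul_inv, map_one]
    exact u.isUnit.mul_left_cancel (by rw [h1, Units.mul_inv])
  obtain ⟨a, ha⟩ := hfix _ hfixu
  obtain ⟨b, hb⟩ := hfix _ hfixu'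
  have hab : a * b = 1 := hinj (by rw [map_mul, ha, hb, Units.mul_inv, map_one])
  obtain ⟨v, hv⟩ := hUC ⟨a, b, hab, by rw [mul_comm, hab]⟩ z r
    (by rw [← hu, Units.val_mk, map_mul, ha, mul_comm]) hzN
  rw [Units.val_mk, ha] at hv
  set w : S := algebraMap R S r * v with hw
  have hw0 : w ≠ 0 := mul_ne_zero hrS v.ne_zero
  have hww : w * σ w = z * σ z := by
    rw [← hu, ← hv, hw, map_mul, AlgEquiv.commutes, map_pow]; ring
  obtain ⟨y, hy0, hy⟩ : ∃ y : S, y ≠ 0 ∧ z * σ y = w * y := by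
    by_cases h : z + σ w = 0
    · refine ⟨d * σ w, mul_ne_zero hd0 (by simpa using hw0), ?_⟩
      rw [map_mul, hσ, hd, eq_neg_of_add_eq_zero_left h]; ring
    · refine ⟨z + σ w, h, ?_⟩
      rw [map_add, hσ]; linear_combination -hww
  have hσy0 : σ y ≠ 0 := by simpa using hy0
  have hJ0 : (I : Ideal S) * Ideal.span {σ y} ≠ 0 :=
    mul_ne_zero hI0 (by simpa using hσy0)
  refine ⟨⟨_, mem_nonZeroDivisors_of_ne_zero hJ0⟩, ?_, ?_⟩
  · rw [ClassGroup.mk0_eq_mk0_iff]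
    refine ⟨1, σ y, one_ne_zero, hσy0, ?_⟩
    simp [mul_comm]
  · show Ideal.map σ ((I : Ideal S) * Ideal.span {σ y}) = (I : Ideal S) * Ideal.span {σ y}
    rw [Ideal.map_mul, Ideal.map_span, Set.image_singleton]
    have e1 : (σ : S → S) (σ y) = y := hσ y
    rw [show (σ : S ≃ₐ[R] S) (σ y) = y from hσ y]
    apply mul_left_cancel₀ (show Ideal.span {z} ≠ 0 by simpa using hz0)
    calc Ideal.span {z} * (Ideal.map σ (I : Ideal S) * Ideal.span {y})
        = I * (I * Ideal.map σ (I : Ideal S)) * Ideal.span {y} := by rw [← hz]; ring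
      _ = I * (Ideal.span {algebraMap R S r} * Ideal.span {y}) := by rw [hr]; ring
      _ = I * Ideal.span {w * y} := by
          rw [Ideal.span_singleton_mul_span_singleton]
          congr 1
          rw [Ideal.span_singleton_eq_span_singleton]
          exact ⟨v, by rw [hw]; ring⟩
      _ = Ideal.span {z} * (I * Ideal.span {σ y}) := by
          rw [← hy, ← Ideal.span_singleton_mul_span_singleton]; ring

/-- Conjugation-invariant ideal classes are generated by the primes with trivial residue action. -/
theorem ClassGroup.mk0_mem_closure_of_map_eq (J : (Ideal S)⁰) (hJ : (J : Ideal S).map σ = J) :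
    ClassGroup.mk0 J ∈ Subgroup.closure {c | ∃ P : (Ideal S)⁰, (P : Ideal S).IsPrime ∧
      (∀ s, s - σ s ∈ (P : Ideal S)) ∧ ClassGroup.mk0 P = c} := by
  obtain ⟨γ, hγ, M, hM, hJM⟩ := Ideal.exists_eq_span_mul_prod hσ hfix (J : Ideal S)
    (nonZeroDivisors.coe_ne_zero J) hJ
  have key : ∀ M : Multiset (Ideal S), (∀ P ∈ M, P.IsPrime ∧ P ≠ ⊥ ∧ ∀ s, s - σ s ∈ P) →
      ∃ A : (Ideal S)⁰, (A : Ideal S) = M.prod ∧ ClassGroup.mk0 A ∈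
      Subgroup.closure {c | ∃ P : (Ideal S)⁰, (P : Ideal S).IsPrime ∧
      (∀ s, s - σ s ∈ (P : Ideal S)) ∧ ClassGroup.mk0 P = c} := by
    intro M
    induction M using Multiset.induction with
    | empty => exact fun _ => ⟨1, by simp, by rw [map_one]; exact one_mem _⟩
    | cons P M ih =>
      intro h
      obtain ⟨A, hA, hA2⟩ := ih fun Q hQ => h Q (Multiset.mem_cons_of_mem hQ)
      obtain ⟨h1, h2, h3⟩ := h P (Multiset.mem_cons_self P M)
      refine ⟨⟨P, mem_nonZeroDivisors_of_ne_zero h2⟩ * A, by simp [hA], ?_⟩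
      rw [map_mul]
      exact mul_mem (Subgroup.subset_closure ⟨_, h1, h3, rfl⟩) hA2
  obtain ⟨A, hA, hA2⟩ := key M hM
  convert hA2 using 1
  rw [ClassGroup.mk0_eq_mk0_iff]
  exact ⟨1, algebraMap R S γ, one_ne_zero, by simpa using hγ, by rw [hA, ← hJM]; simp⟩

end Ambiguous

section ResidueFields

variable {R S : Type*} [CommRing R] [CommRing S] [IsDomain S] [CharZero S] [Algebra R S]
  [FaithfulSMul R S] {σ : S ≃ₐ[R] S} (hσ : ∀ x, σ (σ x) = x)
  (hfix : ∀ x, σ x = x → ∃ r, algebraMap R S r = x)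
  {ℓ ℓ' : ℕ} (hℓ : ℓ.Prime) (hℓ2 : ℓ ≠ 2) (hℓ' : ℓ.Coprime ℓ')
  {δ : S} (hδ : δ ^ 2 = -(ℓ * ℓ')) (hσδ : σ δ = -δ)
  (hF : ∀ x : R, (ℓ : R) ∣ x ^ ℓ ^ 2 - x)
  {k : Type*} [Field k] (φ : S →+* k) (hφ : φ ℓ = 0)

include hσ hfix hℓ hℓ' hδ hσδ hF hφ

/-- The conjugation acts trivially on residue fields of ramified characteristic. -/
theorem map_conj_eq_of_ramified (s : S) : φ (σ s) = φ s := by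
  set d := s - σ s with hd
  have hσd : σ d = -d := by rw [hd, map_sub, hσ]; ring
  obtain ⟨D, hD⟩ := hfix (d ^ 2) (by rw [map_pow, hσd]; ring)
  obtain ⟨e, he⟩ := hfix (d * δ) (by rw [map_mul, hσd, hσδ]; ring)
  have hinj := FaithfulSMul.algebraMap_injective R S
  have h1 : e ^ 2 = -(ℓ * ℓ' * D) := by
    apply hinj
    rw [map_pow, he, map_neg, map_mul, hD, mul_pow, hδ]
    push_cast; ring
  have hℓ1 := hℓ.two_le
  obtain ⟨n, hn⟩ : ∃ n, ℓ ^ 2 = 2 + n := Nat.exists_eq_add_of_le (by nlinarith)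
  have h2 : (ℓ : R) ∣ e := by
    have h3 : (ℓ : R) ∣ e ^ ℓ ^ 2 := by
      rw [hn, pow_add, h1]
      exact Dvd.dvd.mul_right ((dvd_neg).2 ⟨ℓ' * D, by ring⟩) _
    have := dvd_sub h3 (hF e)
    rwa [sub_sub_cancel] at this
  obtain ⟨e', rfl⟩ := h2
  have hℓ0 : (ℓ : S) ≠ 0 := by exact_mod_cast hℓ.ne_zero
  have hdφ : φ d = 0 := by
    obtain ⟨a, b, hab⟩ := (Nat.isCoprime_iff_coprime.2 hℓ')
    have hab' : (a : k) * φ ℓ + b * φ ℓ' = 1 := by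
      have := congrArg (Int.cast : ℤ → k) hab
      push_cast at this; simpa using this
    rw [hφ, mul_zero, zero_add] at hab'
    have h4 : (ℓ' : S) * d ^ 2 = -(ℓ * algebraMap R S e' ^ 2) := by
      apply mul_left_cancel₀ hℓ0
      have := congrArg (algebraMap R S) h1
      simp only [map_mul, map_pow, map_neg, map_natCast, hD] at this
      linear_combination this
    have h5 := congrArg φ h4
    rw [map_mul, map_neg, map_mul, hφ, zero_mul, neg_zero, map_pow] at h5
    rcases mul_eq_zero.1 h5 with h | h
    · rw [h, mul_zero] at hab'; exact absurd hab' zero_ne_one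
    · exact pow_eq_zero_iff two_ne_zero |>.1 h
  rw [hd, map_sub, sub_eq_zero] at hdφ
  exact hdφ.symm

include hℓ2

theorem map_pow_sq_eq_of_ramified (t : S) : φ t ^ ℓ ^ 2 = φ t := by
  have hR : ∀ x : R, φ (algebraMap R S x) ^ ℓ ^ 2 = φ (algebraMap R S x) := fun x => by
    obtain ⟨y, hy⟩ := hF x
    have := congrArg (fun x => φ (algebraMap R S x)) hy
    simp only [map_sub, map_pow, map_mul, map_natCast] at this hφ
    rw [hφ, zero_mul, sub_eq_zero] at this
    exact this
  obtain ⟨c, hc⟩ := hfix (t + σ t) (by rw [map_add, hσ, add_comm])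
  have h2t : φ (algebraMap R S c) = 2 * φ t := by
    rw [hc, map_add, map_conj_eq_of_ramified hσ hfix hℓ hℓ' hδ hσδ hF φ hφ]; ring
  have h2 := hR 2
  rw [map_ofNat, map_ofNat] at h2
  have hc2 := hR c
  rw [h2t, mul_pow, h2] at hc2
  refine mul_left_cancel₀ ?_ hc2
  intro h0
  have hcop : ℓ.Coprime 2 := (Nat.coprime_primes hℓ Nat.prime_two).2 hℓ2
  obtain ⟨a, b, hab⟩ := (Nat.isCoprime_iff_coprime.2 hcop)
  have hab' := congrArg (Int.cast : ℤ → k) hab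
  push_cast at hab'
  rw [map_natCast] at hφ
  rw [hφ, h0] at hab'
  simp at hab'

theorem map_pow_sq_sub_one_eq_of_ramified {t : S} (ht : φ t ≠ 0) : φ t ^ (ℓ ^ 2 - 1) = 1 := by
  have := map_pow_sq_eq_of_ramified hσ hfix hℓ hℓ2 hℓ' hδ hσδ hF φ hφ t
  have hℓ1 := hℓ.two_le
  obtain ⟨n, hn⟩ : ∃ n, ℓ ^ 2 = n + 1 := Nat.exists_eq_add_of_le' (by nlinarith)
  rw [hn, pow_succ] at this
  rw [hn, Nat.add_sub_cancel]
  exact mul_right_cancel₀ ht (by rw [this, one_mul])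

/-- Elements whose image is a square satisfy Euler's criterion. -/
theorem map_pow_half_eq_one_of_ramified {a r z : S} (h : φ a * φ r ^ 2 = φ z ^ 2) (hz : φ z ≠ 0) :
    φ a ^ ((ℓ ^ 2 - 1) / 2) = 1 := by
  have hr : φ r ≠ 0 := by
    rintro h0; rw [h0] at h; apply hz
    exact pow_eq_zero_iff two_ne_zero |>.1 (by rw [← h]; ring)
  have hev : 2 * ((ℓ ^ 2 - 1) / 2) = ℓ ^ 2 - 1 := by
    apply Nat.mul_div_cancel'
    obtain ⟨n, rfl⟩ := hℓ.odd_of_ne_two hℓ2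
    exact ⟨2 * n ^ 2 + 2 * n, by
      rw [show (2 * n + 1) ^ 2 = 2 * (2 * n ^ 2 + 2 * n) + 1 by ring]; simp⟩
  have h1 := map_pow_sq_sub_one_eq_of_ramified hσ hfix hℓ hℓ2 hℓ' hδ hσδ hF φ hφ hz
  have h2 := map_pow_sq_sub_one_eq_of_ramified hσ hfix hℓ hℓ2 hℓ' hδ hσδ hF φ hφ hr
  have := congrArg (· ^ ((ℓ ^ 2 - 1) / 2)) h
  simp only [mul_pow, ← pow_mul, hev, h1, h2, mul_one] at this
  exact this

end ResidueFields

section ResidueUnits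

variable {k : Type*} [Field k] {ℓ : ℕ} [Fact ℓ.Prime] [CharP k ℓ]

theorem intCast_pow_half_eq_legendreSym (a : ℤ) : (a : k) ^ (ℓ / 2) = (legendreSym ℓ a : k) := by
  have := congrArg (ZMod.castHom dvd_rfl k) (legendreSym.eq_pow ℓ a)
  simpa using this.symm

/-- `1 + √2` has norm `-1` in characteristic `ℓ` when `2` is not a square modulo `ℓ`. -/
theorem one_add_sqrt_two_pow (hl2 : legendreSym ℓ 2 = -1) (hℓ2 : ℓ ≠ 2) {s : k} (hs : s ^ 2 = 2) :
    (1 + s) ^ (ℓ + 1) = -1 := by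
  have h := intCast_pow_half_eq_legendreSym (k := k) (ℓ := ℓ) 2
  rw [hl2] at h
  push_cast at h
  have hsl : s ^ ℓ = -s := by
    have : ℓ = 2 * (ℓ / 2) + 1 := by
      have := (Fact.out (p := ℓ.Prime)).eq_two_or_odd; omega
    rw [this, pow_succ, pow_mul, hs, h]; ring
  rw [pow_succ, add_pow_char, hsl, one_pow]
  linear_combination -hs

theorem pow_half_of_pow_four {z : k} (hz : z ^ 4 = -1) (h : ℓ % 8 = 3 ∨ ℓ % 8 = 5) :
    z ^ ((ℓ ^ 2 - 1) / 2) = -1 := by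
  obtain ⟨n, hn⟩ : ∃ n, (ℓ ^ 2 - 1) / 2 = 4 * (2 * n + 1) := by
    rcases h with h | h
    · obtain ⟨a, rfl⟩ : ∃ a, ℓ = 8 * a + 3 := ⟨ℓ / 8, by omega⟩
      refine ⟨4 * a ^ 2 + 3 * a, ?_⟩
      rw [show (8 * a + 3) ^ 2 = 2 * (4 * (2 * (4 * a ^ 2 + 3 * a) + 1)) + 1 by ring]; simp
    · obtain ⟨a, rfl⟩ : ∃ a, ℓ = 8 * a + 5 := ⟨ℓ / 8, by omega⟩
      refine ⟨4 * a ^ 2 + 5 * a + 1, ?_⟩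
      rw [show (8 * a + 5) ^ 2 = 2 * (4 * (2 * (4 * a ^ 2 + 5 * a + 1) + 1)) + 1 by ring]; simp
  rw [hn, pow_mul, hz, pow_succ, pow_mul]; norm_num

theorem one_add_sqrt_two_pow_half_of_five (hℓ : ℓ % 8 = 5) {s : k} (hs : s ^ 2 = 2) :
    (1 + s) ^ ((ℓ ^ 2 - 1) / 2) = 1 := by
  obtain ⟨a, ha⟩ : ∃ a, ℓ = 8 * a + 5 := ⟨ℓ / 8, by omega⟩
  have h := one_add_sqrt_two_pow (legendreSym_two_of_five hℓ) (by omega) hs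
  have : (ℓ ^ 2 - 1) / 2 = (ℓ + 1) * (2 * (2 * a + 1)) := by
    rw [ha, show (8 * a + 5) ^ 2 = 2 * ((8 * a + 5 + 1) * (2 * (2 * a + 1))) + 1 by ring]; simp
  rw [this, pow_mul, h, pow_mul]; norm_num

theorem one_add_sqrt_two_pow_half_of_three (hℓ : ℓ % 8 = 3) {s : k} (hs : s ^ 2 = 2) :
    (1 + s) ^ ((ℓ ^ 2 - 1) / 2) = -1 := by
  obtain ⟨a, ha⟩ : ∃ a, ℓ = 8 * a + 3 := ⟨ℓ / 8, by omega⟩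
  have h := one_add_sqrt_two_pow (legendreSym_two_of_three hℓ) (by omega) hs
  have : (ℓ ^ 2 - 1) / 2 = (ℓ + 1) * (2 * (2 * a) + 1) := by
    rw [ha, show (8 * a + 3) ^ 2 = 2 * ((8 * a + 3 + 1) * (2 * (2 * a) + 1)) + 1 by ring]; simp
  rw [this, pow_mul, h, pow_succ, pow_mul]; norm_num

theorem sqrt_two_pow_half_of_five (hℓ : ℓ % 8 = 5) {s : k} (hs : s ^ 2 = 2) :
    s ^ ((ℓ ^ 2 - 1) / 2) = -1 := by
  obtain ⟨a, ha⟩ : ∃ a, ℓ = 8 * a + 5 := ⟨ℓ / 8, by omega⟩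
  have h := intCast_pow_half_eq_legendreSym (k := k) (ℓ := ℓ) 2
  rw [legendreSym_two_of_five hℓ] at h
  push_cast at h
  have : (ℓ ^ 2 - 1) / 2 = 2 * (ℓ / 2 * (2 * (2 * a + 1) + 1)) := by
    rw [show ℓ / 2 = 4 * a + 2 by omega, ha,
      show (8 * a + 5) ^ 2 = 2 * (2 * ((4 * a + 2) * (2 * (2 * a + 1) + 1))) + 1 by ring]; simp
  rw [this, pow_mul, hs, pow_mul, h, pow_succ, pow_mul]; norm_num

end ResidueUnits

/-- The arithmetic of the ring of integers `S` of `ℚ(ζ₈, √(-pq))` over the ring of integers `R` of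
`ℚ(ζ₈)`: `σ` is the conjugation over `R`, while `τ` and `τ'` fix `δ = √(-pq)` and map `ζ` to `ζ⁻¹`
and `-ζ` respectively. -/
structure IsOcticExtension {R S : Type*} [CommRing R] [CommRing S] [Algebra R S] (p q : ℕ)
    (σ : S ≃ₐ[R] S) (τ τ' : S ≃+* S) (ζ : R) (δ θ : S) : Prop where
  mod_p : p % 8 = 5
  mod_q : q % 8 = 3
  pell : ∃ x y : ℤ, (p : ℤ) * x ^ 2 - q * y ^ 2 = 1
  pell_two : ∃ a b : ℤ, (q : ℤ) * a ^ 2 - 2 * p * b ^ 2 = 1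
  zeta_pow : ζ ^ 4 = -1
  delta_sq : δ ^ 2 = -(p * q)
  two_mul_theta : 2 * θ = 1 + δ
  conj_conj : ∀ x, σ (σ x) = x
  conj_fix : ∀ x, σ x = x → ∃ r, algebraMap R S r = x
  conj_delta : σ δ = -δ
  tau_tau : ∀ x, τ (τ x) = x
  tau_zeta : τ (algebraMap R S ζ) = -algebraMap R S ζ ^ 3
  tau_delta : τ δ = δ
  tau'_zeta : τ' (algebraMap R S ζ) = -algebraMap R S ζ
  tau'_delta : τ' δ = δ
  frob_p : ∀ x : R, (p : R) ∣ x ^ p ^ 2 - x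
  frob_q : ∀ x : R, (q : R) ∣ x ^ q ^ 2 - x
  base_units : ∀ η : Rˣ, ∃ s : R, (η : R) = s ^ 2 ∨ (η : R) = ζ * s ^ 2 ∨
    (η : R) = (1 + (ζ - ζ ^ 3)) * s ^ 2 ∨ (η : R) = ζ * (1 + (ζ - ζ ^ 3)) * s ^ 2
  tau_units : ∀ w : Sˣ, τ w = w → ∃ s : S, (w : S) = s ^ 2 ∨ (w : S) = -s ^ 2 ∨
    (w : S) = algebraMap R S (1 + (ζ - ζ ^ 3)) * s ^ 2 ∨
    (w : S) = -algebraMap R S (1 + (ζ - ζ ^ 3)) * s ^ 2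
  finrank : Module.finrank ℤ S = 8

theorem exists_ringHom_field_of_not_isUnit {S : Type u} [CommRing S] {a : S} (ha : ¬ IsUnit a) :
    ∃ (k : Type u) (_ : Field k) (φ : S →+* k), φ a = 0 := by
  obtain ⟨P, hP, h⟩ := exists_max_ideal_of_mem_nonunits ha
  exact ⟨S ⧸ P, Ideal.Quotient.field P, Ideal.Quotient.mk P, Ideal.Quotient.eq_zero_iff_mem.2 h⟩

theorem map_ne_zero_of_span_sup_eq_top {S k : Type*} [CommRing S] [Field k] (φ : S →+* k)
    {z a : S} (h : Ideal.span {z} ⊔ Ideal.span {a} = ⊤) (ha : φ a = 0) : φ z ≠ 0 := by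
  intro hz
  obtain ⟨b, hb, c, hc, e⟩ := Submodule.mem_sup.1 ((Ideal.eq_top_iff_one _).1 h)
  obtain ⟨b, rfl⟩ := Ideal.mem_span_singleton'.1 hb
  obtain ⟨c, rfl⟩ := Ideal.mem_span_singleton'.1 hc
  have := congrArg φ e
  simp [hz, ha] at this

theorem isUnit_natCast_of_sq_eq {R : Type*} [CommRing R] [IsDomain R] {ℓ : ℕ} (hℓ : 2 ≤ ℓ)
    (hℓ0 : (ℓ : R) ≠ 0) (hF : ∀ x : R, (ℓ : R) ∣ x ^ ℓ ^ 2 - x) {r c : R} (hc : IsUnit c)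
    (hr : r ^ 2 = c * ℓ) : IsUnit (ℓ : R) := by
  have h1 : (ℓ : R) ∣ r ^ ℓ ^ 2 := (Dvd.intro_left c hr.symm).trans (pow_dvd_pow r (by nlinarith))
  obtain ⟨s, rfl⟩ := (dvd_sub_right h1).1 (hF r)
  have h2 : (ℓ : R) * s ^ 2 = c := mul_left_cancel₀ hℓ0 (by linear_combination hr)
  exact isUnit_of_dvd_unit (Dvd.intro _ h2) hc

namespace IsOcticExtension

variable {R : Type v} {S : Type u} [CommRing R] [IsDomain R] [IsPrincipalIdealRing R]
  [CommRing S] [IsDedekindDomain S] [Module.Free ℤ S] [Module.Finite ℤ S] [CharZero S]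
  [Algebra R S] [FaithfulSMul R S]
  {p q : ℕ} [hpP : Fact p.Prime] [hqP : Fact q.Prime]
  {σ : S ≃ₐ[R] S} {τ τ' : S ≃+* S} {ζ : R} {δ θ : S}
  (h : IsOcticExtension p q σ τ τ' ζ δ θ)

include h

theorem absNorm_natCast (ℓ : ℕ) : Ideal.absNorm (Ideal.span {(ℓ : S)}) = ℓ ^ 8 := by
  rw [Ideal.absNorm_span_natCast, h.finrank]

theorem not_isUnit_natCast {ℓ : ℕ} (hℓ : ℓ.Prime) : ¬ IsUnit (ℓ : S) := by
  intro hu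
  have := h.absNorm_natCast ℓ
  rw [Ideal.span_singleton_eq_top.2 hu, Ideal.absNorm_top] at this
  exact hℓ.one_lt.ne' (Nat.pow_eq_one.1 this.symm |>.resolve_right (by norm_num))

theorem coprime : p.Coprime q := by
  refine (Nat.coprime_primes hpP.out hqP.out).2 ?_
  have := h.mod_p; have := h.mod_q
  omega

section Field
variable {k : Type*} [Field k] (φ : S →+* k)

theorem map_conj_p (hφ : φ p = 0) (s : S) : φ (σ s) = φ s :=
  map_conj_eq_of_ramified h.conj_conj h.conj_fix hpP.out h.coprime h.delta_sq h.conj_delta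
    h.frob_p φ hφ s

theorem map_conj_q (hφ : φ q = 0) (s : S) : φ (σ s) = φ s :=
  map_conj_eq_of_ramified h.conj_conj h.conj_fix hqP.out h.coprime.symm
    (by rw [h.delta_sq]; ring) h.conj_delta h.frob_q φ hφ s

theorem map_pow_half_p (hφ : φ p = 0) {a r z : S} (e : φ a * φ r ^ 2 = φ z ^ 2) (hz : φ z ≠ 0) :
    φ a ^ ((p ^ 2 - 1) / 2) = 1 :=
  map_pow_half_eq_one_of_ramified h.conj_conj h.conj_fix hpP.out
    (by have := h.mod_p; rintro rfl; omega) h.coprime h.delta_sq h.conj_delta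
    h.frob_p φ hφ e hz

theorem map_pow_half_q (hφ : φ q = 0) {a r z : S} (e : φ a * φ r ^ 2 = φ z ^ 2) (hz : φ z ≠ 0) :
    φ a ^ ((q ^ 2 - 1) / 2) = 1 :=
  map_pow_half_eq_one_of_ramified h.conj_conj h.conj_fix hqP.out
    (by have := h.mod_q; rintro rfl; omega) h.coprime.symm (by rw [h.delta_sq]; ring) h.conj_delta
    h.frob_q φ hφ e hz

theorem map_zeta_pow : φ (algebraMap R S ζ) ^ 4 = -1 := by
  rw [← map_pow, ← map_pow, h.zeta_pow]; simp

theorem map_sqrt_two_sq :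
    (φ (algebraMap R S ζ) - φ (algebraMap R S ζ) ^ 3) ^ 2 = 2 := by
  have := h.map_zeta_pow φ
  linear_combination (φ (algebraMap R S ζ) ^ 2 - 2) * this

theorem charP_p (hφ : φ p = 0) : CharP k p := by
  rw [map_natCast] at hφ
  exact (CharP.charP_iff_prime_eq_zero hpP.out).2 hφ

theorem charP_q (hφ : φ q = 0) : CharP k q := by
  rw [map_natCast] at hφ
  exact (CharP.charP_iff_prime_eq_zero hqP.out).2 hφ

theorem neg_one_ne_one_p (hφ : φ p = 0) : (-1 : k) ≠ 1 := by
  have := h.charP_p φ hφ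
  have := h.mod_p
  have : Fact (2 < p) := ⟨by omega⟩
  exact CharP.neg_one_ne_one k p

theorem neg_one_ne_one_q (hφ : φ q = 0) : (-1 : k) ≠ 1 := by
  have := h.charP_q φ hφ
  have := h.mod_q
  have : Fact (2 < q) := ⟨by omega⟩
  exact CharP.neg_one_ne_one k q

end Field
end IsOcticExtension

theorem exists_eq_sq_of_mul_sq_eq {S : Type*} [CommRing S] [IsDomain S] [IsIntegrallyClosed S]
    {A t v : S} (e : A * t ^ 2 = v ^ 2) (ht : t ≠ 0) : ∃ t', A = t' ^ 2 := by
  obtain ⟨t', rfl⟩ : t ∣ v := by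
    rw [← IsIntegrallyClosed.pow_dvd_pow_iff (n := 2) two_ne_zero]
    exact Dvd.intro_left _ e
  exact ⟨t', mul_right_cancel₀ (pow_ne_zero 2 ht) (by rw [e]; ring)⟩

namespace IsOcticExtension

variable {R : Type v} {S : Type u} [CommRing R] [IsDomain R] [IsPrincipalIdealRing R]
  [CommRing S] [IsDedekindDomain S] [Module.Free ℤ S] [Module.Finite ℤ S] [CharZero S]
  [Algebra R S] [FaithfulSMul R S]
  {p q : ℕ} [hpP : Fact p.Prime] [hqP : Fact q.Prime]
  {σ : S ≃ₐ[R] S} {τ τ' : S ≃+* S} {ζ : R} {δ θ : S}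
  (h : IsOcticExtension p q σ τ τ' ζ δ θ)

include h

theorem not_isUnit_natCast_base {ℓ : ℕ} (hℓ : ℓ.Prime) : ¬ IsUnit (ℓ : R) := fun hu =>
  h.not_isUnit_natCast hℓ (by simpa using hu.map (algebraMap R S))

theorem natCast_base_ne_zero {ℓ : ℕ} (hℓ : ℓ.Prime) : (ℓ : R) ≠ 0 := fun h0 => by
  have := congrArg (algebraMap R S) h0
  rw [map_natCast, map_zero, Nat.cast_eq_zero] at this
  exact hℓ.ne_zero this

theorem exists_ringHom_p :
    ∃ (k : Type u) (_ : Field k) (φ : S →+* k), φ p = 0 :=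
  exists_ringHom_field_of_not_isUnit (h.not_isUnit_natCast hpP.out)

theorem exists_ringHom_q :
    ∃ (k : Type u) (_ : Field k) (φ : S →+* k), φ q = 0 :=
  exists_ringHom_field_of_not_isUnit (h.not_isUnit_natCast hqP.out)

theorem zeta_pow' : algebraMap R S ζ ^ 4 = -1 := by
  rw [← map_pow, h.zeta_pow]; simp

section Field

variable {k : Type*} [Field k] (φ : S →+* k)

theorem map_zeta_pow_half_p (hφ : φ p = 0) : φ (algebraMap R S ζ) ^ ((p ^ 2 - 1) / 2) = -1 := by
  have := h.charP_p φ hφ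
  exact pow_half_of_pow_four (h.map_zeta_pow φ) (.inr h.mod_p)

theorem map_zeta_pow_half_q (hφ : φ q = 0) : φ (algebraMap R S ζ) ^ ((q ^ 2 - 1) / 2) = -1 := by
  have := h.charP_q φ hφ
  exact pow_half_of_pow_four (h.map_zeta_pow φ) (.inl h.mod_q)

theorem map_unit_pow_half_p (hφ : φ p = 0) :
    φ (algebraMap R S (1 + (ζ - ζ ^ 3))) ^ ((p ^ 2 - 1) / 2) = 1 := by
  have := h.charP_p φ hφ
  have := one_add_sqrt_two_pow_half_of_five h.mod_p (h.map_sqrt_two_sq φ)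
  simpa using this

theorem map_unit_pow_half_q (hφ : φ q = 0) :
    φ (algebraMap R S (1 + (ζ - ζ ^ 3))) ^ ((q ^ 2 - 1) / 2) = -1 := by
  have := h.charP_q φ hφ
  have := one_add_sqrt_two_pow_half_of_three h.mod_q (h.map_sqrt_two_sq φ)
  simpa using this

end Field

/-- A unit of `R` which is, up to squares, the norm of an element prime to `pq` is a square. -/
theorem exists_eq_sq_of_norm_eq (η : Rˣ) (z : S) (r : R)
    (hz : z * σ z = algebraMap R S (η * r ^ 2))
    (hcop : Ideal.span {z} ⊔ Ideal.span {(p * q : S)} = ⊤) : ∃ s : R, (η : R) = s ^ 2 := by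
  obtain ⟨s, hs⟩ := h.base_units η
  have key : ∀ c : R, (η : R) = c * s ^ 2 →
      algebraMap R S c * algebraMap R S (s * r) ^ 2 = z * σ z := by
    intro c hc
    rw [hz, hc]; simp only [map_mul, map_pow]; ring
  have hp : ∀ c : R, (η : R) = c * s ^ 2 → ∀ (k : Type u) (_ : Field k) (φ : S →+* k), φ p = 0 →
      φ (algebraMap R S c) ^ ((p ^ 2 - 1) / 2) = 1 := fun c hc k _ φ hφ =>
    h.map_pow_half_p φ hφ (r := algebraMap R S (s * r)) (z := z)
      (by rw [← map_pow, ← map_mul, key c hc, map_mul, h.map_conj_p φ hφ, sq])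
      (map_ne_zero_of_span_sup_eq_top φ hcop (by rw [map_mul, hφ, zero_mul]))
  have hq : ∀ c : R, (η : R) = c * s ^ 2 → ∀ (k : Type u) (_ : Field k) (φ : S →+* k), φ q = 0 →
      φ (algebraMap R S c) ^ ((q ^ 2 - 1) / 2) = 1 := fun c hc k _ φ hφ =>
    h.map_pow_half_q φ hφ (r := algebraMap R S (s * r)) (z := z)
      (by rw [← map_pow, ← map_mul, key c hc, map_mul, h.map_conj_q φ hφ, sq])
      (map_ne_zero_of_span_sup_eq_top φ hcop (by rw [map_mul, hφ, mul_zero]))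
  obtain ⟨k, _, φ, hφ⟩ := h.exists_ringHom_p
  obtain ⟨k', _, φ', hφ'⟩ := h.exists_ringHom_q
  rcases hs with hs | hs | hs | hs
  · exact ⟨s, hs⟩
  · exact absurd ((h.map_zeta_pow_half_p φ hφ).symm.trans (hp _ hs k _ φ hφ))
      (h.neg_one_ne_one_p φ hφ)
  · exact absurd ((h.map_unit_pow_half_q φ' hφ').symm.trans (hq _ hs k' _ φ' hφ'))
      (h.neg_one_ne_one_q φ' hφ')
  · have := hp _ hs k _ φ hφ
    rw [map_mul, map_mul, mul_pow, h.map_zeta_pow_half_p φ hφ, h.map_unit_pow_half_p φ hφ,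
      mul_one] at this
    exact absurd this (h.neg_one_ne_one_p φ hφ)

section Pell

variable {w : S} (hw : w ^ 2 = p * q) (hσw : σ w = -w) {x y : ℤ}
  (hxy : (p : ℤ) * x ^ 2 - q * y ^ 2 = 1)

include hw hσw hxy

theorem eps_mul_conj :
    ((p * x ^ 2 + q * y ^ 2 : S) + 2 * x * y * w) * σ ((p * x ^ 2 + q * y ^ 2 : S) + 2 * x * y * w)
      = 1 := by
  have : (p * x ^ 2 - q * y ^ 2 : S) = 1 := by exact_mod_cast hxy
  simp only [map_add, map_mul, map_pow, map_natCast, map_intCast, map_ofNat, hσw]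
  linear_combination -4 * (x * y : S) ^ 2 * hw + (p * x ^ 2 - q * y ^ 2 + 1 : S) * this

theorem eps_ne_sq (v : S) : (p * x ^ 2 + q * y ^ 2 : S) + 2 * x * y * w ≠ v ^ 2 := by
  intro hv
  have hpell : (p * x ^ 2 - q * y ^ 2 : S) = 1 := by exact_mod_cast hxy
  set ε : S := (p * x ^ 2 + q * y ^ 2 : S) + 2 * x * y * w with hε
  have hN : ε * σ ε = 1 := h.eps_mul_conj hw hσw hxy
  set t : S := (p * x + y * w) * σ v with ht
  have ht2 : t ^ 2 = p := by
    have h1 : (p * x + y * w : S) ^ 2 = p * ε := by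
      rw [hε]; linear_combination (y : S) ^ 2 * hw
    rw [ht, mul_pow, h1, ← map_pow, ← hv, mul_assoc, hN, mul_one]
  have hσt : (σ t) ^ 2 = t ^ 2 := by rw [← map_pow, ht2, map_natCast]
  have hinj := FaithfulSMul.algebraMap_injective R S
  rcases sq_eq_sq_iff_eq_or_eq_neg.1 hσt with h1 | h1
  · obtain ⟨r, hr⟩ := h.conj_fix t h1
    refine h.not_isUnit_natCast_base hpP.out (isUnit_natCast_of_sq_eq hpP.out.two_le
      (h.natCast_base_ne_zero hpP.out) h.frob_p isUnit_one (r := r) (hinj ?_))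
    rw [map_pow, hr, ht2]; simp
  · obtain ⟨e, he⟩ := h.conj_fix (t * δ) (by rw [map_mul, h1, h.conj_delta]; ring)
    have he2 : e ^ 2 = -(p ^ 2 * q) := hinj (by
      rw [map_pow, he]; simp only [map_neg, map_mul, map_pow, map_natCast]
      linear_combination t ^ 2 * h.delta_sq - (p * q : S) * ht2)
    have hp0 := h.natCast_base_ne_zero hpP.out
    obtain ⟨e', rfl⟩ : (p : R) ∣ e := by
      have h1 : (p : R) ∣ e ^ p ^ 2 :=
        (show (p : R) ∣ e ^ 2 from ⟨-(p * q), by rw [he2]; ring⟩).trans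
          (pow_dvd_pow _ (by nlinarith [hpP.out.two_le]))
      exact (dvd_sub_right h1).1 (h.frob_p e)
    refine h.not_isUnit_natCast_base hqP.out (isUnit_natCast_of_sq_eq hqP.out.two_le
      (h.natCast_base_ne_zero hqP.out) h.frob_q isUnit_one.neg (r := e') ?_)
    exact mul_left_cancel₀ (pow_ne_zero 2 hp0) (by linear_combination he2)

theorem eps_mul_ne_sq (v : S) :
    ((p * x ^ 2 + q * y ^ 2 : S) + 2 * x * y * w) * algebraMap R S (1 + (ζ - ζ ^ 3)) ≠ v ^ 2 := by
  intro hv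
  set ε : S := (p * x ^ 2 + q * y ^ 2 : S) + 2 * x * y * w with hε
  have hN : ε * σ ε = 1 := h.eps_mul_conj hw hσw hxy
  set ε₂ : S := algebraMap R S (1 + (ζ - ζ ^ 3)) with hε₂
  have h2 : (v * σ v) ^ 2 = ε₂ ^ 2 := by
    rw [mul_pow, ← map_pow, ← hv, map_mul, hε₂, AlgEquiv.commutes, ← hε₂]
    linear_combination ε₂ ^ 2 * hN
  obtain ⟨k, _, φ, hφ⟩ := h.exists_ringHom_q
  have hneg : (-1 : k) ^ ((q ^ 2 - 1) / 2) = 1 := by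
    have := h.map_zeta_pow φ
    rw [← this, ← pow_mul, mul_comm, pow_mul, h.map_zeta_pow_half_q φ hφ]; norm_num
  have hne := h.neg_one_ne_one_q φ hφ
  have hpow : φ ε₂ ^ ((q ^ 2 - 1) / 2) = -1 := h.map_unit_pow_half_q φ hφ
  have hv0 : φ v ≠ 0 := by
    intro h0
    have h3 := congrArg φ h2
    rw [map_pow, map_pow, map_mul, h0, zero_mul, zero_pow two_ne_zero] at h3
    have h4 := pow_eq_zero_iff two_ne_zero |>.1 h3.symm
    rw [h4, zero_pow] at hpow
    · exact one_ne_zero (neg_eq_zero.1 hpow.symm)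
    · rintro h5; rw [h5, pow_zero] at hpow; exact hne hpow.symm
  have key : ∀ c : S, v * σ v = c → φ c ^ ((q ^ 2 - 1) / 2) = 1 := fun c hc =>
    h.map_pow_half_q φ hφ (r := 1) (z := v) (by
      rw [← hc, map_mul, h.map_conj_q φ hφ, map_one]; ring) hv0
  rcases sq_eq_sq_iff_eq_or_eq_neg.1 h2 with h3 | h3
  · exact hne (hpow.symm.trans (key _ h3))
  · have := key _ h3
    rw [map_neg, neg_pow, hneg, one_mul] at this
    exact hne (hpow.symm.trans this)

variable (hτw : τ w = -w)
include hτw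

/-- An ideal of `K = ℚ(√(-pq))` whose square is in the class of the prime above `p` does not
become principal. -/
theorem sq_mul_ne_of_tau_fixed (α c : S) (W : Sˣ) (hc0 : c ≠ 0) (hc : τ c = c) :
    α ^ 2 * (p * x + y * w) ≠ c * W := by
  intro he
  have hpell : (p * x ^ 2 - q * y ^ 2 : S) = 1 := by exact_mod_cast hxy
  set ε : S := (p * x ^ 2 + q * y ^ 2 : S) + 2 * x * y * w with hε
  have hN : ε * σ ε = 1 := h.eps_mul_conj hw hσw hxy
  set β : S := p * x + y * w with hβ
  have hβ2 : β ^ 2 = p * ε := by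
    rw [hβ, hε]; linear_combination (y : S) ^ 2 * hw
  have hβτ : β * τ β = p := by
    rw [hβ]; simp only [map_add, map_mul, map_natCast, map_intCast, hτw]
    linear_combination (p : S) * hpell - (y : S) ^ 2 * hw
  set W' : S := W * τ W with hW'
  have h1 : (α * τ α) ^ 2 * p = c ^ 2 * W' := by
    have := congrArg τ he
    simp only [map_mul, map_pow, hc] at this
    rw [hW', ← hβτ]
    linear_combination τ α ^ 2 * τ β * he + c * W * this
  have h2 : (α * τ α * β) ^ 2 = c ^ 2 * (ε * W') := by
    rw [mul_pow, hβ2]; linear_combination ε * h1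
  obtain ⟨v, hv⟩ : c ∣ α * τ α * β := by
    rw [← IsIntegrallyClosed.pow_dvd_pow_iff (n := 2) two_ne_zero]
    exact Dvd.intro _ h2.symm
  have h3 : ε * W' = v ^ 2 := mul_left_cancel₀ (pow_ne_zero 2 hc0) (by rw [← h2, hv]; ring)
  have hW : τ W' = W' := by rw [hW', map_mul, h.tau_tau, mul_comm]
  obtain ⟨s, hs⟩ := h.tau_units (W * Units.map τ.toMonoidHom W) hW
  change W' = _ ∨ W' = _ ∨ W' = _ ∨ W' = _ at hs
  have hW0 : W' ≠ 0 := (W * Units.map τ.toMonoidHom W).ne_zero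
  have hz := h.zeta_pow'
  set z := algebraMap R S ζ with hzdef
  have hs0 : s ≠ 0 := by
    rintro rfl
    rcases hs with hs | hs | hs | hs <;> exact hW0 (by rw [hs]; ring)
  have hz0 : z ≠ 0 := by
    intro h0
    rw [h0] at hz
    norm_num at hz
  rcases hs with hs | hs | hs | hs
  · obtain ⟨t, ht⟩ := exists_eq_sq_of_mul_sq_eq (A := ε) (t := s) (by rw [← h3, hs]) hs0
    exact h.eps_ne_sq hw hσw hxy t ht
  · obtain ⟨t, ht⟩ := exists_eq_sq_of_mul_sq_eq (A := ε) (t := z ^ 2 * s) (by rw [← h3, hs]; linear_combination ε * s ^ 2 * hz)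
      (mul_ne_zero (pow_ne_zero 2 hz0) hs0)
    exact h.eps_ne_sq hw hσw hxy t ht
  · obtain ⟨t, ht⟩ := exists_eq_sq_of_mul_sq_eq (A := ε * algebraMap R S (1 + (ζ - ζ ^ 3))) (t := s)
      (by rw [← h3, hs, mul_assoc]) hs0
    exact h.eps_mul_ne_sq hw hσw hxy t ht
  · obtain ⟨t, ht⟩ := exists_eq_sq_of_mul_sq_eq (A := ε * algebraMap R S (1 + (ζ - ζ ^ 3))) (t := z ^ 2 * s)
      (by rw [← h3, hs]; linear_combination ε * algebraMap R S (1 + (ζ - ζ ^ 3)) * s ^ 2 * hz)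
      (mul_ne_zero (pow_ne_zero 2 hz0) hs0)
    exact h.eps_mul_ne_sq hw hσw hxy t ht

end Pell

end IsOcticExtension

/-- Two ideals agree up to principal ideals with generators in the submonoid `T`. -/
def Ideal.Rel {S : Type*} [CommRing S] (T : Submonoid S) (I J : Ideal S) : Prop :=
  ∃ s ∈ T, ∃ t ∈ T, Ideal.span {s} * I = Ideal.span {t} * J

namespace Ideal.Rel

variable {S : Type*} [CommRing S] {T : Submonoid S} {I J K I' J' : Ideal S}

theorem refl (T : Submonoid S) (I : Ideal S) : Rel T I I := ⟨1, T.one_mem, 1, T.one_mem, rfl⟩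

theorem symm (h : Rel T I J) : Rel T J I := by
  obtain ⟨s, hs, t, ht, e⟩ := h
  exact ⟨t, ht, s, hs, e.symm⟩

theorem mul (h : Rel T I J) (h' : Rel T I' J') : Rel T (I * I') (J * J') := by
  obtain ⟨s, hs, t, ht, e⟩ := h
  obtain ⟨s', hs', t', ht', e'⟩ := h'
  refine ⟨s * s', T.mul_mem hs hs', t * t', T.mul_mem ht ht', ?_⟩
  rw [← span_singleton_mul_span_singleton, ← span_singleton_mul_span_singleton,
    mul_mul_mul_comm, e, e', mul_mul_mul_comm]

theorem trans (h : Rel T I J) (h' : Rel T J K) : Rel T I K := by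
  obtain ⟨s, hs, t, ht, e⟩ := h
  obtain ⟨s', hs', t', ht', e'⟩ := h'
  refine ⟨s * s', T.mul_mem hs hs', t * t', T.mul_mem ht ht', ?_⟩
  rw [← span_singleton_mul_span_singleton, ← span_singleton_mul_span_singleton,
    mul_comm (span {s}), mul_assoc, e, mul_left_comm, e', mul_assoc]

theorem of_mul_self (h : Rel T (I * J) 1) (hJ : Rel T (J * J) 1) : Rel T I J := by
  have h1 := (refl T I).mul hJ.symm
  have h2 := h.mul (refl T J)
  rw [mul_one] at h1
  rw [one_mul] at h2
  exact h1.trans (by rwa [← mul_assoc])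

theorem span_singleton {t : S} (ht : t ∈ T) : Rel T (Ideal.span {t}) 1 :=
  ⟨1, T.one_mem, t, ht, by simp⟩

theorem mk0_eq [IsDedekindDomain S] (hT : T ≤ S⁰) {I J : (Ideal S)⁰} (h : Rel T (I : Ideal S) J) :
    ClassGroup.mk0 I = ClassGroup.mk0 J := by
  obtain ⟨s, hs, t, ht, e⟩ := h
  exact ClassGroup.mk0_eq_mk0_iff.2
    ⟨s, t, nonZeroDivisors.ne_zero (hT hs), nonZeroDivisors.ne_zero (hT ht), e⟩

/-- A product of ideals equivalent to one of two ideals `P`, `Q` with principal squares. -/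
theorem multiset_prod {P Q : Ideal S} (hP : Rel T (P * P) 1) (hQ : Rel T (Q * Q) 1)
    (M : Multiset (Ideal S)) (hM : ∀ I ∈ M, Rel T I P ∨ Rel T I Q) :
    Rel T M.prod 1 ∨ Rel T M.prod P ∨ Rel T M.prod Q ∨ Rel T M.prod (P * Q) := by
  induction M using Multiset.induction with
  | empty => exact .inl (by rw [Multiset.prod_zero]; exact refl T 1)
  | cons I M ih =>
    have ih := ih fun J hJ => hM J (Multiset.mem_cons_of_mem hJ)
    rw [Multiset.prod_cons]
    have eP : ∀ X, Rel T (P * (P * X)) X := fun X => by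
      simpa [mul_assoc] using hP.mul (refl T X)
    have eQ : ∀ X, Rel T (Q * (Q * X)) X := fun X => by
      simpa [mul_assoc] using hQ.mul (refl T X)
    rcases hM I (Multiset.mem_cons_self I M) with hI | hI <;> rcases ih with h | h | h | h
    · exact .inr (.inl (by simpa using hI.mul h))
    · exact .inl ((hI.mul h).trans hP)
    · exact .inr (.inr (.inr (hI.mul h)))
    · exact .inr (.inr (.inl ((hI.mul h).trans (eP Q))))
    · exact .inr (.inr (.inl (by simpa using hI.mul h)))
    · exact .inr (.inr (.inr (by simpa [mul_comm] using hI.mul h)))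
    · exact .inl ((hI.mul h).trans hQ)
    · exact .inr (.inl ((hI.mul h).trans (by simpa [mul_left_comm, mul_comm] using eQ P)))

end Ideal.Rel

section Norm

variable {S : Type u} [CommRing S] [IsDedekindDomain S] [Module.Free ℤ S] [Module.Finite ℤ S]
  [CharZero S] {ℓ : ℕ} [hℓ : Fact ℓ.Prime]

theorem Ideal.sq_dvd_absNorm_of_zeta (hfin : Module.finrank ℤ S = 8) (hℓ8 : ℓ % 8 = 3 ∨ ℓ % 8 = 5)
    {z : S} (hz : z ^ 4 = -1) {P : Ideal S} (hP : P.IsPrime) (hℓP : (ℓ : S) ∈ P) :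
    ℓ ^ 2 ∣ Ideal.absNorm P := by
  have hP0 : P ≠ ⊥ := by
    rintro rfl
    exact hℓ.out.ne_zero (by exact_mod_cast (Ideal.mem_bot.1 hℓP : (ℓ : S) = 0))
  have hmax : P.IsMaximal := hP.isMaximal hP0
  have hdvd : Ideal.absNorm P ∣ ℓ ^ 8 := by
    rw [← hfin, ← Ideal.absNorm_span_natCast]
    exact Ideal.absNorm_dvd_absNorm_of_le ((Ideal.span_singleton_le_iff_mem _).2 hℓP)
  obtain ⟨f, -, hf⟩ := (Nat.dvd_prime_pow hℓ.out).1 hdvd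
  rw [hf]
  apply pow_dvd_pow
  by_contra! hf2
  have hf0 : f ≠ 0 := by
    rintro rfl
    exact hP.ne_top (Ideal.absNorm_eq_one_iff.1 (by rw [hf, pow_zero]))
  obtain rfl : f = 1 := by omega
  let := Ideal.Quotient.field P
  have hcard : Nat.card (S ⧸ P) = ℓ := by
    rw [← Submodule.cardQuot_apply, ← Ideal.absNorm_apply, hf, pow_one]
  have : Finite (S ⧸ P) := Nat.finite_of_card_ne_zero (by rw [hcard]; exact hℓ.out.ne_zero)
  let := Fintype.ofFinite (S ⧸ P)
  have hk : (ℓ : S ⧸ P) = 0 := by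
    have := Ideal.Quotient.eq_zero_iff_mem.2 hℓP
    rwa [map_natCast] at this
  set y : S ⧸ P := Ideal.Quotient.mk P z with hy
  have hy4 : y ^ 4 = -1 := by rw [hy, ← map_pow, hz, map_neg, map_one]
  have hne : (-1 : S ⧸ P) ≠ 1 := by
    intro h1
    have h2 : (2 : S ⧸ P) = 0 := by linear_combination -h1
    obtain ⟨a, ha⟩ : ∃ a, ℓ = 2 * a + 1 := ⟨ℓ / 2, by omega⟩
    rw [ha] at hk
    push_cast at hk
    rw [h2, zero_mul, zero_add] at hk
    exact one_ne_zero hk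
  have hy0 : y ≠ 0 := by
    intro h0
    rw [h0] at hy4
    norm_num at hy4
  have hpow := FiniteField.pow_card_sub_one_eq_one y hy0
  rw [← Nat.card_eq_fintype_card, hcard] at hpow
  rcases hℓ8 with h8 | h8
  · obtain ⟨a, rfl⟩ : ∃ a, ℓ = 8 * a + 3 := ⟨ℓ / 8, by omega⟩
    rw [show 8 * a + 3 - 1 = 4 * (2 * a) + 2 by omega, pow_add, pow_mul, hy4, pow_mul] at hpow
    norm_num at hpow
    rcases hpow with h1 | h1 <;> rw [h1] at hy4 <;> norm_num at hy4 <;> exact hne hy4.symm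
  · obtain ⟨a, rfl⟩ : ∃ a, ℓ = 8 * a + 5 := ⟨ℓ / 8, by omega⟩
    rw [show 8 * a + 5 - 1 = 4 * (2 * a + 1) by omega, pow_mul, hy4, pow_succ, pow_mul] at hpow
    norm_num at hpow
    exact hne hpow

theorem Ideal.mul_eq_span_of_zeta (hfin : Module.finrank ℤ S = 8)
    (hℓ8 : ℓ % 8 = 3 ∨ ℓ % 8 = 5) {z : S} (hz : z ^ 4 = -1) {P P' : Ideal S} (hP : P.IsPrime)
    (hP' : P'.IsPrime) (hℓP : (ℓ : S) ∈ P) (hℓP' : (ℓ : S) ∈ P') (hne : P ≠ P') {β ε : S}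
    (hε : IsUnit ε) (hβ : β ^ 2 = ℓ * ε) : P * P' = Ideal.span {β} := by
  have hne0 : ∀ P : Ideal S, (ℓ : S) ∈ P → P ≠ ⊥ := by
    rintro _ h rfl
    exact hℓ.out.ne_zero (by exact_mod_cast (Ideal.mem_bot.1 h : (ℓ : S) = 0))
  have hcop : P ⊔ P' = ⊤ := Ideal.IsMaximal.coprime_of_ne (hP.isMaximal (hne0 _ hℓP))
    (hP'.isMaximal (hne0 _ hℓP')) hne
  have hmem : ∀ P : Ideal S, P.IsPrime → (ℓ : S) ∈ P → β ∈ P := fun P hP h =>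
    hP.mem_of_pow_mem 2 (by rw [hβ]; exact P.mul_mem_right _ h)
  obtain ⟨J, hJ⟩ : P * P' ∣ Ideal.span {β} := by
    rw [Ideal.dvd_iff_le, Ideal.mul_eq_inf_of_coprime hcop, Ideal.span_singleton_le_iff_mem]
    exact ⟨hmem P hP hℓP, hmem P' hP' hℓP'⟩
  have hsq : Ideal.span {β} ^ 2 = Ideal.span {(ℓ : S)} := by
    rw [Ideal.span_singleton_pow, hβ]
    exact Ideal.span_singleton_mul_right_unit hε _
  have hN : Ideal.absNorm (Ideal.span {β}) = ℓ ^ 4 := by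
    have := congrArg Ideal.absNorm hsq
    rw [map_pow, Ideal.absNorm_span_natCast, hfin] at this
    exact Nat.pow_left_injective two_ne_zero (by simp only [this]; ring)
  obtain ⟨a, ha⟩ := Ideal.sq_dvd_absNorm_of_zeta hfin hℓ8 hz hP hℓP
  obtain ⟨b, hb⟩ := Ideal.sq_dvd_absNorm_of_zeta hfin hℓ8 hz hP' hℓP'
  rw [hJ, map_mul, map_mul, ha, hb] at hN
  have h1 : a * b * Ideal.absNorm J = 1 :=
    mul_left_cancel₀ (pow_ne_zero 4 hℓ.out.ne_zero) (by rw [mul_one]; nth_rw 2 [← hN]; ring)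
  have : J = ⊤ := Ideal.absNorm_eq_one_iff.1 (Nat.eq_one_of_mul_eq_one_left h1)
  rw [hJ, this, Ideal.mul_top]

end Norm

/-- The nonzero elements `t` for which `t / σ t` is, up to sign, a power of `ε`. -/
def conjEigenSubmonoid {R S : Type*} [CommRing R] [CommRing S] [IsDomain S] [Algebra R S]
    (σ : S ≃ₐ[R] S) (ε : S) : Submonoid S where
  carrier := {t | t ≠ 0 ∧ ∃ j : ℕ, t = ε ^ j * σ t ∨ t = -(ε ^ j * σ t)}
  one_mem' := ⟨one_ne_zero, 0, .inl (by simp)⟩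
  mul_mem' := by
    rintro a b ⟨ha, j, hj⟩ ⟨hb, k, hk⟩
    refine ⟨mul_ne_zero ha hb, j + k, ?_⟩
    rw [map_mul, pow_add]
    rcases hj with hj | hj <;> rcases hk with hk | hk
    · left; linear_combination b * hj + ε ^ j * σ a * hk
    · right; linear_combination b * hj + ε ^ j * σ a * hk
    · right; linear_combination b * hj - ε ^ j * σ a * hk
    · left; linear_combination b * hj - ε ^ j * σ a * hk

namespace IsOcticExtension

variable {R : Type v} {S : Type u} [CommRing R] [IsDomain R] [IsPrincipalIdealRing R]
  [CommRing S] [IsDedekindDomain S] [Module.Free ℤ S] [Module.Finite ℤ S] [CharZero S]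
  [Algebra R S] [FaithfulSMul R S]
  {p q : ℕ} [hpP : Fact p.Prime] [hqP : Fact q.Prime]
  {σ : S ≃ₐ[R] S} {τ τ' : S ≃+* S} {ζ : R} {δ θ : S}
  (h : IsOcticExtension p q σ τ τ' ζ δ θ)

include h

theorem theta_sub_conj : θ - σ θ = δ := by
  have h1 := congrArg σ h.two_mul_theta
  rw [map_mul, map_ofNat, map_add, map_one, h.conj_delta] at h1
  exact mul_left_cancel₀ (two_ne_zero (α := S)) (by linear_combination h.two_mul_theta - h1)

theorem delta_ne_zero : δ ≠ 0 := by
  rintro h0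
  have h1 := h.delta_sq
  rw [h0, zero_pow two_ne_zero, eq_comm, neg_eq_zero] at h1
  exact mul_ne_zero hpP.out.ne_zero hqP.out.ne_zero (by exact_mod_cast h1)

theorem natCast_mem_of_forall_sub_mem {P : Ideal S} (hP : P.IsPrime) (hT : ∀ s, s - σ s ∈ P) :
    (p : S) ∈ P ∨ (q : S) ∈ P := by
  apply hP.mem_or_mem
  rw [← neg_mem_iff, ← h.delta_sq]
  exact P.pow_mem_of_mem (by rw [← h.theta_sub_conj]; exact hT θ) 2 two_pos

theorem forall_sub_mem_p {P : Ideal S} (hP : P.IsMaximal) (hp : (p : S) ∈ P) (s : S) :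
    s - σ s ∈ P := by
  let _ := Ideal.Quotient.field P
  rw [← Ideal.Quotient.eq_zero_iff_mem, map_sub, sub_eq_zero]
  exact (h.map_conj_p (Ideal.Quotient.mk P) (Ideal.Quotient.eq_zero_iff_mem.2 hp) s).symm

theorem forall_sub_mem_q {P : Ideal S} (hP : P.IsMaximal) (hq : (q : S) ∈ P) (s : S) :
    s - σ s ∈ P := by
  let _ := Ideal.Quotient.field P
  rw [← Ideal.Quotient.eq_zero_iff_mem, map_sub, sub_eq_zero]
  exact (h.map_conj_q (Ideal.Quotient.mk P) (Ideal.Quotient.eq_zero_iff_mem.2 hq) s).symm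

theorem exists_unit_of_conj_eq (W : Sˣ) (hW : σ W = W) : ∃ η : Rˣ, algebraMap R S η = W := by
  have hinj := FaithfulSMul.algebraMap_injective R S
  obtain ⟨a, ha⟩ := h.conj_fix W hW
  obtain ⟨b, hb⟩ := h.conj_fix (↑W⁻¹) (W.isUnit.mul_left_cancel (by
    nth_rw 1 [← hW]; rw [← map_mul, W.mul_inv, map_one]))
  have hab : a * b = 1 := hinj (by rw [map_mul, ha, hb, map_one, W.mul_inv])
  exact ⟨⟨a, b, hab, by rw [mul_comm, hab]⟩, ha⟩

theorem exists_sq_eq_norm (W : Sˣ) : ∃ s : R, (W * σ W : S) = algebraMap R S s ^ 2 := by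
  obtain ⟨η, hη⟩ := h.exists_unit_of_conj_eq (W * Units.map σ.toAlgHom.toMonoidHom W) (by
    change σ (W * σ W) = W * σ W
    rw [map_mul, h.conj_conj, mul_comm])
  change _ = (W * σ W : S) at hη
  obtain ⟨s, hs⟩ := h.exists_eq_sq_of_norm_eq η W 1 (by rw [← hη]; simp)
    (by rw [Ideal.span_singleton_eq_top.2 W.isUnit, top_sup_eq])
  exact ⟨s, by rw [← hη, hs, map_pow]⟩

section Pell

variable {w : S} (hw : w ^ 2 = p * q) (hσw : σ w = -w) {x y : ℤ}
  (hxy : (p : ℤ) * x ^ 2 - q * y ^ 2 = 1)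
  {a b : ℤ} (hab : (q : ℤ) * a ^ 2 - 2 * p * b ^ 2 = 1) (hτ'w : τ' w = w)

include hw hσw hxy hab hτ'w

/-- An element of the form `1 + iu` with `u` a unit of relative norm `-1` generates an ideal fixed
by `σ`, but it is not equivalent to the unit ideal. -/
theorem exists_fixed_not_rel : ∃ b₀ : S, b₀ ≠ 0 ∧
    (Ideal.span {b₀}).map σ = Ideal.span {b₀} ∧
    ¬ Ideal.Rel (conjEigenSubmonoid σ ((p * x ^ 2 + q * y ^ 2 : S) + 2 * x * y * w))
      (Ideal.span {b₀}) 1 := by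
  have hpell : (p * x ^ 2 - q * y ^ 2 : S) = 1 := by exact_mod_cast hxy
  have hpell' : (q * a ^ 2 - 2 * p * b ^ 2 : S) = 1 := by exact_mod_cast hab
  set ε : S := (p * x ^ 2 + q * y ^ 2 : S) + 2 * x * y * w with hε
  have hN : ε * σ ε = 1 := h.eps_mul_conj hw hσw hxy
  have hz := h.zeta_pow'
  set z := algebraMap R S ζ with hzdef
  have hσz : σ z = z := AlgEquiv.commutes σ ζ
  have hτ'z : τ' z = -z := h.tau'_zeta
  set s : S := z - z ^ 3 with hs
  have hs2 : s ^ 2 = 2 := by rw [hs]; linear_combination (z ^ 2 - 2) * hz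
  have hσs : σ s = s := by rw [hs, map_sub, map_pow, hσz]
  have hτ's : τ' s = -s := by rw [hs, map_sub, map_pow, hτ'z]; ring
  set u : S := w * (x * a + s * y * b) + (q * y * a + s * p * x * b) with hu
  have huσ : u * σ u = -1 := by
    rw [hu]
    simp only [map_add, map_mul, map_natCast, map_intCast, hσw, hσs]
    linear_combination -(x * a + s * y * b : S) ^ 2 * hw
      + (p ^ 2 * x ^ 2 * b ^ 2 - p * q * y ^ 2 * b ^ 2 : S) * hs2 +
      (-q * a ^ 2 + 2 * p * b ^ 2 : S) * hpell - hpell'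
  have huτ : u * τ' u = ε := by
    rw [hu, hε]
    simp only [map_add, map_mul, map_natCast, map_intCast, hτ'w, hτ's]
    linear_combination (x ^ 2 * a ^ 2 - s ^ 2 * y ^ 2 * b ^ 2 : S) * hw
      - (p * q * y ^ 2 * b ^ 2 + p ^ 2 * x ^ 2 * b ^ 2 + 2 * p * x * y * w * b ^ 2 : S) * hs2
      + ε * hpell'
  have hτ'ε : τ' ε = ε := by
    rw [hε]; simp only [map_add, map_mul, map_pow, map_natCast, map_intCast, map_ofNat, hτ'w]
  set κ : S := z ^ 2 * u with hκ
  have hκσ : κ * σ κ = 1 := by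
    rw [hκ, map_mul, map_pow, hσz]; linear_combination z ^ 4 * huσ - hz
  have hb : κ * σ (1 + κ) = 1 + κ := by rw [map_add, map_one]; linear_combination hκσ
  have hε0 : ε ≠ 0 := left_ne_zero_of_mul_eq_one hN
  have hb0 : 1 + κ ≠ 0 := by
    intro h0
    have hu2 : u = z ^ 2 := by linear_combination -z ^ 2 * h0 + u * hz
    apply h.eps_ne_sq hw hσw hxy (z ^ 2)
    rw [← hε, ← huτ, hu2, map_pow, hτ'z]; ring
  refine ⟨1 + κ, hb0, ?_, ?_⟩
  · rw [Ideal.map_span, Set.image_singleton]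
    nth_rw 2 [← hb]
    exact (Ideal.span_singleton_mul_left_unit (IsUnit.of_mul_eq_one _ hκσ) _).symm
  · rintro ⟨s', ⟨hs'0, j, hj⟩, t, ⟨ht0, k, hk⟩, e⟩
    rw [Ideal.span_singleton_mul_span_singleton, mul_one, Ideal.span_singleton_eq_span_singleton] at e
    obtain ⟨W, hW⟩ := e
    obtain ⟨c, hc⟩ := h.exists_sq_eq_norm W
    have hσt : σ t = σ s' * σ (1 + κ) * σ W := by rw [← hW, map_mul, map_mul]
    have h1 : κ * ε ^ j * W ^ 2 = ε ^ k * algebraMap R S c ^ 2 ∨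
        κ * ε ^ j * W ^ 2 = -(ε ^ k * algebraMap R S c ^ 2) := by
      have hne : σ s' * σ (1 + κ) ≠ 0 := by
        rw [← map_mul]; exact (map_ne_zero_iff σ σ.injective).2 (mul_ne_zero hs'0 hb0)
      rw [← hc]
      have e1 : (t = κ * ε ^ j * (σ s' * σ (1 + κ)) * W ∨
          t = -(κ * ε ^ j * (σ s' * σ (1 + κ)) * W)) := by
        rw [← hW]
        rcases hj with hj | hj
        · left; linear_combination W * (1 + κ) * hj - W * ε ^ j * σ s' * hb
        · right; linear_combination W * (1 + κ) * hj + W * ε ^ j * σ s' * hb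
      rw [hσt] at hk
      rcases e1 with e1 | e1 <;> rcases hk with hk | hk
      · left; exact mul_left_cancel₀ hne (by linear_combination W * (hk - e1))
      · right; exact mul_left_cancel₀ hne (by linear_combination W * (hk - e1))
      · right; exact mul_left_cancel₀ hne (by linear_combination -W * (hk - e1))
      · left; exact mul_left_cancel₀ hne (by linear_combination -W * (hk - e1))
    obtain ⟨f, hf⟩ : ∃ f : S, κ * ε ^ (j + k) * W ^ 2 = f ^ 2 := by
      rcases h1 with h1 | h1
      · exact ⟨ε ^ k * algebraMap R S c, by rw [pow_add]; linear_combination ε ^ k * h1⟩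
      · exact ⟨z ^ 2 * (ε ^ k * algebraMap R S c), by
          rw [pow_add]
          linear_combination ε ^ k * h1 - (ε ^ k * algebraMap R S c) ^ 2 * hz⟩
    obtain ⟨n, v, hv⟩ : ∃ n, ∃ v, κ * ε ^ n = v ^ 2 := by
      obtain ⟨v, hv⟩ := exists_eq_sq_of_mul_sq_eq hf W.ne_zero
      exact ⟨_, v, hv⟩
    have hτκ : κ * τ' κ = -ε := by
      rw [hκ, map_mul, map_pow, hτ'z]; linear_combination z ^ 4 * huτ + ε * hz
    have h2 : ε * (z ^ 2 * ε ^ n) ^ 2 = (v * τ' v) ^ 2 := by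
      have h3 := congrArg τ' hv
      rw [map_mul, map_pow, map_pow, hτ'ε] at h3
      linear_combination ε * ε ^ (2 * n) * hz - ε ^ (2 * n) * hτκ + κ * ε ^ n * h3 + τ' v ^ 2 * hv
    have hz0 : z ≠ 0 := by
      intro h0; rw [h0] at hz; norm_num at hz
    obtain ⟨v', hv'⟩ := exists_eq_sq_of_mul_sq_eq h2
      (mul_ne_zero (pow_ne_zero 2 hz0) (pow_ne_zero n hε0))
    exact h.eps_ne_sq hw hσw hxy v' hv'

end Pell

end IsOcticExtension

namespace IsOcticExtension

variable {R : Type v} {S : Type u} [CommRing R] [IsDomain R] [IsPrincipalIdealRing R]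
  [CommRing S] [IsDedekindDomain S] [Module.Free ℤ S] [Module.Finite ℤ S] [CharZero S]
  [Algebra R S] [FaithfulSMul R S]
  {p q : ℕ} [hpP : Fact p.Prime] [hqP : Fact q.Prime]
  {σ : S ≃ₐ[R] S} {τ τ' : S ≃+* S} {ζ : R} {δ θ : S}
  (h : IsOcticExtension p q σ τ τ' ζ δ θ)

include h

theorem exists_sqrt : ∃ w : S, w ^ 2 = p * q ∧ σ w = -w ∧ τ w = -w ∧ τ' w = w ∧
    w = -(algebraMap R S ζ ^ 2 * δ) := by
  have hz := h.zeta_pow'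
  refine ⟨-(algebraMap R S ζ ^ 2 * δ), ?_, ?_, ?_, ?_, rfl⟩
  · linear_combination algebraMap R S ζ ^ 4 * h.delta_sq - (p * q : S) * hz
  · rw [map_neg, map_mul, map_pow, h.conj_delta, AlgEquiv.commutes]; ring
  · rw [map_neg, map_mul, map_pow, h.tau_delta, h.tau_zeta]
    linear_combination -algebraMap R S ζ ^ 2 * δ * hz
  · rw [map_neg, map_mul, map_pow, h.tau'_delta, h.tau'_zeta]; ring

/-- The class group of `S` has at most one involution. -/
theorem exists_forall_sq_eq_one : ∃ e : ClassGroup S, ∀ c : ClassGroup S, c ^ 2 = 1 →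
    c = 1 ∨ c = e := by
  obtain ⟨w, hw, hσw, -, hτ'w, -⟩ := h.exists_sqrt
  obtain ⟨x, y, hxy⟩ := h.pell
  obtain ⟨a, b, hab⟩ := h.pell_two
  obtain ⟨b₀, hb0, hbσ, hbrel⟩ := h.exists_fixed_not_rel hw hσw hxy hab hτ'w
  have hpell : (p * x ^ 2 - q * y ^ 2 : S) = 1 := by exact_mod_cast hxy
  set ε : S := (p * x ^ 2 + q * y ^ 2 : S) + 2 * x * y * w with hε
  have hN : ε * σ ε = 1 := h.eps_mul_conj hw hσw hxy
  have hεu : IsUnit ε := IsUnit.of_mul_eq_one _ hN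
  set T := conjEigenSubmonoid σ ε with hT
  have hT0 : T ≤ S⁰ := fun t ht => mem_nonZeroDivisors_of_ne_zero ht.1
  have hinj := FaithfulSMul.algebraMap_injective R S
  have hRT : ∀ r : R, r ≠ 0 → algebraMap R S r ∈ T := fun r hr =>
    ⟨(map_ne_zero_iff _ hinj).2 hr, 0, .inl (by simp)⟩
  have hp0 : (p : S) ≠ 0 := by exact_mod_cast hpP.out.ne_zero
  have hq0 : (q : S) ≠ 0 := by exact_mod_cast hqP.out.ne_zero
  have hne : ∀ {c β : S}, c ≠ 0 → β ^ 2 = c * ε → β ≠ 0 := by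
    rintro c β hc hβ rfl
    exact mul_ne_zero hc hεu.ne_zero (by rw [← hβ]; ring)
  obtain ⟨β, hβ, hβT⟩ : ∃ β : S, β ^ 2 = p * ε ∧ β ∈ T := by
    have h1 : (p * x + y * w : S) ^ 2 = p * ε := by
      rw [hε]; linear_combination (y : S) ^ 2 * hw
    refine ⟨p * x + y * w, h1, hne hp0 h1, 1, .inl ?_⟩
    simp only [map_add, map_mul, map_natCast, map_intCast, hσw, hε]
    linear_combination -(p * x + y * w : S) * hpell + (2 * x * y ^ 2 : S) * hw
  obtain ⟨β', hβ', hβ'T⟩ : ∃ β : S, β ^ 2 = q * ε ∧ β ∈ T := by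
    have h1 : (q * y + x * w : S) ^ 2 = q * ε := by
      rw [hε]; linear_combination (x : S) ^ 2 * hw
    refine ⟨q * y + x * w, h1, hne hq0 h1, 1, .inr ?_⟩
    simp only [map_add, map_mul, map_natCast, map_intCast, hσw, hε]
    linear_combination -(q * y + x * w : S) * hpell - (2 * x ^ 2 * y : S) * hw
  have hsq : ∀ P : Ideal S, P ≠ ⊥ → (∀ s, s - σ s ∈ P) → Ideal.Rel T (P * P) 1 := by
    intro P hP0 hP
    obtain ⟨r, hr⟩ := Ideal.exists_mul_map_eq_span h.conj_conj h.conj_fix P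
    rw [Ideal.map_eq_of_forall_sub_mem h.conj_conj hP] at hr
    rw [hr]
    refine Ideal.Rel.span_singleton (hRT r ?_)
    rintro rfl
    rw [map_zero, Ideal.span_singleton_eq_bot.2 rfl] at hr
    exact hP0 (by simpa using hr)
  have hmul : ∀ (ℓ : ℕ) (_ : Fact ℓ.Prime) (γ : S), (ℓ % 8 = 3 ∨ ℓ % 8 = 5) → γ ^ 2 = ℓ * ε → γ ∈ T →
      ∀ P P' : Ideal S, P.IsPrime → P'.IsPrime → P ≠ ⊥ → P' ≠ ⊥ → (∀ s, s - σ s ∈ P) →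
      (∀ s, s - σ s ∈ P') → (ℓ : S) ∈ P → (ℓ : S) ∈ P' → Ideal.Rel T P P' := by
    intro ℓ _ γ hℓ8 hγ hγT P P' hP hP' hP0 hP'0 hPT hP'T hℓP hℓP'
    refine Ideal.Rel.of_mul_self ?_ (hsq P' hP'0 hP'T)
    by_cases hPP : P = P'
    · subst hPP; exact hsq P hP0 hPT
    · rw [Ideal.mul_eq_span_of_zeta h.finrank hℓ8 h.zeta_pow' hP hP' hℓP hℓP' hPP hεu hγ]
      exact Ideal.Rel.span_singleton hγT
  obtain ⟨P, hPm, hpmem⟩ := exists_max_ideal_of_mem_nonunits (h.not_isUnit_natCast hpP.out)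
  obtain ⟨Q, hQm, hqmem⟩ := exists_max_ideal_of_mem_nonunits (h.not_isUnit_natCast hqP.out)
  have hP0 : P ≠ ⊥ := by rintro rfl; exact hp0 hpmem
  have hQ0 : Q ≠ ⊥ := by rintro rfl; exact hq0 hqmem
  have hPT := h.forall_sub_mem_p hPm hpmem
  have hQT := h.forall_sub_mem_q hQm hqmem
  have hPP := hsq P hP0 hPT
  have hQQ := hsq Q hQ0 hQT
  have hdich : ∀ I : Ideal S, I.IsPrime → I ≠ ⊥ → (∀ s, s - σ s ∈ I) →
      Ideal.Rel T I P ∨ Ideal.Rel T I Q := by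
    intro I hI hI0 hIT
    rcases h.natCast_mem_of_forall_sub_mem hI hIT with h1 | h1
    · exact .inl (hmul p hpP β (.inr h.mod_p) hβ hβT I P hI hPm.isPrime hI0 hP0 hIT hPT h1 hpmem)
    · exact .inr (hmul q hqP β' (.inl h.mod_q) hβ' hβ'T I Q hI hQm.isPrime hI0 hQ0 hIT hQT h1 hqmem)
  set P' : (Ideal S)⁰ := ⟨P, mem_nonZeroDivisors_of_ne_zero hP0⟩ with hP'
  set Q' : (Ideal S)⁰ := ⟨Q, mem_nonZeroDivisors_of_ne_zero hQ0⟩ with hQ'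
  set c := ClassGroup.mk0 P' with hc
  set d := ClassGroup.mk0 Q' with hd
  have hcc : c * c = 1 := by
    rw [hc, ← map_mul, ← map_one ClassGroup.mk0]
    exact Ideal.Rel.mk0_eq hT0 hPP
  have hdd : d * d = 1 := by
    rw [hd, ← map_mul, ← map_one ClassGroup.mk0]
    exact Ideal.Rel.mk0_eq hT0 hQQ
  have hfour : ∀ e : ClassGroup S, e ^ 2 = 1 → e = 1 ∨ e = c ∨ e = d ∨ e = c * d := by
    intro e he
    have hN0 : Ideal.span {(p * q : S)} ≠ ⊥ := by
      rw [Ne, Ideal.span_singleton_eq_bot]; exact mul_ne_zero hp0 hq0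
    obtain ⟨J, hJ, hJσ⟩ := ClassGroup.exists_map_eq_of_sq_eq_one h.conj_conj h.conj_fix
      h.delta_ne_zero h.conj_delta hN0 (fun η z r hz hcop => by
        obtain ⟨s, hs⟩ := h.exists_eq_sq_of_norm_eq η z r hz hcop
        have hsu : IsUnit s := by
          refine isUnit_of_dvd_unit ?_ η.isUnit
          rw [hs]; exact dvd_pow_self s two_ne_zero
        exact ⟨Units.map (algebraMap R S).toMonoidHom hsu.unit, by
          simp [hs, sq, AlgEquiv.commutes]⟩) he
    obtain ⟨γ, hγ, M, hM, hJM⟩ := Ideal.exists_eq_span_mul_prod h.conj_conj h.conj_fix (J : Ideal S)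
      (nonZeroDivisors.coe_ne_zero J) hJσ
    have h1 : Ideal.Rel T (J : Ideal S) M.prod := by
      rw [hJM]
      simpa using (Ideal.Rel.span_singleton (hRT γ hγ)).mul (Ideal.Rel.refl T M.prod)
    rw [← hJ]
    rcases Ideal.Rel.multiset_prod hPP hQQ M (fun I hI =>
      hdich I (hM I hI).1 (hM I hI).2.1 (hM I hI).2.2) with h2 | h2 | h2 | h2
    · exact .inl (by rw [← map_one ClassGroup.mk0]; exact Ideal.Rel.mk0_eq hT0 (h1.trans h2))
    · exact .inr (.inl (Ideal.Rel.mk0_eq (J := P') hT0 (h1.trans h2)))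
    · exact .inr (.inr (.inl (Ideal.Rel.mk0_eq (J := Q') hT0 (h1.trans h2))))
    · exact .inr (.inr (.inr (by
        rw [hc, hd, ← map_mul]; exact Ideal.Rel.mk0_eq (J := P' * Q') hT0 (h1.trans h2))))
  have hrel : c = 1 ∨ d = 1 ∨ c * d = 1 := by
    obtain ⟨γ, hγ, M, hM, hbM⟩ := Ideal.exists_eq_span_mul_prod h.conj_conj h.conj_fix
      (Ideal.span {b₀}) (by simpa using hb0) hbσ
    have h1 : Ideal.Rel T M.prod (Ideal.span {b₀}) := by
      rw [hbM]
      simpa using ((Ideal.Rel.span_singleton (hRT γ hγ)).mul (Ideal.Rel.refl T M.prod)).symm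
    set B : (Ideal S)⁰ := ⟨Ideal.span {b₀},
      mem_nonZeroDivisors_of_ne_zero (by simpa using hb0)⟩ with hB
    have hB1 : ClassGroup.mk0 B = 1 := ClassGroup.mk0_eq_one_iff_exists.2 ⟨b₀, hb0, rfl⟩
    rw [← hB1]
    rcases Ideal.Rel.multiset_prod hPP hQQ M (fun I hI =>
      hdich I (hM I hI).1 (hM I hI).2.1 (hM I hI).2.2) with h2 | h2 | h2 | h2
    · exact absurd (h1.symm.trans h2) hbrel
    · exact .inl (Ideal.Rel.mk0_eq (J := B) hT0 (h2.symm.trans h1))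
    · exact .inr (.inl (Ideal.Rel.mk0_eq (J := B) hT0 (h2.symm.trans h1)))
    · exact .inr (.inr (by
        rw [hc, hd, ← map_mul]
        exact Ideal.Rel.mk0_eq (I := P' * Q') (J := B) hT0 (h2.symm.trans h1)))
  rcases hrel with h1 | h1 | h1
  · refine ⟨d, fun e he => ?_⟩
    have := hfour e he
    rw [h1, one_mul] at this
    tauto
  · refine ⟨c, fun e he => ?_⟩
    have := hfour e he
    rw [h1, mul_one] at this
    tauto
  · refine ⟨c, fun e he => ?_⟩
    have hdc : d = c := by rw [← one_mul d, ← hcc, mul_assoc, h1, mul_one]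
    have := hfour e he
    rw [h1, hdc] at this
    tauto

end IsOcticExtension

theorem Ideal.isCoprime_of_mem_of_one_sub_mem {S : Type*} [CommRing S] {I J : Ideal S} {a : S}
    (hI : a ∈ I) (hJ : 1 - a ∈ J) : IsCoprime I J :=
  Ideal.isCoprime_iff_exists.2 ⟨a, hI, 1 - a, hJ, by ring⟩

theorem Ideal.span_pair_mul_span_pair_one_sub {S : Type*} [CommRing S] {a b c : S}
    (hb : b * (1 - b) = a * c) :
    Ideal.span {a, b} * Ideal.span {a, 1 - b} = Ideal.span {a} := by
  rw [Ideal.span_pair_mul_span_pair]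
  apply le_antisymm
  · rw [Ideal.span_le]
    rintro x (rfl | rfl | rfl | rfl) <;> rw [SetLike.mem_coe, Ideal.mem_span_singleton]
    · exact dvd_mul_right _ _
    · exact dvd_mul_right _ _
    · exact dvd_mul_left _ _
    · exact ⟨c, hb⟩
  · refine (Ideal.span_singleton_le_iff_mem _).2 ?_
    have h1 : a * (1 - b) ∈ Ideal.span {a * a, a * (1 - b), b * a, b * (1 - b)} :=
      Ideal.subset_span (by simp)
    have h2 : b * a ∈ Ideal.span {a * a, a * (1 - b), b * a, b * (1 - b)} :=
      Ideal.subset_span (by simp)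
    have h3 := Ideal.add_mem _ h1 h2
    rwa [show a * (1 - b) + b * a = a by ring] at h3

namespace IsOcticExtension

variable {R : Type v} {S : Type u} [CommRing R] [IsDomain R] [IsPrincipalIdealRing R]
  [CommRing S] [IsDedekindDomain S] [Module.Free ℤ S] [Module.Finite ℤ S] [CharZero S]
  [Algebra R S] [FaithfulSMul R S]
  {p q : ℕ} [hpP : Fact p.Prime] [hqP : Fact q.Prime]
  {σ : S ≃ₐ[R] S} {τ τ' : S ≃+* S} {ζ : R} {δ θ : S}
  (h : IsOcticExtension p q σ τ τ' ζ δ θ)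

include h

theorem theta_mul : ∃ k : ℤ, θ * (1 - θ) = 2 * k := by
  obtain ⟨k, hk⟩ : ∃ k : ℤ, (1 + p * q : ℤ) = 8 * k := by
    have h1 : (p * q) % 8 = 7 := by rw [Nat.mul_mod, h.mod_p, h.mod_q]
    exact ⟨(p * q / 8 : ℕ) + 1, by zify at h1; push_cast; omega⟩
  have hk' : (1 + p * q : S) = 8 * k := by exact_mod_cast hk
  refine ⟨k, mul_left_cancel₀ (show (4 : S) ≠ 0 by norm_num) ?_⟩
  linear_combination hk' + (1 - 2 * θ - δ) * h.two_mul_theta - h.delta_sq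

theorem conj_theta : σ θ = 1 - θ := by
  linear_combination -h.theta_sub_conj + h.two_mul_theta

theorem span_mul_conj_span :
    Ideal.span {1 - algebraMap R S ζ, θ} * Ideal.span {1 - algebraMap R S ζ, 1 - θ} =
      Ideal.span {1 - algebraMap R S ζ} := by
  have hz := h.zeta_pow'
  set z := algebraMap R S ζ
  obtain ⟨k, hk⟩ := h.theta_mul
  refine Ideal.span_pair_mul_span_pair_one_sub (c := (1 + z) * (1 + z ^ 2) * k) ?_
  rw [hk]
  linear_combination (k : S) * hz

theorem span_pow_four : Ideal.span {1 - algebraMap R S ζ, θ} ^ 4 = Ideal.span {2, θ} := by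
  have hC := h.span_mul_conj_span
  have hz := h.zeta_pow'
  set z := algebraMap R S ζ
  obtain ⟨k, hk⟩ := h.theta_mul
  have h2 : Ideal.span {2, θ} * Ideal.span {2, 1 - θ} = Ideal.span {(2 : S)} :=
    Ideal.span_pair_mul_span_pair_one_sub hk
  have h4 : Ideal.span {(2 : S)} = Ideal.span {1 - z} ^ 4 := by
    have hu : IsUnit (z ^ 2 * (z - z ^ 3 - 1) ^ 2) := by
      refine IsUnit.of_mul_eq_one (-(z ^ 2 * (z - z ^ 3 + 1) ^ 2)) ?_
      have hs : (z - z ^ 3) ^ 2 = 2 := by linear_combination (z ^ 2 - 2) * hz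
      linear_combination -hz - z ^ 4 * ((z - z ^ 3) ^ 2) * hs
    rw [Ideal.span_singleton_pow, ← Ideal.span_singleton_mul_right_unit hu]
    congr 2
    linear_combination -(1-4*z+4*z^2-2*z^4)*hz
  have hmul : Ideal.span {2, θ} * Ideal.span {2, 1 - θ} =
      Ideal.span {1 - z, θ} ^ 4 * Ideal.span {1 - z, 1 - θ} ^ 4 := by
    rw [h2, h4, ← mul_pow, hC]
  have hm : ∀ a b : S, b ∈ Ideal.span {a, b} := fun a b => Ideal.subset_span (by simp)
  have hcop : ∀ a b : S, IsCoprime (Ideal.span {a, θ}) (Ideal.span {b, 1 - θ}) := fun a b =>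
    Ideal.isCoprime_of_mem_of_one_sub_mem (hm _ θ) (hm _ (1 - θ))
  apply dvd_antisymm
  · exact (hcop (1 - z) 2).pow_left.dvd_of_dvd_mul_right (by rw [hmul]; exact dvd_mul_right _ _)
  · exact (hcop 2 (1 - z)).pow_right.dvd_of_dvd_mul_right (by rw [← hmul]; exact dvd_mul_right _ _)

theorem tau_sqrt_two : τ (algebraMap R S (ζ - ζ ^ 3)) = algebraMap R S (ζ - ζ ^ 3) := by
  have hz := h.zeta_pow'
  rw [map_sub, map_pow, map_sub, map_pow, h.tau_zeta]
  set z := algebraMap R S ζ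
  linear_combination (z ^ 5 - z) * hz

theorem exists_mul_tau_eq_sq (η : Rˣ) :
    ∃ e : S, algebraMap R S η * τ (algebraMap R S η) = e ^ 2 := by
  obtain ⟨s, hs⟩ := h.base_units η
  have hz := h.zeta_pow'
  have h1 : algebraMap R S ζ * τ (algebraMap R S ζ) = 1 := by
    rw [h.tau_zeta]; linear_combination -hz
  have h2 : algebraMap R S (1 + (ζ - ζ ^ 3)) * τ (algebraMap R S (1 + (ζ - ζ ^ 3))) =
      algebraMap R S (1 + (ζ - ζ ^ 3)) ^ 2 := by
    rw [map_add, map_add, h.tau_sqrt_two, map_one, map_one, sq]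
  set s' := algebraMap R S s
  rcases hs with hs | hs | hs | hs <;> rw [hs] <;> simp only [map_mul, map_pow]
  · exact ⟨s' * τ s', by ring⟩
  · exact ⟨s' * τ s', by linear_combination (s' * τ s') ^ 2 * h1⟩
  · exact ⟨algebraMap R S (1 + (ζ - ζ ^ 3)) * (s' * τ s'), by
      linear_combination (s' * τ s') ^ 2 * h2⟩
  · refine ⟨algebraMap R S (1 + (ζ - ζ ^ 3)) * (s' * τ s'), ?_⟩
    set z := algebraMap R S ζ
    set g := algebraMap R S (1 + (ζ - ζ ^ 3))
    linear_combination (s' * τ s') ^ 2 * h2 + (s' * τ s') ^ 2 * (g * τ g) * h1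

/-- The class of the ideal `(1 - ζ, θ)` is not a square. -/
theorem sq_ne_mk0 (C : (Ideal S)⁰) (hC : (C : Ideal S) = Ideal.span {1 - algebraMap R S ζ, θ})
    (c : ClassGroup S) : c ^ 2 ≠ ClassGroup.mk0 C := by
  intro hc
  have hCC := h.span_mul_conj_span
  have hz := h.zeta_pow'
  have hp0 : (p : S) ≠ 0 := by exact_mod_cast hpP.out.ne_zero
  have hq0 : (q : S) ≠ 0 := by exact_mod_cast hqP.out.ne_zero
  have hN0 : Ideal.span {(p * q : S)} ≠ ⊥ := by
    rw [Ne, Ideal.span_singleton_eq_bot]; exact mul_ne_zero hp0 hq0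
  obtain ⟨J, hJ, hJN⟩ := ClassGroup.exists_mk0_eq_sup_eq_top c⁻¹ hN0
  have h1 : ClassGroup.mk0 (C * J ^ 2) = 1 := by
    rw [map_mul, map_pow, hJ, ← hc, ← mul_pow, mul_inv_cancel, one_pow]
  obtain ⟨z₀, hz00, hz₀⟩ := ClassGroup.mk0_eq_one_iff_exists.1 h1
  rw [Submonoid.coe_mul, SubmonoidClass.coe_pow, hC] at hz₀
  obtain ⟨r, hr⟩ := Ideal.exists_mul_map_eq_span h.conj_conj h.conj_fix (J : Ideal S)
  have hr0 : r ≠ 0 := by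
    rintro rfl
    rw [map_zero, Ideal.span_singleton_eq_bot.2 rfl, ← Ideal.zero_eq_bot, mul_eq_zero] at hr
    have hJ0 := nonZeroDivisors.coe_ne_zero J
    refine hr.elim hJ0 fun h0 => hJ0 ?_
    rw [← Ideal.map_map_of_involutive h.conj_conj (J : Ideal S), h0, Ideal.zero_eq_bot,
      Ideal.map_bot]
  have hcop : Ideal.span {z₀} ⊔ Ideal.span {(p * q : S)} = ⊤ := by
    rw [← Ideal.isCoprime_iff_sup_eq, ← hz₀]
    refine IsCoprime.mul_left ?_ (IsCoprime.pow_left (Ideal.isCoprime_iff_sup_eq.2 hJN))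
    obtain ⟨k, hk⟩ : ∃ k : ℕ, p * q = 2 * k + 1 := by
      have h1 : (p * q) % 8 = 7 := by rw [Nat.mul_mod, h.mod_p, h.mod_q]
      exact ⟨p * q / 2, by omega⟩
    have hk' : (p * q : S) = 2 * k + 1 := by exact_mod_cast hk
    refine Ideal.isCoprime_of_mem_of_one_sub_mem (a := -(2 * k : S)) ?_ ?_
    · rw [show -(2 * k : S) = -((1 + algebraMap R S ζ) * (1 + algebraMap R S ζ ^ 2) * k) *
        (1 - algebraMap R S ζ) by linear_combination (-k : S) * hz]
      exact Ideal.mul_mem_left _ _ (Ideal.subset_span (by simp))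
    · rw [hk', sub_neg_eq_add, add_comm]; exact Ideal.mem_span_singleton_self _
  obtain ⟨W, hW⟩ : Associated ((1 - algebraMap R S ζ) * algebraMap R S r ^ 2) (z₀ * σ z₀) := by
    rw [← Ideal.span_singleton_eq_span_singleton, ← Ideal.span_singleton_mul_span_singleton,
      ← Ideal.span_singleton_mul_span_singleton, ← Ideal.span_singleton_pow, ← hr, ← hCC]
    have : Ideal.span {σ z₀} = (Ideal.span {z₀}).map σ := by
      rw [Ideal.map_span, Set.image_singleton]
    rw [this, ← hz₀, Ideal.map_mul, Ideal.map_pow, Ideal.map_span, Set.image_pair, h.conj_theta,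
      map_sub, map_one, AlgEquiv.commutes]
    ring
  have hA0 : (1 - algebraMap R S ζ) * algebraMap R S r ^ 2 ≠ 0 := by
    refine left_ne_zero_of_mul (b := (W : S)) ?_
    rw [hW]
    exact mul_ne_zero hz00 ((map_ne_zero_iff σ σ.injective).2 hz00)
  obtain ⟨η, hη⟩ := h.exists_unit_of_conj_eq W (mul_left_cancel₀ hA0 (by
    rw [hW]
    have := congrArg σ hW
    simp only [map_mul, map_sub, map_pow, map_one, AlgEquiv.commutes, h.conj_conj] at this
    rw [this, mul_comm]))
  obtain ⟨e, he⟩ := h.exists_mul_tau_eq_sq η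
  obtain ⟨k, _, φ, hφ⟩ := h.exists_ringHom_p
  have key : ∀ ψ : S →+* k, ψ p = 0 →
      ψ ((1 - algebraMap R S ζ) * algebraMap R S η) ^ ((p ^ 2 - 1) / 2) = 1 := fun ψ hψ =>
    h.map_pow_half_p ψ hψ (r := algebraMap R S r) (z := z₀) (by
      rw [sq (ψ z₀)]
      nth_rw 2 [← h.map_conj_p ψ hψ z₀]
      rw [← map_mul ψ z₀, ← hW, ← hη]; simp only [map_mul, map_pow]; ring)
      (map_ne_zero_of_span_sup_eq_top ψ hcop (by rw [map_mul, hψ, zero_mul]))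
  have k1 := key φ hφ
  have k2 := key (φ.comp τ.toRingHom) (by simpa using hφ)
  have hprod : φ ((1 - algebraMap R S ζ) * τ (1 - algebraMap R S ζ)) ^ ((p ^ 2 - 1) / 2) *
      φ (e ^ 2) ^ ((p ^ 2 - 1) / 2) = 1 := by
    rw [← he, ← mul_pow, ← one_mul (1 : k)]
    nth_rw 1 [← k1]
    rw [← k2, ← mul_pow]
    congr 1
    simp only [map_mul, RingHom.comp_apply]
    change _ = _ * (φ (τ _) * φ (τ _))
    ring
  have hφe : φ e ≠ 0 := by
    have : IsUnit e := by
      refine isUnit_of_dvd_unit (dvd_pow_self e two_ne_zero) ?_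
      rw [← he]
      exact (η.isUnit.map _).mul ((η.isUnit.map (algebraMap R S)).map τ)
    exact (this.map φ).ne_zero
  have hpe : φ (e ^ 2) ^ ((p ^ 2 - 1) / 2) = 1 :=
    h.map_pow_half_p φ hφ (r := 1) (z := e) (by simp) hφe
  have := h.charP_p φ hφ
  have hs := sqrt_two_pow_half_of_five h.mod_p (h.map_sqrt_two_sq φ)
  have hε := h.map_unit_pow_half_p φ hφ
  rw [hpe, mul_one] at hprod
  have hid : (1 - algebraMap R S ζ) * τ (1 - algebraMap R S ζ) *
      algebraMap R S (1 + (ζ - ζ ^ 3)) = algebraMap R S ζ - algebraMap R S ζ ^ 3 := by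
    rw [map_sub, map_one, h.tau_zeta]
    simp only [map_add, map_sub, map_one, map_pow]
    set z := algebraMap R S ζ
    linear_combination (1-z-z^2+z^3)*hz
  rw [← map_pow φ, ← map_sub, ← hid, map_mul, mul_pow, hprod, hε, mul_one] at hs
  exact h.neg_one_ne_one_p φ hφ hs.symm

end IsOcticExtension

section TwoGroup

variable {G : Type*} [CommGroup G] [Finite G] {e x : G}

/-- If `G` has at most one involution, then the squares have index at most two. -/
theorem exists_sq_or_mul_sq_of_involution (he : ∀ c : G, c ^ 2 = 1 → c = 1 ∨ c = e)
    (hx : ∀ c : G, c ^ 2 ≠ x) (y : G) : (∃ z, y = z ^ 2) ∨ ∃ z, y = x * z ^ 2 := by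
  classical
  set f : G →* G := powMonoidHom 2 with hf
  have hker : Nat.card f.ker ≤ 2 := by
    have : (f.ker : Set G) ⊆ ({1, e} : Finset G) := fun c hc => by
      simpa using he c (by simpa [hf] using hc)
    calc Nat.card f.ker ≤ Nat.card ({1, e} : Finset G) := Nat.card_mono (Finset.finite_toSet _) this
      _ ≤ 2 := by
        rw [Nat.card_eq_fintype_card, Fintype.card_coe]; exact Finset.card_le_two
  have hidx : f.range.index ≤ 2 := by
    have h1 := f.range.card_mul_index
    have h2 := f.ker.card_mul_index
    rw [Subgroup.index_ker, ← h1, mul_comm] at h2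
    have h3 := Nat.eq_of_mul_eq_mul_left Nat.card_pos h2
    rwa [← h3]
  have hxr : x ∉ f.range := fun ⟨c, hc⟩ => hx c hc
  have hidx2 : f.range.index = 2 := by
    have h0 : f.range.index ≠ 0 := Subgroup.index_ne_zero_of_finite
    have h1 : f.range.index ≠ 1 := fun h => hxr (by rw [Subgroup.index_eq_one.1 h]; trivial)
    omega
  by_cases hy : y ∈ f.range
  · obtain ⟨z, hz⟩ := hy
    exact .inl ⟨z, hz.symm⟩
  · have : x⁻¹ * y ∈ f.range :=
      (Subgroup.mul_mem_iff_of_index_two hidx2).2 (by simp [hxr, hy])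
    obtain ⟨z, hz⟩ := this
    exact .inr ⟨z, by rw [show z ^ 2 = x⁻¹ * y from hz, mul_inv_cancel_left]⟩

theorem exists_eq_pow_mul_pow_of_involution (he : ∀ c : G, c ^ 2 = 1 → c = 1 ∨ c = e)
    (hx : ∀ c : G, c ^ 2 ≠ x) (k : ℕ) : ∀ y : G, ∃ (j : ℕ) (z : G), y = x ^ j * z ^ 2 ^ k := by
  induction k with
  | zero => exact fun y => ⟨0, y, by simp⟩
  | succ k ih =>
    intro y
    obtain ⟨j, z, rfl⟩ := ih y
    rcases exists_sq_or_mul_sq_of_involution he hx z with ⟨w, rfl⟩ | ⟨w, rfl⟩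
    · exact ⟨j, w, by rw [← pow_mul, pow_succ, mul_comm 2]⟩
    · exact ⟨j + 2 ^ k, w, by rw [mul_pow, ← pow_mul, pow_add, mul_assoc, pow_succ, mul_comm 2]⟩

variable {v g : ℕ} (hG : Nat.card G = 2 ^ v * g) (hg : Odd g)
  (he : ∀ c : G, c ^ 2 = 1 → c = 1 ∨ c = e) (hx : ∀ c : G, c ^ 2 ≠ x)

include hG hg he hx

theorem Sylow.eq_zpowers_of_involution (P : Sylow 2 G) :
    (P : Subgroup G) = Subgroup.zpowers (x ^ g) := by
  have hle : (P : Subgroup G) ≤ Subgroup.zpowers (x ^ g) := by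
    intro y hy
    obtain ⟨j, z, hz⟩ := exists_eq_pow_mul_pow_of_involution he hx v y
    have h1 : y ^ g = (x ^ g) ^ j := by
      rw [hz, mul_pow, ← pow_mul z, ← hG, pow_card_eq_one', mul_one, ← pow_mul, ← pow_mul,
        mul_comm]
    obtain ⟨n, hn⟩ := P.isPGroup'.exists_card_eq
    have h2 : orderOf y ∣ 2 ^ n := by
      rw [← hn]
      exact Subgroup.orderOf_dvd_natCard _ hy
    have hcop : (orderOf y).Coprime g :=
      Nat.Coprime.coprime_dvd_left h2 (Nat.Coprime.pow_left _ hg.coprime_two_left)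
    obtain ⟨m, hm⟩ := exists_pow_eq_self_of_coprime hcop.symm
    rw [← hm, h1]
    exact Subgroup.pow_mem _ (Subgroup.pow_mem _ (Subgroup.mem_zpowers _) _) _
  refine (P.is_maximal' ?_ hle).symm
  rw [IsPGroup.iff_orderOf]
  rintro ⟨y, hy⟩
  rw [Subgroup.orderOf_mk]
  obtain ⟨i, -, hi⟩ := (Nat.dvd_prime_pow Nat.prime_two).1
    ((orderOf_dvd_of_mem_zpowers hy).trans (orderOf_dvd_of_pow_eq_one (n := 2 ^ v)
      (by rw [← pow_mul, mul_comm, ← hG, pow_card_eq_one'])))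
  exact ⟨i, hi⟩

theorem orderOf_pow_of_involution : orderOf (x ^ g) = 2 ^ v := by
  have : Fact (Nat.Prime 2) := ⟨Nat.prime_two⟩
  have P : Sylow 2 G := default
  have h1 := P.card_eq_multiplicity
  rw [Sylow.eq_zpowers_of_involution hG hg he hx P, Nat.card_zpowers] at h1
  rw [h1, hG, Nat.factorization_mul (by positivity) hg.pos.ne', Finsupp.add_apply,
    Nat.Prime.factorization_pow Nat.prime_two, Finsupp.single_eq_same,
    Nat.factorization_eq_zero_of_not_dvd (Nat.two_dvd_ne_zero.2 (Nat.odd_iff.1 hg)), add_zero]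

theorem pos_of_involution : 0 < v := by
  rw [Nat.pos_iff_ne_zero]
  rintro rfl
  obtain ⟨k, rfl⟩ := hg
  refine hx (x ^ (k + 1)) ?_
  rw [← pow_mul, show (k + 1) * 2 = (2 * k + 1) + 1 by ring, pow_succ]
  have := pow_card_eq_one' (x := x)
  rw [hG, pow_zero, one_mul] at this
  rw [this, one_mul]

theorem pow_eq_involution : x ^ (g * 2 ^ (v - 1)) = e := by
  have hv := pos_of_involution hG hg he hx
  have ho := orderOf_pow_of_involution hG hg he hx
  refine (he _ ?_).resolve_left fun h => ?_
  · rw [← pow_mul, mul_assoc, ← pow_succ, Nat.sub_add_cancel hv, mul_comm, ← hG, pow_card_eq_one']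
  · rw [pow_mul] at h
    have := orderOf_dvd_of_pow_eq_one h
    rw [ho, Nat.pow_dvd_pow_iff_le_right (by norm_num)] at this
    omega

theorem Sylow.nonempty_mulEquiv_of_involution {h n : ℕ} (hh : Odd h) (hxh : orderOf (x ^ h) = 2 ^ n)
    (P : Sylow 2 G) : Nonempty (P ≃* Multiplicative (ZMod (2 ^ n))) := by
  have ho := orderOf_pow_of_involution hG hg he hx
  have h2 : orderOf ((x ^ g) ^ h) = orderOf (x ^ g) :=
    Nat.Coprime.orderOf_pow (by rw [ho]; exact Nat.Coprime.pow_left _ hh.coprime_two_left)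
  have h3 : orderOf ((x ^ h) ^ g) = orderOf (x ^ h) :=
    Nat.Coprime.orderOf_pow (by rw [hxh]; exact Nat.Coprime.pow_left _ hg.coprime_two_left)
  rw [← pow_mul, mul_comm, pow_mul, h3, hxh, ho] at h2
  have hP := Sylow.eq_zpowers_of_involution hG hg he hx P
  have hcard : Nat.card P = 2 ^ n := by
    rw [show Nat.card P = Nat.card (P : Subgroup G) from rfl, hP, Nat.card_zpowers, ho, h2]
  have hc : IsCyclic P := by
    have : IsCyclic (P : Subgroup G) := by rw [hP]; infer_instance
    exact this
  rw [← hcard]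
  exact ⟨(zmodCyclicMulEquiv hc).symm⟩

end TwoGroup

/-- The arithmetic of the ring of integers `O` of `ℚ(√(-pq))`, with conjugation `σ`. -/
structure IsQuadraticExtension {O : Type*} [CommRing O] (p q : ℕ) [Fact q.Prime]
    (σ : O ≃ₐ[ℤ] O) (δ θ : O) : Prop where
  mod_p : p % 8 = 5
  mod_q : q % 8 = 3
  legendre : legendreSym q p = 1
  delta_sq : δ ^ 2 = -(p * q)
  two_mul_theta : 2 * θ = 1 + δ
  conj_delta : σ δ = -δ
  exists_eq : ∀ x, ∃ a b : ℤ, x = a + b * θ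
  finrank : Module.finrank ℤ O = 2

theorem Ideal.span_pair_sq_of_sq_eq {O : Type*} [CommRing O] {l l' : ℕ} {δ : O}
    (hδ : δ ^ 2 = -(l * l')) (hl : IsCoprime (l : ℤ) l') :
    Ideal.span {(l : O), δ} * Ideal.span {(l : O), δ} = Ideal.span {(l : O)} := by
  obtain ⟨u, v, huv⟩ := hl
  have huv' : (u : O) * l + v * l' = 1 := by simpa using congrArg (Int.cast : ℤ → O) huv
  rw [Ideal.span_pair_mul_span_pair]
  apply le_antisymm
  · rw [Ideal.span_le]
    rintro x (rfl | rfl | rfl | rfl) <;> rw [SetLike.mem_coe, Ideal.mem_span_singleton]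
    · exact dvd_mul_right _ _
    · exact dvd_mul_right _ _
    · exact dvd_mul_left _ _
    · exact ⟨-l', by linear_combination hδ⟩
  · refine (Ideal.span_singleton_le_iff_mem _).2 ?_
    have h1 : (l * l : O) ∈ Ideal.span {(l * l : O), l * δ, δ * l, δ * δ} :=
      Ideal.subset_span (by simp)
    have h2 : δ * δ ∈ Ideal.span {(l * l : O), l * δ, δ * l, δ * δ} :=
      Ideal.subset_span (by simp)
    have h3 := Ideal.add_mem _ (Ideal.mul_mem_left _ (u : O) h1) (Ideal.mul_mem_left _ (-v : O) h2)
    rwa [show u * (l * l : O) + -v * (δ * δ) = l by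
      linear_combination (l : O) * huv' - (v : O) * hδ] at h3

theorem Ideal.span_pair_mul_span_pair_of_sq_eq {O : Type*} [CommRing O] {l l' : ℕ} {δ : O}
    (hδ : δ ^ 2 = -(l * l')) (hl : IsCoprime (l : ℤ) l') :
    Ideal.span {(l : O), δ} * Ideal.span {(l' : O), δ} = Ideal.span {δ} := by
  obtain ⟨u, v, huv⟩ := hl
  have huv' : (u : O) * l + v * l' = 1 := by simpa using congrArg (Int.cast : ℤ → O) huv
  rw [Ideal.span_pair_mul_span_pair]
  apply le_antisymm
  · rw [Ideal.span_le]
    rintro x (rfl | rfl | rfl | rfl) <;> rw [SetLike.mem_coe, Ideal.mem_span_singleton]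
    · exact ⟨-δ, by linear_combination hδ⟩
    · exact dvd_mul_left _ _
    · exact dvd_mul_right _ _
    · exact dvd_mul_right _ _
  · refine (Ideal.span_singleton_le_iff_mem _).2 ?_
    have h1 : l * δ ∈ Ideal.span {(l * l' : O), l * δ, δ * l', δ * δ} :=
      Ideal.subset_span (by simp)
    have h2 : δ * l' ∈ Ideal.span {(l * l' : O), l * δ, δ * l', δ * δ} :=
      Ideal.subset_span (by simp)
    have h3 := Ideal.add_mem _ (Ideal.mul_mem_left _ (u : O) h1) (Ideal.mul_mem_left _ (v : O) h2)
    rwa [show u * (l * δ) + v * (δ * l') = δ by linear_combination δ * huv'] at h3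

namespace IsQuadraticExtension

variable {O : Type u} [CommRing O] [IsDedekindDomain O] [Module.Free ℤ O] [Module.Finite ℤ O]
  [CharZero O] {p q : ℕ} [hpP : Fact p.Prime] [hqP : Fact q.Prime] {σ : O ≃ₐ[ℤ] O} {δ θ : O}
  (h : IsQuadraticExtension p q σ δ θ)

include h

theorem conj_theta : σ θ = 1 - θ := by
  have h1 := congrArg σ h.two_mul_theta
  rw [map_mul, map_add, h.conj_delta, map_one, map_ofNat] at h1
  exact mul_left_cancel₀ (two_ne_zero' O) (by linear_combination h1 + h.two_mul_theta)

theorem delta_ne_zero : δ ≠ 0 := by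
  rintro rfl
  have h1 := h.delta_sq
  have hp0 : (p : O) ≠ 0 := by exact_mod_cast hpP.out.ne_zero
  have hq0 : (q : O) ≠ 0 := by exact_mod_cast hqP.out.ne_zero
  exact mul_ne_zero hp0 hq0 (by linear_combination h1)

theorem conj_conj (x : O) : σ (σ x) = x := by
  obtain ⟨a, b, rfl⟩ := h.exists_eq x
  simp only [map_add, map_mul, map_intCast, h.conj_theta, map_sub, map_one]
  ring

theorem conj_fix (x : O) (hx : σ x = x) : ∃ r : ℤ, algebraMap ℤ O r = x := by
  obtain ⟨a, b, rfl⟩ := h.exists_eq x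
  simp only [map_add, map_mul, map_intCast, h.conj_theta] at hx
  have h1 : (b : O) * δ = 0 := by linear_combination -hx - b * h.two_mul_theta
  have h2 := (mul_eq_zero.1 h1).resolve_right h.delta_ne_zero
  exact ⟨a, by rw [h2]; simp⟩

theorem intCast_dvd {a b : ℤ} (hab : (a : O) ∣ b) : a ∣ b := by
  by_cases ha : a = 0
  · subst ha
    rw [Int.cast_zero, zero_dvd_iff] at hab
    simpa using hab
  obtain ⟨y, hy⟩ := hab
  have ha' : (a : O) ≠ 0 := by exact_mod_cast ha
  obtain ⟨r, rfl⟩ := h.conj_fix y (mul_left_cancel₀ ha' (by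
    have := congrArg σ hy
    rw [map_mul, map_intCast, map_intCast] at this
    rw [← this, hy]))
  refine ⟨r, ?_⟩
  rw [eq_intCast] at hy
  exact_mod_cast hy

theorem four_mul_mul_conj (z : O) :
    ∃ A B : ℤ, 4 * (z * σ z) = ((A ^ 2 + p * q * B ^ 2 : ℤ) : O) := by
  obtain ⟨a, b, rfl⟩ := h.exists_eq z
  refine ⟨2 * a + b, b, ?_⟩
  simp only [map_add, map_mul, map_intCast, h.conj_theta]
  push_cast
  linear_combination -(b : O) ^ 2 * (2 * θ - 1 + δ) * h.two_mul_theta - (b : O) ^ 2 * h.delta_sq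

theorem exists_four_mul_eq {I : Ideal O} {n : ℤ} (hn : 0 ≤ n)
    (hI : I * I.map σ = Ideal.span {(n : O)}) {z : O} (hz : I = Ideal.span {z}) :
    ∃ A B : ℤ, 4 * n = A ^ 2 + p * q * B ^ 2 := by
  obtain ⟨N, hN⟩ := h.conj_fix (z * σ z) (by rw [map_mul, h.conj_conj, mul_comm])
  rw [eq_intCast] at hN
  obtain ⟨A, B, hAB⟩ := h.four_mul_mul_conj z
  rw [← hN] at hAB
  have hAB' : 4 * N = A ^ 2 + p * q * B ^ 2 := by exact_mod_cast hAB
  rw [hz, Ideal.map_span, Set.image_singleton, Ideal.span_singleton_mul_span_singleton,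
    ← hN] at hI
  have hN0 : 0 ≤ N := by
    have : (0 : ℤ) ≤ 4 * N := by rw [hAB']; positivity
    omega
  have h1 := h.intCast_dvd (Ideal.span_singleton_le_span_singleton.1 hI.le)
  have h2 := h.intCast_dvd (Ideal.span_singleton_le_span_singleton.1 hI.ge)
  exact ⟨A, B, by rw [← hAB', Int.dvd_antisymm hn hN0 h1 h2]⟩

theorem coprime : IsCoprime (p : ℤ) q := by
  rw [Nat.isCoprime_iff_coprime, Nat.coprime_primes hpP.out hqP.out]
  rintro rfl
  have h1 := h.mod_p
  have h2 := h.mod_q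
  omega

theorem not_isUnit_natCast {l : ℕ} (hl : l.Prime) : ¬ IsUnit (l : O) := fun hu => by
  have h1 : ((l : ℤ) : O) ∣ ((1 : ℤ) : O) := by simpa using hu.dvd
  have := h.intCast_dvd h1
  exact hl.one_lt.ne' (by exact_mod_cast Int.eq_one_of_dvd_one (by positivity) this)

theorem span_two_theta_mul_map :
    Ideal.span {2, θ} * (Ideal.span {2, θ}).map σ = Ideal.span {(2 : O)} := by
  obtain ⟨k, hk⟩ : ∃ k : ℤ, (1 + p * q : ℤ) = 8 * k := by
    have h1 : (p * q) % 8 = 7 := by rw [Nat.mul_mod, h.mod_p, h.mod_q]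
    exact ⟨(p * q / 8 : ℕ) + 1, by zify at h1; push_cast; omega⟩
  have hk' : (1 + p * q : O) = 8 * k := by exact_mod_cast hk
  rw [Ideal.map_span, Set.image_pair, h.conj_theta, map_ofNat]
  refine Ideal.span_pair_mul_span_pair_one_sub (c := (k : O))
    (mul_left_cancel₀ (show (4 : O) ≠ 0 by norm_num) ?_)
  linear_combination hk' + (1 - 2 * θ - δ) * h.two_mul_theta - h.delta_sq

/-- The class of a prime above `2` is not a square. -/
theorem sq_ne_mk0 (C : (Ideal O)⁰) (hC : (C : Ideal O) = Ideal.span {2, θ}) (c : ClassGroup O) :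
    c ^ 2 ≠ ClassGroup.mk0 C := by
  intro hc
  have hp0 : (p : O) ≠ 0 := by exact_mod_cast hpP.out.ne_zero
  obtain ⟨J, hJ, hJN⟩ := ClassGroup.exists_mk0_eq_sup_eq_top c⁻¹
    (show Ideal.span {(p : O)} ≠ ⊥ by simpa using hpP.out.ne_zero)
  have h1 : ClassGroup.mk0 (C * J ^ 2) = 1 := by
    rw [map_mul, map_pow, hJ, ← hc, ← mul_pow, mul_inv_cancel, one_pow]
  obtain ⟨z, -, hz⟩ := ClassGroup.mk0_eq_one_iff_exists.1 h1
  rw [Submonoid.coe_mul, SubmonoidClass.coe_pow, hC] at hz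
  obtain ⟨r, hr⟩ := Ideal.exists_mul_map_eq_span h.conj_conj h.conj_fix (J : Ideal O)
  rw [eq_intCast] at hr
  obtain ⟨A, B, hAB⟩ := h.exists_four_mul_eq (n := 2 * r ^ 2) (by positivity) (by
    rw [Ideal.map_mul, Ideal.map_pow, mul_mul_mul_comm, ← mul_pow, hr, h.span_two_theta_mul_map,
      Ideal.span_singleton_pow, Ideal.span_singleton_mul_span_singleton]
    push_cast; rfl) hz
  have hpr : ¬ (p : ℤ) ∣ r := by
    rintro ⟨s, rfl⟩
    have h2 : IsCoprime (J : Ideal O) (Ideal.span {(p : O)}) := Ideal.isCoprime_iff_sup_eq.2 hJN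
    have h3 : IsCoprime ((J : Ideal O).map σ) (Ideal.span {(p : O)}) := by
      rw [Ideal.isCoprime_iff_sup_eq]
      have := congrArg (Ideal.map σ) hJN
      rwa [Ideal.map_sup, Ideal.map_top, Ideal.map_span, Set.image_singleton, map_natCast] at this
    have h4 := Ideal.isCoprime_iff_sup_eq.1 (h2.mul_left h3)
    rw [hr, sup_eq_right.2 (Ideal.span_singleton_le_span_singleton.2
      (⟨s, by push_cast; rfl⟩ : (p : O) ∣ ((p * s : ℤ) : O))),
      Ideal.span_singleton_eq_top] at h4
    exact h.not_isUnit_natCast hpP.out h4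
  have hpI : Prime (p : ℤ) := Nat.prime_iff_prime_int.1 hpP.out
  have hp2 : ¬ (p : ℤ) ∣ 2 := fun h2 => by
    have := Int.le_of_dvd (by norm_num) h2
    have := h.mod_p
    omega
  have hA : ¬ (p : ℤ) ∣ A ^ 2 := fun h2 => by
    have h3 : (p : ℤ) ∣ 2 * (2 * (2 * r ^ 2)) := by
      rw [show 2 * (2 * (2 * r ^ 2)) = A ^ 2 + p * (q * B ^ 2) by linear_combination hAB]
      exact dvd_add h2 (dvd_mul_right _ _)
    exact hpr (hpI.dvd_of_dvd_pow
      ((((hpI.dvd_or_dvd h3).resolve_left hp2 |> hpI.dvd_or_dvd).resolve_left hp2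
        |> hpI.dvd_or_dvd).resolve_left hp2))
  have h5 := legendreSym_mul_eq_one_of_mul_sq (p := p) (c := A ^ 2) (d := 2) (t := 2 * r)
    (k := q * B ^ 2) hA (by linear_combination hAB)
  rw [legendreSym.mul, legendreSym_two_of_five h.mod_p, legendreSym.sq_one' _
    (fun h0 => hA (((ZMod.intCast_zmod_eq_zero_iff_dvd _ _).1 h0).pow two_ne_zero))] at h5
  norm_num at h5

theorem isMaximal_span_pair {l l' : ℕ} (hl : l.Prime) (hδ : δ ^ 2 = -(l * l'))
    (hll : IsCoprime (l : ℤ) l') : (Ideal.span {(l : O), δ}).IsMaximal := by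
  have h1 := congrArg Ideal.absNorm (Ideal.span_pair_sq_of_sq_eq hδ hll)
  rw [map_mul, Ideal.absNorm_span_natCast, h.finrank, ← sq] at h1
  have h2 : Ideal.absNorm (Ideal.span {(l : O), δ}) = l := Nat.pow_left_injective two_ne_zero h1
  have h3 := Ideal.isPrime_of_irreducible_absNorm (I := Ideal.span {(l : O), δ})
    (by rw [h2]; exact hl)
  refine h3.isMaximal fun h0 => ?_
  rw [h0, Ideal.absNorm_bot] at h2
  exact hl.ne_zero h2.symm

theorem eq_or_eq_of_sq_eq_one {P : (Ideal O)⁰} (hP : (P : Ideal O) = Ideal.span {(p : O), δ})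
    {c : ClassGroup O} (hc : c ^ 2 = 1) : c = 1 ∨ c = ClassGroup.mk0 P := by
  have hp0 : (p : O) ≠ 0 := by exact_mod_cast hpP.out.ne_zero
  have hq0 : (q : O) ≠ 0 := by exact_mod_cast hqP.out.ne_zero
  obtain ⟨J, rfl, hJ⟩ := ClassGroup.exists_map_eq_of_sq_eq_one h.conj_conj h.conj_fix
    h.delta_ne_zero h.conj_delta (N := Ideal.span {(p : O)}) (by simpa using hpP.out.ne_zero)
    (fun η z r hz hcop => by
      rcases Int.units_eq_one_or η with rfl | rfl
      · exact ⟨1, by simp⟩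
      · exfalso
        obtain ⟨A, B, hAB⟩ := h.four_mul_mul_conj z
        rw [hz, eq_intCast] at hAB
        have hAB' : 4 * (-1 * r ^ 2) = A ^ 2 + p * q * B ^ 2 := by exact_mod_cast hAB
        have hr : r ^ 2 = 0 := by
          have : 0 ≤ A ^ 2 + p * q * B ^ 2 := by positivity
          nlinarith [sq_nonneg r]
        rw [hr, mul_zero, map_zero] at hz
        have hz0 : z = 0 := by
          rcases mul_eq_zero.1 hz with h0 | h0
          · exact h0
          · exact (map_eq_zero_iff σ σ.injective).1 h0
        rw [hz0, Ideal.span_singleton_eq_bot.2 rfl, bot_sup_eq, Ideal.span_singleton_eq_top] at hcop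
        exact h.not_isUnit_natCast hpP.out hcop) hc
  set Q : (Ideal O)⁰ := ⟨Ideal.span {(q : O), δ}, mem_nonZeroDivisors_of_ne_zero fun h0 => hq0 (by
    have : (q : O) ∈ Ideal.span {(q : O), δ} := Ideal.subset_span (by simp)
    rw [h0] at this
    simpa using this)⟩ with hQ
  have hδ' : δ ^ 2 = -((q : O) * p) := by rw [h.delta_sq, mul_comm]
  have hPP : ClassGroup.mk0 P * ClassGroup.mk0 P = 1 := by
    rw [← map_mul, ClassGroup.mk0_eq_one_iff_exists]
    exact ⟨p, hp0, by rw [Submonoid.coe_mul, hP]; exact Ideal.span_pair_sq_of_sq_eq h.delta_sq h.coprime⟩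
  have hPQ : ClassGroup.mk0 P * ClassGroup.mk0 Q = 1 := by
    rw [← map_mul, ClassGroup.mk0_eq_one_iff_exists]
    exact ⟨δ, h.delta_ne_zero, by
      rw [Submonoid.coe_mul, hP]; exact Ideal.span_pair_mul_span_pair_of_sq_eq h.delta_sq h.coprime⟩
  have hQP : ClassGroup.mk0 Q = ClassGroup.mk0 P := by
    rw [← mul_right_inj, hPQ, hPP]
  have hle : Subgroup.closure {c | ∃ P : (Ideal O)⁰, (P : Ideal O).IsPrime ∧
      (∀ s, s - σ s ∈ (P : Ideal O)) ∧ ClassGroup.mk0 P = c} ≤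
      Subgroup.zpowers (ClassGroup.mk0 P) := by
    rw [Subgroup.closure_le]
    rintro c ⟨I, hI, hIT, rfl⟩
    have hδI : δ ∈ (I : Ideal O) := by
      have h1 := hIT θ
      rwa [h.conj_theta, show θ - (1 - θ) = δ by linear_combination h.two_mul_theta] at h1
    have hpq : (p * q : O) ∈ (I : Ideal O) := by
      rw [show (p * q : O) = -δ * δ by linear_combination h.delta_sq]
      exact Ideal.mul_mem_left _ _ hδI
    have hmem : ∀ l : ℕ, (l : O) ∈ (I : Ideal O) → Ideal.span {(l : O), δ} ≤ I := fun l hl => by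
      rw [Ideal.span_le]
      rintro x (rfl | rfl)
      · exact hl
      · exact hδI
    rcases hI.mem_or_mem hpq with h1 | h1
    · have : I = P := Subtype.ext (hP.trans ((h.isMaximal_span_pair hpP.out h.delta_sq
        h.coprime).eq_of_le hI.ne_top (hmem p h1))).symm
      rw [this]
      exact Subgroup.mem_zpowers _
    · have : I = Q := Subtype.ext ((h.isMaximal_span_pair hqP.out hδ'
        h.coprime.symm).eq_of_le hI.ne_top (hmem q h1)).symm
      rw [this, hQP]
      exact Subgroup.mem_zpowers _
  obtain ⟨n, hn⟩ := hle (ClassGroup.mk0_mem_closure_of_map_eq h.conj_conj h.conj_fix J hJ)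
  rcases Int.even_or_odd' n with ⟨k, rfl | rfl⟩
  · left
    rw [← hn]
    simp [zpow_mul, sq, hPP]
  · right
    rw [← hn]
    simp [zpow_add, zpow_mul, sq, hPP]

theorem exists_span_pow_mul_eq {v g : ℕ} [Finite (ClassGroup O)]
    (hG : Nat.card (ClassGroup O) = 2 ^ v * g) (hg : Odd g) :
    ∃ n : ℕ, v = n + 2 ∧ ∃ k : O, k ≠ 0 ∧
      Ideal.span {2, θ} ^ (g * 2 ^ (n + 1)) * Ideal.span {(p : O), δ} = Ideal.span {k} := by
  have hp0 : (p : O) ≠ 0 := by exact_mod_cast hpP.out.ne_zero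
  set P : (Ideal O)⁰ := ⟨Ideal.span {(p : O), δ}, mem_nonZeroDivisors_of_ne_zero fun h0 => hp0 (by
    have : (p : O) ∈ Ideal.span {(p : O), δ} := Ideal.subset_span (by simp)
    rw [h0] at this
    simpa using this)⟩ with hP
  set C : (Ideal O)⁰ := ⟨Ideal.span {2, θ}, mem_nonZeroDivisors_of_ne_zero fun h0 =>
    two_ne_zero' O (by
      have : (2 : O) ∈ Ideal.span {2, θ} := Ideal.subset_span (by simp)
      rw [h0] at this
      simp at this)⟩ with hC
  have he := fun c (hc : c ^ 2 = 1) => h.eq_or_eq_of_sq_eq_one (P := P) rfl hc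
  have hx := h.sq_ne_mk0 C rfl
  have hPP : Ideal.span {(p : O), δ} * Ideal.span {(p : O), δ} = Ideal.span {(p : O)} :=
    Ideal.span_pair_sq_of_sq_eq h.delta_sq h.coprime
  have h1 := pow_eq_involution hG hg he hx
  have h2 : ClassGroup.mk0 (C ^ (g * 2 ^ (v - 1)) * P) = 1 := by
    rw [map_mul, map_pow, h1, ← map_mul, ClassGroup.mk0_eq_one_iff_exists]
    exact ⟨p, hp0, hPP⟩
  obtain ⟨k, hk0, hk⟩ := ClassGroup.mk0_eq_one_iff_exists.1 h2
  rw [Submonoid.coe_mul, SubmonoidClass.coe_pow] at hk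
  change Ideal.span {2, θ} ^ _ * Ideal.span {(p : O), δ} = _ at hk
  have hv := pos_of_involution hG hg he hx
  obtain ⟨n, rfl⟩ | rfl : (∃ n, v = n + 2) ∨ v = 1 := by
    rcases Nat.lt_or_ge v 2 with h3 | h3
    · right; omega
    · exact .inl ⟨v - 2, by omega⟩
  · exact ⟨n, rfl, k, hk0, hk⟩
  exfalso
  rw [Nat.sub_self, pow_zero, mul_one] at hk
  have hPσ : (Ideal.span {(p : O), δ}).map σ = Ideal.span {(p : O), δ} := by
    rw [Ideal.map_span, Set.image_pair, map_natCast, h.conj_delta]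
    apply le_antisymm
    · rw [Ideal.span_le]
      rintro x (rfl | rfl)
      · exact Ideal.subset_span (by simp)
      · exact Ideal.neg_mem_iff _ |>.2 (Ideal.subset_span (by simp))
    · rw [Ideal.span_le]
      rintro x (rfl | rfl)
      · exact Ideal.subset_span (by simp)
      · exact Ideal.neg_mem_iff _ |>.1 (Ideal.subset_span (by simp))
  obtain ⟨A, B, hAB⟩ := h.exists_four_mul_eq (n := 2 ^ g * p) (by positivity) (by
    rw [Ideal.map_mul, Ideal.map_pow, mul_mul_mul_comm, ← mul_pow, hPσ, hPP,
      h.span_two_theta_mul_map, Ideal.span_singleton_pow, Ideal.span_singleton_mul_span_singleton]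
    push_cast; rfl) hk
  have hqI : Prime (q : ℤ) := Nat.prime_iff_prime_int.1 hqP.out
  have hq2 : ¬ (q : ℤ) ∣ 2 := fun h2 => by
    have := Int.le_of_dvd (by norm_num) h2
    have := h.mod_q
    omega
  obtain ⟨j, rfl⟩ := hg
  have hA : ¬ (q : ℤ) ∣ A ^ 2 := fun h2 => by
    have h3 : (q : ℤ) ∣ 2 ^ (2 * j + 3) * p := by
      rw [show (2 : ℤ) ^ (2 * j + 3) * p = A ^ 2 + q * (p * B ^ 2) by linear_combination hAB]
      exact dvd_add h2 (dvd_mul_right _ _)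
    rcases hqI.dvd_or_dvd h3 with h4 | h4
    · exact hq2 (hqI.dvd_of_dvd_pow h4)
    · exact hqI.not_isUnit (h.coprime.isUnit_of_dvd' h4 dvd_rfl)
  have h5 := legendreSym_mul_eq_one_of_mul_sq (p := q) (c := A ^ 2) (d := 2 * p) (t := 2 ^ (j + 1))
    (k := p * B ^ 2) hA (by linear_combination hAB)
  rw [legendreSym.mul, legendreSym.mul, h.legendre, legendreSym_two_of_three h.mod_q,
    legendreSym.sq_one' _
    (fun h0 => hA (((ZMod.intCast_zmod_eq_zero_iff_dvd _ _).1 h0).pow two_ne_zero))] at h5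
  norm_num at h5

end IsQuadraticExtension

namespace IsOcticExtension

variable {R : Type v} {S : Type u} [CommRing R] [IsDomain R] [IsPrincipalIdealRing R]
  [CommRing S] [IsDedekindDomain S] [Module.Free ℤ S] [Module.Finite ℤ S] [CharZero S]
  [Algebra R S] [FaithfulSMul R S]
  {p q : ℕ} [hpP : Fact p.Prime] [hqP : Fact q.Prime]
  {σ : S ≃ₐ[R] S} {τ τ' : S ≃+* S} {ζ : R} {δ θ : S}
  (h : IsOcticExtension p q σ τ τ' ζ δ θ)

include h

theorem span_natCast_delta {w : S} (hw : w ^ 2 = p * q) (hσw : σ w = -w)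
    (hwδ : w = -(algebraMap R S ζ ^ 2 * δ)) {x y : ℤ} (hxy : (p : ℤ) * x ^ 2 - q * y ^ 2 = 1) :
    Ideal.span {(p : S), δ} = Ideal.span {p * x + y * w} := by
  have hp0 : (p : S) ≠ 0 := by exact_mod_cast hpP.out.ne_zero
  have hcop : IsCoprime (p : ℤ) q := Nat.isCoprime_iff_coprime.2 h.coprime
  have hI := Ideal.span_pair_sq_of_sq_eq h.delta_sq hcop
  have hεu : IsUnit ((p * x ^ 2 + q * y ^ 2 : S) + 2 * x * y * w) :=
    IsUnit.of_mul_eq_one _ (h.eps_mul_conj hw hσw hxy)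
  have hmem : (p * x + y * w : S) ∈ Ideal.span {(p : S), δ} := by
    rw [hwδ, show (p * x + y * -(algebraMap R S ζ ^ 2 * δ) : S) =
      x * p + -(y * algebraMap R S ζ ^ 2) * δ by ring]
    exact Ideal.add_mem _ (Ideal.mul_mem_left _ _ (Ideal.subset_span (by simp)))
      (Ideal.mul_mem_left _ _ (Ideal.subset_span (by simp)))
  obtain ⟨J, hJ⟩ := Ideal.dvd_iff_le.2 ((Ideal.span_singleton_le_iff_mem _).2 hmem)
  have h1 : Ideal.span {(p : S)} * (J * J) = Ideal.span {(p : S)} * 1 := by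
    rw [mul_one]
    nth_rw 1 [← hI]
    rw [mul_mul_mul_comm, ← hJ, Ideal.span_singleton_mul_span_singleton,
      ← Ideal.span_singleton_mul_right_unit hεu (p : S)]
    congr 2
    linear_combination (y : S) ^ 2 * hw
  have h2 := mul_left_cancel₀ (by simpa using hp0) h1
  have h3 : J = 1 := by
    rw [Ideal.one_eq_top, eq_top_iff, ← Ideal.one_eq_top, ← h2]
    exact Ideal.mul_le_left
  rw [hJ, h3, mul_one]

theorem nonempty_sylow_mulEquiv [Finite (ClassGroup S)] {O : Type*} [CommRing O]
    [IsDedekindDomain O] [Module.Free ℤ O] [Module.Finite ℤ O] [CharZero O]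
    [Finite (ClassGroup O)] {σO : O ≃ₐ[ℤ] O} {δO θO : O}
    (hO : IsQuadraticExtension p q σO δO θO) (ι : O →+* S) (hι : Function.Injective ι)
    (hιδ : ι δO = δ) (hιθ : ι θO = θ) {m : ℕ}
    (hm : (Nat.card (ClassGroup O)).factorization 2 = m) (P : Sylow 2 (ClassGroup S)) :
    Nonempty (P ≃* Multiplicative (ZMod (2 ^ (m + 1)))) := by
  obtain ⟨w, hw, hσw, hτw, -, hwδ⟩ := h.exists_sqrt
  obtain ⟨x, y, hxy⟩ := h.pell
  have hβ := h.span_natCast_delta hw hσw hwδ hxy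
  have hcardO : Nat.card (ClassGroup O) ≠ 0 := Nat.card_pos.ne'
  have hcardS : Nat.card (ClassGroup S) ≠ 0 := Nat.card_pos.ne'
  obtain ⟨v, g, hg, hO2⟩ := Nat.exists_eq_two_pow_mul_odd hcardO
  obtain ⟨v', g', hg', hS2⟩ := Nat.exists_eq_two_pow_mul_odd hcardS
  have hvm : v = m := by
    rw [← hm, hO2, Nat.factorization_mul (by positivity) hg.pos.ne', Finsupp.add_apply,
      Nat.Prime.factorization_pow Nat.prime_two, Finsupp.single_eq_same,
      Nat.factorization_eq_zero_of_not_dvd (Nat.two_dvd_ne_zero.2 (Nat.odd_iff.1 hg)), add_zero]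
  obtain ⟨n, hn, k, hk0, hk⟩ := hO.exists_span_pow_mul_eq hO2 hg
  have hkS := congrArg (Ideal.map ι) hk
  rw [Ideal.map_mul, Ideal.map_pow, Ideal.map_span, Ideal.map_span, Ideal.map_span, Set.image_pair,
    Set.image_pair, Set.image_singleton, hιδ, hιθ, map_natCast, map_ofNat, hβ,
    ← h.span_pow_four, ← pow_mul] at hkS
  have hτk : τ (ι k) = ι k := by
    have hτθ : τ θ = θ := by
      have h1 := congrArg τ h.two_mul_theta
      rw [map_mul, map_add, h.tau_delta, map_one, map_ofNat] at h1
      exact mul_left_cancel₀ (two_ne_zero' S) (h1.trans h.two_mul_theta.symm)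
    obtain ⟨a, b, rfl⟩ := hO.exists_eq k
    simp only [map_add, map_mul, map_intCast, hιθ, hτθ]
  have hιk0 : ι k ≠ 0 := (map_ne_zero_iff ι hι).2 hk0
  have hβ0 : (p * x + y * w : S) ≠ 0 := by
    intro h0
    rw [h0, Ideal.span_singleton_eq_bot.2 rfl, ← Ideal.zero_eq_bot, mul_zero] at hkS
    exact hιk0 (Ideal.span_singleton_eq_bot.1 hkS.symm)
  have hθ0 : Ideal.span {1 - algebraMap R S ζ, θ} ≠ ⊥ := by
    intro h0
    rw [h0, Ideal.bot_pow (by have := hg.pos; positivity), ← Ideal.zero_eq_bot, zero_mul] at hkS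
    exact hιk0 (Ideal.span_singleton_eq_bot.1 hkS.symm)
  set C : (Ideal S)⁰ := ⟨_, mem_nonZeroDivisors_of_ne_zero hθ0⟩ with hC
  have hx := h.sq_ne_mk0 C rfl
  obtain ⟨e, he⟩ := h.exists_forall_sq_eq_one
  refine Sylow.nonempty_mulEquiv_of_involution hS2 hg' he hx hg ?_ P
  have : Fact (Nat.Prime 2) := ⟨Nat.prime_two⟩
  rw [← hvm, hn, show n + 2 + 1 = (n + 2) + 1 from rfl]
  apply orderOf_eq_prime_pow
  · rw [← pow_mul, ← map_pow, ClassGroup.mk0_eq_one_iff_exists]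
    rintro ⟨α, hα0, hα⟩
    rw [SubmonoidClass.coe_pow] at hα
    change Ideal.span {1 - algebraMap R S ζ, θ} ^ _ = _ at hα
    rw [show 4 * (g * 2 ^ (n + 1)) = g * 2 ^ (n + 2) * 2 by ring, pow_mul, hα,
      Ideal.span_singleton_pow, Ideal.span_singleton_mul_span_singleton,
      Ideal.span_singleton_eq_span_singleton] at hkS
    obtain ⟨W, hW⟩ := hkS.symm
    exact h.sq_mul_ne_of_tau_fixed hw hσw hxy hτw α (ι k) W hιk0 hτk hW.symm
  · rw [← pow_mul, ← map_pow]
    set B : (Ideal S)⁰ := ⟨Ideal.span {(p * x + y * w : S)},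
      mem_nonZeroDivisors_of_ne_zero (by simpa using hβ0)⟩ with hB
    have h1 : ClassGroup.mk0 B = 1 := ClassGroup.mk0_eq_one_iff_exists.2 ⟨_, hβ0, rfl⟩
    rw [← mul_one (ClassGroup.mk0 _), ← h1, ← map_mul, h1, ClassGroup.mk0_eq_one_iff_exists]
    refine ⟨ι k, hιk0, ?_⟩
    rw [Submonoid.coe_mul, SubmonoidClass.coe_pow, ← hkS,
      show 4 * (g * 2 ^ (n + 1)) = g * 2 ^ (n + 2 + 1) by ring]

end IsOcticExtension

theorem IntermediateField.exists_add_mul_of_mem_adjoin_insert {K L : Type*} [Field K] [Field L]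
    [Algebra K L] {S : Set L} {β : L} (hβ : β ^ 2 ∈ adjoin K S) {x : L}
    (hx : x ∈ adjoin K (insert β S)) :
    ∃ c ∈ adjoin K S, ∃ d ∈ adjoin K S, x = c + d * β := by
  induction hx using adjoin_induction with
  | mem x hx =>
    rcases hx with rfl | hx
    · exact ⟨0, zero_mem _, 1, one_mem _, by ring⟩
    · exact ⟨x, subset_adjoin K S hx, 0, zero_mem _, by ring⟩
  | algebraMap r => exact ⟨_, algebraMap_mem _ r, 0, zero_mem _, by ring⟩
  | add x y _ _ hx hy =>
    obtain ⟨c, hc, d, hd, rfl⟩ := hx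
    obtain ⟨c', hc', d', hd', rfl⟩ := hy
    exact ⟨_, add_mem hc hc', _, add_mem hd hd', by ring⟩
  | mul x y _ _ hx hy =>
    obtain ⟨c, hc, d, hd, rfl⟩ := hx
    obtain ⟨c', hc', d', hd', rfl⟩ := hy
    exact ⟨_, add_mem (mul_mem hc hc') (mul_mem (mul_mem hd hd') hβ), _,
      add_mem (mul_mem hc hd') (mul_mem hc' hd), by ring⟩
  | inv x _ hx =>
    obtain ⟨c, hc, d, hd, rfl⟩ := hx
    have hn : c ^ 2 - d ^ 2 * β ^ 2 ∈ adjoin K S :=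
      sub_mem (pow_mem hc 2) (mul_mem (pow_mem hd 2) hβ)
    by_cases h0 : c + d * β = 0
    · exact ⟨0, zero_mem _, 0, zero_mem _, by simp [h0]⟩
    by_cases h1 : c - d * β = 0
    · have hc0 : c = d * β := sub_eq_zero.mp h1
      have h2 : (c + d * β) ^ 2 ∈ adjoin K S := by
        rw [← hc0]
        exact pow_mem (add_mem hc hc) 2
      refine ⟨_, mul_mem hc (inv_mem h2), _, mul_mem hd (inv_mem h2), ?_⟩
      field_simp
    · refine ⟨_, mul_mem hc (inv_mem hn), _, neg_mem (mul_mem hd (inv_mem hn)), ?_⟩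
      have hn' : c ^ 2 - d ^ 2 * β ^ 2 = (c + d * β) * (c - d * β) := by ring
      rw [hn']
      field_simp
      ring

theorem IntermediateField.mem_adjoin_or_mul_mem_adjoin {K L : Type*} [Field K] [Field L]
    [CharZero L] [Algebra K L] {S : Set L} {β x : L} (hβ : β ^ 2 ∈ adjoin K S)
    (hx : x ∈ adjoin K (insert β S)) (hx2 : x ^ 2 ∈ adjoin K S) :
    x ∈ adjoin K S ∨ x * β ∈ adjoin K S := by
  obtain ⟨c, hc, d, hd, rfl⟩ := exists_add_mul_of_mem_adjoin_insert hβ hx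
  by_cases hc0 : c = 0
  · right
    have : (c + d * β) * β = d * β ^ 2 := by rw [hc0]; ring
    rw [this]
    exact mul_mem hd hβ
  left
  by_cases hd0 : d = 0
  · simpa [hd0] using hc
  refine add_mem hc (mul_mem hd ?_)
  have : β = ((c + d * β) ^ 2 - c ^ 2 - d ^ 2 * β ^ 2) * (2 * c * d)⁻¹ := by
    field_simp
    ring
  rw [this]
  refine mul_mem (sub_mem (sub_mem hx2 (pow_mem hc 2)) (mul_mem (pow_mem hd 2) hβ)) (inv_mem ?_)
  exact mul_mem (mul_mem (natCast_mem _ 2) hc) hd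

theorem IntermediateField.notMem_adjoin_pair_of_not_isSquare {L : Type*} [Field L] [CharZero L]
    {x y z : L} {X Y Z : ℚ} (hx : x ^ 2 = X) (hy : y ^ 2 = Y) (hz : z ^ 2 = Z)
    (h1 : ¬IsSquare X) (h2 : ¬IsSquare (X * Y)) (h3 : ¬IsSquare (X * Z))
    (h4 : ¬IsSquare (X * Y * Z)) : x ∉ adjoin ℚ {y, z} := by
  have key : ∀ (w : L) (W : ℚ), w ^ 2 = W → w ∈ adjoin ℚ (∅ : Set L) → IsSquare W := by
    intro w W hw hwm
    rw [adjoin_empty, mem_bot] at hwm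
    obtain ⟨r, rfl⟩ := hwm
    refine ⟨r, ?_⟩
    rw [← sq]
    have h : ((r ^ 2 : ℚ) : L) = W := by rw [← hw]; simp
    exact (Rat.cast_injective h).symm
  have hmem : ∀ (S : Set L) (r : ℚ), (r : L) ∈ adjoin ℚ S := fun S r => by
    exact algebraMap_mem (adjoin ℚ S) r
  intro hmx
  have key2 : ∀ (w : L) (W : ℚ), w ^ 2 = W → w ∈ adjoin ℚ {z} → IsSquare W ∨ IsSquare (W * Z) := by
    intro w W hw hwm
    rw [← insert_empty_eq] at hwm
    rcases mem_adjoin_or_mul_mem_adjoin (hz ▸ hmem _ _) hwm (hw ▸ hmem _ _) with h | h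
    · exact Or.inl (key w W hw h)
    · exact Or.inr (key _ _ (by rw [mul_pow, hw, hz]; push_cast; rfl) h)
  rcases mem_adjoin_or_mul_mem_adjoin (hy ▸ hmem _ _) hmx (hx ▸ hmem _ _) with h | h
  · exact (key2 x X hx h).elim h1 h3
  · exact (key2 _ (X * Y) (by rw [mul_pow, hx, hy]; push_cast; rfl) h).elim h2 h4

theorem IsGalois.rat_of_adjoin_eq_top {L : Type*} [Field L] [NumberField L] {S : Set L}
    (hS : ∀ s ∈ S, ∃ r : ℚ, s ^ 2 = r) (htop : IntermediateField.adjoin ℚ S = ⊤) :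
    IsGalois ℚ L := by
  have : Normal ℚ L := by
    rw [normal_iff]
    intro x
    refine ⟨Algebra.IsIntegral.isIntegral x, ?_⟩
    refine IntermediateField.splits_of_mem_adjoin (S := S) (F := ℚ) (K := L) ?_
      (htop ▸ IntermediateField.mem_top)
    intro s hs
    refine ⟨Algebra.IsIntegral.isIntegral s, ?_⟩
    obtain ⟨r, hr⟩ := hS s hs
    have hdvd : minpoly ℚ s ∣ Polynomial.X ^ 2 - Polynomial.C r := by
      apply minpoly.dvd
      simp [hr]
    have hsplit : ((Polynomial.X ^ 2 - Polynomial.C r : Polynomial ℚ).map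
        (algebraMap ℚ L)).Splits := by
      have : (Polynomial.X ^ 2 - Polynomial.C r : Polynomial ℚ).map (algebraMap ℚ L) =
          (Polynomial.X - Polynomial.C s) * (Polynomial.X - Polynomial.C (-s)) := by
        have h : algebraMap ℚ L r = s ^ 2 := by rw [hr]; simp
        simp only [Polynomial.map_sub, Polynomial.map_pow, Polynomial.map_X, Polynomial.map_C, h,
          map_pow, map_neg]
        ring
      rw [this]
      exact (Polynomial.Splits.X_sub_C _).mul (Polynomial.Splits.X_sub_C _)
    refine hsplit.of_dvd ?_ (Polynomial.map_dvd _ hdvd)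
    refine (Polynomial.map_ne_zero_iff (algebraMap ℚ L).injective).mpr ?_
    exact Polynomial.X_pow_sub_C_ne_zero two_pos r
  exact { }

theorem IntermediateField.exists_algEquiv_neg {L : Type*} [Field L] [NumberField L]
    [IsGalois ℚ L] {k : IntermediateField ℚ L} {x : L} (hx : x ∉ k) (hx2 : x ^ 2 ∈ k) :
    ∃ f : L ≃ₐ[k] L, f x = -x := by
  have hb : x ∉ (⊥ : IntermediateField k L) := by
    rw [mem_bot]
    rintro ⟨y, rfl⟩
    exact hx y.2
  rw [IsGalois.mem_bot_iff_fixed] at hb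
  push Not at hb
  obtain ⟨f, hf⟩ := hb
  refine ⟨f, ?_⟩
  have h : f x ^ 2 = x ^ 2 := by
    rw [← map_pow]
    exact f.commutes ⟨_, hx2⟩
  exact (sq_eq_sq_iff_eq_or_eq_neg.mp h).resolve_left hf

theorem IsPrimitiveRoot.pow_four_eq_neg_one {R : Type*} [CommRing R] [IsDomain R] {ζ : R}
    (hζ : IsPrimitiveRoot ζ 8) : ζ ^ 4 = -1 := by
  have h : ζ ^ 4 * ζ ^ 4 = 1 := by
    rw [← pow_add]
    exact hζ.pow_eq_one
  refine (mul_self_eq_one_iff.mp h).resolve_left ?_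
  exact hζ.pow_ne_one_of_pos_of_lt (by norm_num) (by norm_num)

theorem NumberField.isPrincipalIdealRing_of_isCyclotomicExtension_eight (F : Type*) [Field F]
    [NumberField F] [IsCyclotomicExtension {8} ℚ F] :
    IsPrincipalIdealRing (NumberField.RingOfIntegers F) := by
  have hinst : IsCyclotomicExtension {2 ^ 3} ℚ F := by
    norm_num
    infer_instance
  have hζ : IsPrimitiveRoot (IsCyclotomicExtension.zeta (2 ^ 3) ℚ F) (2 ^ 3) :=
    IsCyclotomicExtension.zeta_spec (2 ^ 3) ℚ F
  have hdisc : NumberField.discr F = 256 := by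
    have h := IsCyclotomicExtension.Rat.discr_prime_pow 2 3 F
    have ht : Nat.totient (2 ^ 3) = 4 := by decide
    rw [ht] at h
    norm_num at h
    exact h
  have hplaces : NumberField.InfinitePlace.nrComplexPlaces F = 2 := by
    rw [IsCyclotomicExtension.Rat.nrComplexPlaces_eq_totient_div_two 8]
    decide
  have hrank : Module.finrank ℚ F = 4 := by
    rw [IsCyclotomicExtension.finrank (n := 8) F
      (Polynomial.cyclotomic.irreducible_rat (by norm_num))]
    decide
  have hnorm : Ideal.absNorm (Ideal.span {hζ.toInteger - 1}) = 2 := by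
    rw [Ideal.absNorm_span_singleton,
      IsPrimitiveRoot.norm_toInteger_sub_one_of_eq_two_pow (k := 1) hζ]
    rfl
  have hz4 : hζ.toInteger ^ 4 = -1 := hζ.toInteger_isPrimitiveRoot.pow_four_eq_neg_one
  refine RingOfIntegers.isPrincipalIdealRing_of_isPrincipal_of_norm_le_of_isPrime ?_
  rintro ⟨P, hP0⟩ hP hle
  change Submodule.IsPrincipal P
  change P.IsPrime at hP
  change (Ideal.absNorm P : ℝ) ≤ _ at hle
  rw [hdisc, hplaces, hrank] at hle
  have hle' : Ideal.absNorm P ≤ 2 := by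
    have hpi := Real.pi_gt_three
    have h16 : √|((256 : ℤ) : ℝ)| = 16 := by
      rw [show |((256 : ℤ) : ℝ)| = 16 ^ 2 by norm_num]
      exact Real.sqrt_sq (by norm_num)
    rw [h16] at hle
    have h1 : (4 / Real.pi) ^ 2 ≤ (4 / 3) ^ 2 := by gcongr
    have h24 : ((Nat.factorial 4 : ℕ) : ℝ) = 24 := by norm_num [Nat.factorial]
    rw [h24] at hle
    have h3 : (Ideal.absNorm P : ℝ) < 3 := by
      refine lt_of_le_of_lt hle ?_
      norm_num at h1 ⊢
      nlinarith
    exact Nat.lt_succ_iff.mp (by exact_mod_cast h3)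
  have hne0 : Ideal.absNorm P ≠ 0 := Ideal.absNorm_ne_zero_of_nonZeroDivisors ⟨P, hP0⟩
  have hne1 : Ideal.absNorm P ≠ 1 := fun h => hP.ne_top (Ideal.absNorm_eq_one_iff.mp h)
  have h2 : Ideal.absNorm P = 2 := by omega
  have h2P : (2 : NumberField.RingOfIntegers F) ∈ P := by
    have := Ideal.absNorm_mem P
    rw [h2] at this
    exact_mod_cast this
  have hζP : hζ.toInteger - 1 ∈ P := by
    refine hP.mem_of_pow_mem 4 ?_
    have : (hζ.toInteger - 1) ^ 4 =
        (-2 * hζ.toInteger ^ 3 + 3 * hζ.toInteger ^ 2 - 2 * hζ.toInteger) * 2 := by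
      linear_combination hz4
    rw [this]
    exact P.mul_mem_left _ h2P
  have hle2 : Ideal.span {hζ.toInteger - 1} ≤ P := (Ideal.span_singleton_le_iff_mem _).mpr hζP
  have hprime : (Ideal.span {hζ.toInteger - 1}).IsPrime := by
    refine Ideal.isPrime_of_irreducible_absNorm ?_
    rw [hnorm]
    exact Nat.prime_two
  have hmax : (Ideal.span {hζ.toInteger - 1}).IsMaximal := by
    refine hprime.isMaximal ?_
    intro h
    rw [h] at hnorm
    simp at hnorm
  rw [← hmax.eq_of_le hP.ne_top hle2]
  exact ⟨⟨_, rfl⟩⟩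

theorem NumberField.natCast_dvd_pow_sub_self_of_isCyclotomicExtension_eight {F : Type*} [Field F]
    [NumberField F] [IsCyclotomicExtension {8} ℚ F] (ℓ : ℕ) [Fact ℓ.Prime] (hℓ : ℓ ≠ 2)
    (x : NumberField.RingOfIntegers F) :
    (ℓ : NumberField.RingOfIntegers F) ∣ x ^ ℓ ^ 2 - x := by
  have hζ : IsPrimitiveRoot (IsCyclotomicExtension.zeta 8 ℚ F) 8 :=
    IsCyclotomicExtension.zeta_spec 8 ℚ F
  by_cases hu : IsUnit (ℓ : NumberField.RingOfIntegers F)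
  · exact hu.dvd
  have hx : x ∈ Algebra.adjoin ℤ {hζ.toInteger} := by
    rw [IsCyclotomicExtension.Rat.adjoin_singleton_eq_top hζ]
    exact Algebra.mem_top
  have : CharP (NumberField.RingOfIntegers F ⧸ Ideal.span {(ℓ : NumberField.RingOfIntegers F)}) ℓ :=
    CharP.quotient _ ℓ hu
  rw [← Ideal.mem_span_singleton, ← Ideal.Quotient.eq, map_pow]
  have h8 : ℓ ^ 2 % 8 = 1 := by
    have : ℓ % 2 = 1 := ((Fact.out : ℓ.Prime).eq_two_or_odd).resolve_left hℓ
    have h4 : ℓ % 8 = 1 ∨ ℓ % 8 = 3 ∨ ℓ % 8 = 5 ∨ ℓ % 8 = 7 := by omega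
    rcases h4 with h | h | h | h <;> simp [Nat.pow_mod, h]
  induction hx using Algebra.adjoin_induction with
  | mem x hx =>
    rw [Set.mem_singleton_iff] at hx
    subst hx
    have h1 : hζ.toInteger ^ 8 = 1 := hζ.toInteger_isPrimitiveRoot.pow_eq_one
    rw [← map_pow, ← Nat.div_add_mod (ℓ ^ 2) 8, h8, pow_add, pow_mul, h1]
    simp
  | algebraMap r =>
    have h1 : (r : ZMod ℓ) ^ ℓ ^ 2 = r := by
      rw [sq, pow_mul, ZMod.pow_card, ZMod.pow_card]
    have h2 := congrArg (ZMod.castHom (dvd_refl ℓ)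
      (NumberField.RingOfIntegers F ⧸ Ideal.span {(ℓ : NumberField.RingOfIntegers F)})) h1
    rw [map_pow, map_intCast] at h2
    simpa only [algebraMap_int_eq, eq_intCast, map_intCast] using h2
  | add x y _ _ hx hy => rw [map_add, add_pow_char_pow, hx, hy]
  | mul x y _ _ hx hy => rw [map_mul, mul_pow, hx, hy]

theorem exists_eq_sq_of_forall_eq_zpow_mul_zpow {G : Type*} [CommGroup G] {t f : G}
    (h : ∀ x : G, ∃ a b : ℤ, x = t ^ a * f ^ b) {u v : G} (hu : ¬IsSquare u) (hv : ¬IsSquare v)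
    (huv : ¬IsSquare (u * v)) (w : G) :
    ∃ s : G, w = s ^ 2 ∨ w = u * s ^ 2 ∨ w = v * s ^ 2 ∨ w = u * v * s ^ 2 := by
  have key : ∀ a b : ℤ, Even a ∧ Even b → IsSquare (t ^ a * f ^ b) := fun a b hab =>
    (hab.1.isSquare_zpow t).mul (hab.2.isSquare_zpow f)
  have hmul : ∀ a b c d : ℤ, t ^ a * f ^ b * (t ^ c * f ^ d) = t ^ (a + c) * f ^ (b + d) := by
    intro a b c d
    rw [mul_mul_mul_comm, ← zpow_add, ← zpow_add]
  have hdiv : ∀ z : G, IsSquare (w * z) → ∃ s, w = z * s ^ 2 := by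
    rintro z ⟨s, hs⟩
    refine ⟨s * z⁻¹, ?_⟩
    rw [mul_pow, sq s, ← hs, sq]
    simp [mul_left_comm]
  by_contra! hcon
  have h0 : ¬IsSquare w := by
    rintro ⟨s, hs⟩
    exact (hcon s).1 (by rw [hs, sq])
  have h1 : ¬IsSquare (w * u) := fun h => (hdiv u h).elim fun s hs => (hcon s).2.1 hs
  have h2 : ¬IsSquare (w * v) := fun h => (hdiv v h).elim fun s hs => (hcon s).2.2.1 hs
  have h3 : ¬IsSquare (w * (u * v)) := fun h =>
    (hdiv _ h).elim fun s hs => (hcon s).2.2.2 hs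
  obtain ⟨a, b, rfl⟩ := h u
  obtain ⟨c, d, rfl⟩ := h v
  obtain ⟨e, g, rfl⟩ := h w
  simp only [hmul] at huv h1 h2 h3
  have hu' := mt (key _ _) hu
  have hv' := mt (key _ _) hv
  have huv' := mt (key _ _) huv
  have h0' := mt (key _ _) h0
  have h1' := mt (key _ _) h1
  have h2' := mt (key _ _) h2
  have h3' := mt (key _ _) h3
  simp only [Int.even_add] at hu' hv' huv' h0' h1' h2' h3'
  generalize Even a = A, Even b = B, Even c = C, Even d = D, Even e = X, Even g = Y at *
  by_cases A <;> by_cases B <;> by_cases C <;> by_cases D <;> by_cases X <;> by_cases Y <;> simp_all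

theorem NumberField.Units.exists_eq_sq_of_rank_eq_one {E : Type*} [Field E] [NumberField E]
    (hE : NumberField.Units.rank E = 1) {u v : (NumberField.RingOfIntegers E)ˣ}
    (hu : ¬IsSquare u) (hv : ¬IsSquare v) (huv : ¬IsSquare (u * v))
    (w : (NumberField.RingOfIntegers E)ˣ) :
    ∃ s : (NumberField.RingOfIntegers E)ˣ,
      w = s ^ 2 ∨ w = u * s ^ 2 ∨ w = v * s ^ 2 ∨ w = u * v * s ^ 2 := by
  obtain ⟨t, ht⟩ := IsCyclic.exists_generator (α := NumberField.Units.torsion E)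
  refine exists_eq_sq_of_forall_eq_zpow_mul_zpow
    (t := (t : (NumberField.RingOfIntegers E)ˣ))
    (f := NumberField.Units.fundSystem E ⟨0, by omega⟩) ?_ hu hv huv w
  intro x
  obtain ⟨⟨z, e⟩, hz, -⟩ := NumberField.Units.exist_unique_eq_mul_prod E x
  obtain ⟨a, ha⟩ := Subgroup.mem_zpowers_iff.mp (ht z)
  refine ⟨a, e ⟨0, by omega⟩, ?_⟩
  rw [hz, ← ha]
  congr 1
  have : ∀ i : Fin (NumberField.Units.rank E), i = ⟨0, by omega⟩ := fun i => by
    ext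
    have := i.2
    simp only
    omega
  exact Fintype.prod_eq_single _ fun i hi => (hi (this i)).elim

theorem NumberField.Units.rank_eq_one_of_sq_neg {E : Type*} [Field E] [NumberField E]
    (hE : Module.finrank ℚ E = 4) {z : E} {r : ℚ} (hz : z ^ 2 = r) (hr : r < 0) :
    NumberField.Units.rank E = 1 := by
  have hreal : NumberField.InfinitePlace.nrRealPlaces E = 0 := by
    classical
    rw [NumberField.InfinitePlace.nrRealPlaces, Fintype.card_eq_zero_iff]
    refine ⟨fun ⟨w, hw⟩ => ?_⟩
    have h := congrArg (NumberField.InfinitePlace.embedding_of_isReal hw) hz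
    rw [map_pow, map_ratCast] at h
    have h1 : (r : ℝ) < 0 := by exact_mod_cast hr
    nlinarith [sq_nonneg (NumberField.InfinitePlace.embedding_of_isReal hw z)]
  have h1 := NumberField.InfinitePlace.card_add_two_mul_card_eq_rank E
  have h2 := NumberField.InfinitePlace.card_eq_nrRealPlaces_add_nrComplexPlaces E
  rw [NumberField.Units.rank]
  omega

theorem NumberField.RingOfIntegers.not_isUnit_natCast {F : Type*} [Field F] [NumberField F] {ℓ : ℕ}
    (hℓ : ℓ.Prime) : ¬IsUnit (ℓ : NumberField.RingOfIntegers F) := by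
  intro hu
  have h := Ideal.absNorm_span_natCast (S := NumberField.RingOfIntegers F) ℓ
  rw [Ideal.span_singleton_eq_top.2 hu, Ideal.absNorm_top] at h
  exact hℓ.one_lt.ne' (Nat.pow_eq_one.1 h.symm |>.resolve_right Module.finrank_pos.ne')

theorem NumberField.exists_ringHom_pow_eq_self {F : Type u} [Field F]
    [NumberField F] [IsCyclotomicExtension {8} ℚ F] (ℓ : ℕ) [hℓ : Fact ℓ.Prime] (hℓ2 : ℓ ≠ 2) :
    ∃ (k : Type u) (_ : Field k) (φ : NumberField.RingOfIntegers F →+* k),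
      CharP k ℓ ∧ ∀ x, φ x ^ ℓ ^ 2 = φ x := by
  obtain ⟨k, hk, φ, hφ⟩ := exists_ringHom_field_of_not_isUnit
    (NumberField.RingOfIntegers.not_isUnit_natCast (F := F) hℓ.out)
  rw [map_natCast] at hφ
  refine ⟨k, hk, φ, (CharP.charP_iff_prime_eq_zero hℓ.out).2 hφ, fun x => ?_⟩
  obtain ⟨y, hy⟩ := NumberField.natCast_dvd_pow_sub_self_of_isCyclotomicExtension_eight ℓ hℓ2 x
  have := congrArg φ hy
  rw [map_mul, map_natCast, hφ, zero_mul, map_sub, map_pow] at this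
  exact sub_eq_zero.mp this

theorem map_unit_pow_half_eq_one {A k : Type*} [CommRing A] [Field k] {φ : A →+* k} {n : ℕ}
    (hn : n % 2 = 1) (hφ : ∀ x, φ x ^ n = φ x) {u : Aˣ} (hu : IsSquare u) :
    φ u ^ ((n - 1) / 2) = 1 := by
  obtain ⟨s, rfl⟩ := hu
  have h0 : φ (s : A) ≠ 0 := (s.isUnit.map φ).ne_zero
  have h2 : 2 * ((n - 1) / 2) = n - 1 := by omega
  rw [Units.val_mul, map_mul, ← sq, ← pow_mul, h2]
  refine mul_right_cancel₀ h0 ?_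
  rw [← pow_succ, Nat.sub_add_cancel (by omega), hφ, one_mul]

theorem NumberField.exists_unit_eq_of_isCyclotomicExtension_eight {F : Type*} [Field F]
    [NumberField F] [IsCyclotomicExtension {8} ℚ F] {p q : ℕ} [hpP : Fact p.Prime]
    [hqP : Fact q.Prime]
    (hp : p % 8 = 5) (hq : q % 8 = 3) {ζ : NumberField.RingOfIntegers F} (hζ : ζ ^ 4 = -1)
    (η : (NumberField.RingOfIntegers F)ˣ) :
    ∃ s : NumberField.RingOfIntegers F, (η : NumberField.RingOfIntegers F) = s ^ 2 ∨
      (η : NumberField.RingOfIntegers F) = ζ * s ^ 2 ∨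
      (η : NumberField.RingOfIntegers F) = (1 + (ζ - ζ ^ 3)) * s ^ 2 ∨
      (η : NumberField.RingOfIntegers F) = ζ * (1 + (ζ - ζ ^ 3)) * s ^ 2 := by
  have ha : (ζ - ζ ^ 3) ^ 2 = 2 := by linear_combination (-2 + ζ ^ 2) * hζ
  let u : (NumberField.RingOfIntegers F)ˣ :=
    ⟨ζ, -ζ ^ 3, by linear_combination -hζ, by linear_combination -hζ⟩
  let v : (NumberField.RingOfIntegers F)ˣ :=
    ⟨1 + (ζ - ζ ^ 3), (ζ - ζ ^ 3) - 1, by linear_combination ha, by linear_combination ha⟩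
  have huv : (u : NumberField.RingOfIntegers F) = ζ := rfl
  have hvv : (v : NumberField.RingOfIntegers F) = 1 + (ζ - ζ ^ 3) := rfl
  obtain ⟨k, hk, φ, hch, hφ⟩ := NumberField.exists_ringHom_pow_eq_self (F := F) p
    (by rintro rfl; omega)
  obtain ⟨k', hk', φ', hch', hφ'⟩ := NumberField.exists_ringHom_pow_eq_self (F := F) q
    (by rintro rfl; omega)
  have hp2 : p ^ 2 % 2 = 1 := by
    have : p % 2 = 1 := by omega
    simp [Nat.pow_mod, this]
  have hq2 : q ^ 2 % 2 = 1 := by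
    have : q % 2 = 1 := by omega
    simp [Nat.pow_mod, this]
  have hpne : (-1 : k) ≠ 1 := by
    have : Fact (2 < p) := ⟨by have := hpP.out.two_le; omega⟩
    exact CharP.neg_one_ne_one k p
  have hqne : (-1 : k') ≠ 1 := by
    have : Fact (2 < q) := ⟨by have := hqP.out.two_le; omega⟩
    exact CharP.neg_one_ne_one k' q
  have hzp : φ ζ ^ ((p ^ 2 - 1) / 2) = -1 :=
    pow_half_of_pow_four (by rw [← map_pow, hζ, map_neg, map_one]) (Or.inr hp)
  have hep : (1 + φ (ζ - ζ ^ 3)) ^ ((p ^ 2 - 1) / 2) = 1 :=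
    one_add_sqrt_two_pow_half_of_five hp (by rw [← map_pow, ha, map_ofNat])
  have heq : (1 + φ' (ζ - ζ ^ 3)) ^ ((q ^ 2 - 1) / 2) = -1 :=
    one_add_sqrt_two_pow_half_of_three hq (by rw [← map_pow, ha, map_ofNat])
  have hrank : NumberField.Units.rank F = 1 := by
    refine NumberField.Units.rank_eq_one_of_sq_neg (z := algebraMap _ F (ζ ^ 2)) (r := -1) ?_ ?_
      (by norm_num)
    · rw [IsCyclotomicExtension.finrank (n := 8) F
        (Polynomial.cyclotomic.irreducible_rat (by norm_num))]
      decide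
    · rw [← map_pow, ← pow_mul, hζ]
      simp
  obtain ⟨s, hs⟩ := NumberField.Units.exists_eq_sq_of_rank_eq_one hrank (u := u) (v := v)
    (fun hsq => hpne (by rw [← hzp, ← map_unit_pow_half_eq_one hp2 hφ hsq, huv]))
    (fun hsq => hqne (heq.symm.trans (by
      have := map_unit_pow_half_eq_one hq2 hφ' hsq
      rwa [hvv, map_add, map_one] at this)))
    (fun hsq => hpne (by
      have := map_unit_pow_half_eq_one hp2 hφ hsq
      rwa [Units.val_mul, huv, hvv, map_mul, mul_pow, hzp, map_add, map_one, hep, mul_one]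
        at this))
    η
  refine ⟨s, ?_⟩
  rcases hs with hs | hs | hs | hs
  · exact Or.inl (by rw [hs]; rfl)
  · exact Or.inr (Or.inl (by rw [hs]; rfl))
  · exact Or.inr (Or.inr (Or.inl (by rw [hs]; rfl)))
  · exact Or.inr (Or.inr (Or.inr (by rw [hs]; rfl)))

theorem NumberField.exists_algebraMap_ringOfIntegers_fixedField {L : Type*} [Field L]
    [NumberField L] {τ : L ≃ₐ[ℚ] L} {x : NumberField.RingOfIntegers L} (hx : τ (x : L) = x) :
    ∃ y : NumberField.RingOfIntegers (IntermediateField.fixedField (Subgroup.zpowers τ)),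
      algebraMap _ (NumberField.RingOfIntegers L) y = x := by
  have hmem : (x : L) ∈ IntermediateField.fixedField (Subgroup.zpowers τ) := by
    rw [IntermediateField.mem_fixedField_iff]
    intro f hf
    have hst : Subgroup.zpowers τ ≤ MulAction.stabilizer (L ≃ₐ[ℚ] L) (x : L) := by
      rw [Subgroup.zpowers_le]
      exact hx
    exact hst hf
  let z : IntermediateField.fixedField (Subgroup.zpowers τ) := ⟨x, hmem⟩
  have hz : IsIntegral ℤ z :=
    (isIntegral_algHom_iff
      ((IntermediateField.fixedField (Subgroup.zpowers τ)).val.restrictScalars ℤ)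
      Subtype.val_injective).mp x.isIntegral_coe
  exact ⟨⟨z, hz⟩, rfl⟩

theorem NumberField.exists_unit_eq_of_tau_eq_self {L : Type*} [Field L] [NumberField L]
    (hL : Module.finrank ℚ L = 8) {τ τ' : L ≃ₐ[ℚ] L} (hτ : ∀ x, τ (τ x) = x)
    (hcomm : ∀ x, τ (τ' x) = τ' (τ x)) {i d : L} {a : NumberField.RingOfIntegers L} {r : ℚ}
    (hi : i ^ 2 = -1) (hτi : τ i = -i) (hd : d ^ 2 = r) (hr : r < 0) (hτd : τ d = d)
    (ha : a ^ 2 = 2) (hτa : τ (a : L) = a) (hτ'a : τ' (a : L) = -a)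
    (w : (NumberField.RingOfIntegers L)ˣ) (hw : τ ((w : NumberField.RingOfIntegers L) : L) =
      (w : NumberField.RingOfIntegers L)) :
    ∃ s : NumberField.RingOfIntegers L, (w : NumberField.RingOfIntegers L) = s ^ 2 ∨
      (w : NumberField.RingOfIntegers L) = -s ^ 2 ∨
      (w : NumberField.RingOfIntegers L) = (1 + a) * s ^ 2 ∨
      (w : NumberField.RingOfIntegers L) = -(1 + a) * s ^ 2 := by
  let E := IntermediateField.fixedField (Subgroup.zpowers τ)
  have hi0 : i ≠ 0 := by
    rintro rfl
    norm_num at hi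
  have hnot : ∀ n : L, τ n = n → n ^ 2 ≠ -1 := by
    intro n hn hn2
    rcases sq_eq_sq_iff_eq_or_eq_neg.mp (hn2.trans hi.symm) with rfl | rfl
    · rw [hτi] at hn
      exact hi0 (self_eq_neg.mp hn.symm)
    · rw [map_neg, hτi, neg_neg] at hn
      exact hi0 (self_eq_neg.mp hn)
  have hτ1 : τ ≠ 1 := by
    rintro rfl
    exact hi0 (self_eq_neg.mp hτi)
  have hord : orderOf τ = 2 := by
    refine orderOf_eq_prime ?_ hτ1
    ext x
    rw [sq]
    exact hτ x
  have hEfix : ∀ x : E, τ (x : L) = x := fun x =>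
    (IntermediateField.mem_fixedField_iff _ _).mp x.2 τ (Subgroup.mem_zpowers τ)
  have hfin : Module.finrank ℚ E = 4 := by
    have h1 : Module.finrank E L = 2 := by
      rw [IntermediateField.finrank_fixedField_eq_card, Nat.card_zpowers, hord]
    have h2 := Module.finrank_mul_finrank ℚ E L
    rw [h1, hL] at h2
    omega
  have hdE : d ∈ E := by
    rw [IntermediateField.mem_fixedField_iff]
    intro f hf
    have hst : Subgroup.zpowers τ ≤ MulAction.stabilizer (L ≃ₐ[ℚ] L) d := by
      rw [Subgroup.zpowers_le]
      exact hτd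
    exact hst hf
  have hrank : NumberField.Units.rank E = 1 := by
    refine NumberField.Units.rank_eq_one_of_sq_neg hfin (z := ⟨d, hdE⟩) (r := r) ?_ hr
    ext
    simpa using hd
  have hinj : Function.Injective (algebraMap (NumberField.RingOfIntegers E)
      (NumberField.RingOfIntegers L)) := FaithfulSMul.algebraMap_injective _ _
  have hlift : ∀ v : (NumberField.RingOfIntegers L)ˣ,
      τ ((v : NumberField.RingOfIntegers L) : L) = (v : NumberField.RingOfIntegers L) →
      ∃ v' : (NumberField.RingOfIntegers E)ˣ, algebraMap (NumberField.RingOfIntegers E)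
        (NumberField.RingOfIntegers L) v' = v := by
    intro v hv
    have hv' : τ (((v⁻¹ : (NumberField.RingOfIntegers L)ˣ) : NumberField.RingOfIntegers L) : L) =
        ((v⁻¹ : (NumberField.RingOfIntegers L)ˣ) : NumberField.RingOfIntegers L) := by
      have h1 : ((v : NumberField.RingOfIntegers L) : L) *
          (((v⁻¹ : (NumberField.RingOfIntegers L)ˣ) : NumberField.RingOfIntegers L) : L) = 1 := by
        rw [← map_mul, Units.mul_inv, map_one]
      have h2 := congrArg τ h1
      rw [map_mul, hv, map_one, ← h1] at h2
      exact mul_left_cancel₀ (left_ne_zero_of_mul_eq_one h1) h2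
    obtain ⟨y, hy⟩ := NumberField.exists_algebraMap_ringOfIntegers_fixedField hv
    obtain ⟨z, hz⟩ := NumberField.exists_algebraMap_ringOfIntegers_fixedField hv'
    have hyz : y * z = 1 := hinj (by rw [map_mul, hy, hz, Units.mul_inv, map_one])
    exact ⟨⟨y, z, hyz, by rw [mul_comm, hyz]⟩, hy⟩
  obtain ⟨w', hw'⟩ := hlift w hw
  obtain ⟨v, hv⟩ := hlift
    ⟨1 + a, a - 1, by linear_combination ha, by linear_combination ha⟩
    (by change τ (algebraMap _ L (1 + a)) = algebraMap _ L (1 + a); simp [hτa])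
  replace hv : algebraMap (NumberField.RingOfIntegers E) (NumberField.RingOfIntegers L) v =
    1 + a := hv
  have haL : (a : L) ^ 2 = 2 := by rw [← map_pow, ha, map_ofNat]
  have hsq : ∀ u : (NumberField.RingOfIntegers E)ˣ, IsSquare u → ∃ t : L, τ t = t ∧
      (algebraMap (NumberField.RingOfIntegers E) (NumberField.RingOfIntegers L) u : L) =
        t ^ 2 := by
    rintro u ⟨s, rfl⟩
    refine ⟨_, hEfix ((s : NumberField.RingOfIntegers E) : E), ?_⟩
    rw [sq]
    rfl
  obtain ⟨s, hs⟩ := NumberField.Units.exists_eq_sq_of_rank_eq_one hrank (u := -1) (v := v)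
    (fun h => by
      obtain ⟨t, ht, ht2⟩ := hsq _ h
      refine hnot t ht ?_
      rw [← ht2]
      simp)
    (fun h => by
      obtain ⟨t, ht, ht2⟩ := hsq _ h
      refine hnot (t * τ' t) (by rw [map_mul, hcomm, ht]) ?_
      replace ht2 : 1 + (a : L) = t ^ 2 := by
        rw [← ht2, hv]
        rfl
      rw [mul_pow, ← map_pow, ← ht2, map_add, hτ'a, map_one]
      linear_combination -haL)
    (fun h => by
      obtain ⟨t, ht, ht2⟩ := hsq _ h
      refine hnot (t * τ' t) (by rw [map_mul, hcomm, ht]) ?_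
      replace ht2 : -1 * (1 + (a : L)) = t ^ 2 := by
        rw [← ht2, Units.val_mul, map_mul, hv, Units.val_neg, Units.val_one, map_neg, map_one]
        rfl
      rw [mul_pow, ← map_pow, ← ht2, map_mul, map_add, hτ'a, map_neg, map_one]
      linear_combination -haL)
    w'
  refine ⟨algebraMap (NumberField.RingOfIntegers E) (NumberField.RingOfIntegers L) s, ?_⟩
  rw [← hw', ← hv]
  rcases hs with hs | hs | hs | hs
  · exact Or.inl (by rw [hs]; simp)
  · exact Or.inr (Or.inl (by rw [hs]; simp))
  · exact Or.inr (Or.inr (Or.inl (by rw [hs]; simp)))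
  · exact Or.inr (Or.inr (Or.inr (by rw [hs]; simp)))

theorem finrank_eq_two_of_sq {K L : Type*} [Field K] [Field L] [Algebra K L] {x : L} {r : K}
    (hx : x ^ 2 = algebraMap K L r) (hr : ∀ s : K, s ^ 2 ≠ r)
    (htop : IntermediateField.adjoin K {x} = ⊤) : Module.finrank K L = 2 := by
  have hirr : Irreducible (Polynomial.X ^ 2 - Polynomial.C r) :=
    X_pow_sub_C_irreducible_of_prime Nat.prime_two hr
  have hmon : (Polynomial.X ^ 2 - Polynomial.C r).Monic :=
    Polynomial.monic_X_pow_sub_C r two_ne_zero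
  have hmin : Polynomial.X ^ 2 - Polynomial.C r = minpoly K x :=
    minpoly.eq_of_irreducible_of_monic hirr (by simp [hx]) hmon
  have hxint : IsIntegral K x := ⟨_, hmon, by simp [hx]⟩
  have h := IntermediateField.adjoin.finrank hxint
  rw [htop, IntermediateField.finrank_top', ← hmin, Polynomial.natDegree_X_pow_sub_C] at h
  exact h

theorem isIntegral_one_add_div_two {A : Type*} [Field A] [CharZero A] {δ : A} {N : ℕ}
    (hδ : δ ^ 2 = -(N : A)) (hN : N % 4 = 3) : IsIntegral ℤ ((1 + δ) / 2) := by
  obtain ⟨c, hc⟩ : ∃ c : ℤ, (N : ℤ) + 1 = 4 * c := ⟨(N + 1) / 4, by omega⟩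
  refine ⟨Polynomial.X ^ 2 - Polynomial.X + Polynomial.C c, by monicity!, ?_⟩
  have hc' : (N : A) + 1 = 4 * c := by exact_mod_cast congrArg (Int.cast : ℤ → A) hc
  simp only [algebraMap_int_eq, Polynomial.eval₂_add, Polynomial.eval₂_sub, Polynomial.eval₂_pow,
    Polynomial.eval₂_X, Polynomial.eval₂_C, Int.coe_castRingHom]
  linear_combination (1 / 4) * hδ - (1 / 4) * hc'

theorem exists_intCast_eq_of_isIntegral_ratCast {A : Type*} [Field A] [CharZero A] {r : ℚ}
    (hr : IsIntegral ℤ (r : A)) : ∃ n : ℤ, r = n := by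
  have h : IsIntegral ℤ r := by
    rw [← eq_ratCast (algebraMap ℚ A)] at hr
    exact (isIntegral_algebraMap_iff (algebraMap ℚ A).injective).mp hr
  obtain ⟨n, hn⟩ := IsIntegrallyClosed.isIntegral_iff.mp h
  exact ⟨n, by simpa using hn.symm⟩

theorem exists_intCast_eq_of_sq_mul_squarefree {r : ℚ} {N : ℕ} (hN : Squarefree N) {k : ℤ}
    (h : r ^ 2 * N = k) : ∃ n : ℤ, r = n := by
  have hd : (r.den : ℚ) ≠ 0 := by exact_mod_cast r.den_nz
  have h1 : (r.num ^ 2 * N : ℤ) = k * r.den ^ 2 := by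
    have h2 : (r.num : ℚ) = r * r.den := (Rat.mul_den_eq_num r).symm
    have : ((r.num ^ 2 * N : ℤ) : ℚ) = (k * r.den ^ 2 : ℤ) := by
      push_cast
      rw [h2, ← h]
      ring
    exact_mod_cast this
  have h3 : (r.den : ℤ) ^ 2 ∣ r.num ^ 2 * N := ⟨k, by rw [h1, mul_comm]⟩
  have hcop : IsCoprime ((r.den : ℤ) ^ 2) (r.num ^ 2) := by
    refine IsCoprime.pow ?_
    rw [Int.isCoprime_iff_nat_coprime]
    exact r.reduced.symm
  have h4 : (r.den : ℤ) ^ 2 ∣ N := hcop.dvd_of_dvd_mul_left h3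
  have h5 : r.den * r.den ∣ N := by
    rw [← sq]
    exact_mod_cast h4
  have h6 : r.den = 1 := Nat.isUnit_iff.mp (hN _ h5)
  exact ⟨r.num, (Rat.den_eq_one_iff r).mp h6 |>.symm⟩

theorem NumberField.exists_eq_add_mul_of_adjoin_sqrt {K : Type*} [Field K] [NumberField K] {N : ℕ}
    (hN : N % 4 = 3) (hsq : Squarefree N) {δ : K} (hδ : δ ^ 2 = -(N : K))
    (htop : IntermediateField.adjoin ℚ {δ} = ⊤) {f : K ≃ₐ[ℚ] K} (hf : f δ = -δ) {x : K}
    (hx : IsIntegral ℤ x) : ∃ a b : ℤ, x = a + b * ((1 + δ) / 2) := by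
  have hx' : x ∈ IntermediateField.adjoin ℚ (insert δ (∅ : Set K)) := by
    rw [insert_empty_eq, htop]
    exact IntermediateField.mem_top
  have hδ' : δ ^ 2 ∈ IntermediateField.adjoin ℚ (∅ : Set K) := by
    rw [hδ]
    exact neg_mem (natCast_mem _ N)
  obtain ⟨c, hc, d, hd, hxe⟩ := IntermediateField.exists_add_mul_of_mem_adjoin_insert hδ' hx'
  rw [IntermediateField.adjoin_empty, IntermediateField.mem_bot] at hc hd
  obtain ⟨c, rfl⟩ := hc
  obtain ⟨d, rfl⟩ := hd
  rw [eq_ratCast, eq_ratCast] at hxe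
  have hfx : f x = c - d * δ := by
    rw [hxe, map_add, map_mul, map_ratCast, map_ratCast, hf]
    ring
  have hfi : IsIntegral ℤ (f x) := map_isIntegral_int f hx
  obtain ⟨A, hA⟩ : ∃ A : ℤ, 2 * c = A := by
    refine exists_intCast_eq_of_isIntegral_ratCast (A := K) ?_
    have : ((2 * c : ℚ) : K) = x + f x := by
      rw [hfx, hxe]
      push_cast
      ring
    rw [this]
    exact hx.add hfi
  obtain ⟨k, hk⟩ : ∃ k : ℤ, (2 * d) ^ 2 * N = k := by
    refine exists_intCast_eq_of_isIntegral_ratCast (A := K) ?_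
    have : (((2 * d) ^ 2 * N : ℚ) : K) = -(x - f x) ^ 2 := by
      rw [hfx, hxe]
      push_cast
      linear_combination (4 * (d : K) ^ 2) * hδ
    rw [this]
    exact ((hx.sub hfi).pow 2).neg
  obtain ⟨B, hB⟩ := exists_intCast_eq_of_sq_mul_squarefree hsq hk
  obtain ⟨C, hC⟩ : ∃ C : ℤ, c ^ 2 + N * d ^ 2 = C := by
    refine exists_intCast_eq_of_isIntegral_ratCast (A := K) ?_
    have : ((c ^ 2 + N * d ^ 2 : ℚ) : K) = x * f x := by
      rw [hfx, hxe]
      push_cast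
      linear_combination ((d : K) ^ 2) * hδ
    rw [this]
    exact hx.mul hfi
  have hABC : A ^ 2 + N * B ^ 2 = 4 * C := by
    have : ((A ^ 2 + N * B ^ 2 : ℤ) : ℚ) = (4 * C : ℤ) := by
      push_cast
      rw [← hA, ← hB, ← hC]
      ring
    exact_mod_cast this
  have hpar : (2 : ℤ) ∣ A - B := by
    have hN2 : (N : ℤ) % 2 = 1 := by omega
    have h1 : (A ^ 2 + N * B ^ 2) % 2 = 0 := by omega
    rw [← even_iff_two_dvd]
    have h2 : Even (A ^ 2 + N * B ^ 2) := Int.even_iff.mpr h1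
    have h3 : ¬Even (N : ℤ) := by
      rw [Int.even_iff]
      omega
    rw [Int.even_sub]
    rw [Int.even_add, Int.even_mul, Int.even_pow' two_ne_zero, Int.even_pow' two_ne_zero] at h2
    tauto
  obtain ⟨e, he⟩ := hpar
  refine ⟨e, B, ?_⟩
  have h1 : (c : K) * 2 = A := by
    have := congrArg (Rat.cast : ℚ → K) hA
    push_cast at this
    linear_combination this
  have h2 : (d : K) * 2 = B := by
    have := congrArg (Rat.cast : ℚ → K) hB
    push_cast at this
    linear_combination this
  have h3 : (A : K) - B = 2 * e := by exact_mod_cast congrArg (Int.cast : ℤ → K) he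
  rw [hxe]
  linear_combination (1 / 2) * h1 + (δ / 2) * h2 + (1 / 2) * h3

theorem NumberField.exists_isQuadraticExtension {K : Type*} [Field K] [NumberField K] {p q : ℕ}
    [hpP : Fact p.Prime] [hqP : Fact q.Prime] (hp : p % 8 = 5) (hq : q % 8 = 3)
    (hleg : legendreSym q (p : ℤ) = 1) {δ θ : NumberField.RingOfIntegers K}
    (hδ : δ ^ 2 = -(p * q)) (hθ : 2 * θ = 1 + δ)
    (htop : IntermediateField.adjoin ℚ {(δ : K)} = ⊤) :
    ∃ σ : NumberField.RingOfIntegers K ≃ₐ[ℤ] NumberField.RingOfIntegers K,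
      IsQuadraticExtension p q σ δ θ := by
  have hpq : p ≠ q := by
    rintro rfl
    omega
  have hN : p * q % 4 = 3 := by
    have h1 : p % 4 = 1 := by omega
    have h2 : q % 4 = 3 := by omega
    simp [Nat.mul_mod, h1, h2]
  have hsqf : Squarefree (p * q) := by
    rw [Nat.squarefree_mul ((Nat.coprime_primes hpP.out hqP.out).mpr hpq)]
    exact ⟨hpP.out.prime.squarefree, hqP.out.prime.squarefree⟩
  have hδK : (δ : K) ^ 2 = -((p * q : ℕ) : K) := by
    rw [← map_pow, hδ]
    simp
  have hgal : IsGalois ℚ K := by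
    refine IsGalois.rat_of_adjoin_eq_top (S := {(δ : K)}) ?_ htop
    rintro _ rfl
    exact ⟨-((p * q : ℕ) : ℚ), by rw [hδK]; push_cast; rfl⟩
  have hneg : ∀ r : ℚ, r ^ 2 ≠ -((p * q : ℕ) : ℚ) := by
    intro r hr
    have h1 : (0 : ℚ) < (p * q : ℕ) := by
      exact_mod_cast Nat.mul_pos hpP.out.pos hqP.out.pos
    nlinarith [sq_nonneg r]
  have hδbot : (δ : K) ∉ (⊥ : IntermediateField ℚ K) := by
    rw [IntermediateField.mem_bot]
    rintro ⟨r, hr⟩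
    refine hneg r ?_
    rw [← hr, eq_ratCast] at hδK
    exact_mod_cast hδK
  obtain ⟨f, hf⟩ := IntermediateField.exists_algEquiv_neg hδbot
    (by rw [hδK]; exact neg_mem (natCast_mem _ _))
  let σ : NumberField.RingOfIntegers K ≃ₐ[ℤ] NumberField.RingOfIntegers K :=
    AlgEquiv.ofRingEquiv (f := NumberField.RingOfIntegers.mapRingEquiv (f : K ≃+* K))
      (fun r => by simp)
  refine ⟨σ, hp, hq, hleg, hδ, hθ, ?_, ?_, ?_⟩
  · ext
    exact hf
  · intro x
    obtain ⟨a, b, hab⟩ := NumberField.exists_eq_add_mul_of_adjoin_sqrt hN hsqf hδK htop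
      (f := f.restrictScalars ℚ) hf x.isIntegral_coe
    refine ⟨a, b, ?_⟩
    ext
    have h2 : (2 : K) * θ = 1 + δ := by
      have := congrArg (algebraMap _ K) hθ
      rwa [map_mul, map_add, map_ofNat, map_one] at this
    change algebraMap _ K x = algebraMap _ K (a + b * θ)
    rw [hab, ← h2, map_add, map_mul, map_intCast, map_intCast]
    ring
  · rw [NumberField.RingOfIntegers.rank]
    refine finrank_eq_two_of_sq (x := (δ : K)) (r := -((p * q : ℕ) : ℚ)) ?_ hneg htop
    rw [hδK]
    simp

theorem IntermediateField.algEquiv_apply_eq_of_adjoin_eq_top {K L : Type*} [Field K] [Field L]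
    [Algebra K L] {S : Set L} (htop : adjoin K S = ⊤) {f g : L →ₐ[K] L}
    (h : ∀ s ∈ S, f s = g s) (x : L) : f x = g x := by
  have hx : x ∈ adjoin K S := htop ▸ mem_top
  induction hx using adjoin_induction with
  | mem x hx => exact h x hx
  | algebraMap r => rw [AlgHom.commutes, AlgHom.commutes]
  | add x y _ _ hx hy => rw [map_add, map_add, hx, hy]
  | mul x y _ _ hx hy => rw [map_mul, map_mul, hx, hy]
  | inv x _ hx => rw [map_inv₀, map_inv₀, hx]

theorem not_isSquare_rat_mul_of_prime {p : ℕ} (hp : p.Prime) {n : ℕ} (hn : ¬p ∣ n) :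
    ¬IsSquare ((p * n : ℕ) : ℚ) := by
  have h := not_isSquare_mul_of_prime hp hn
  rw [← Rat.isSquare_intCast_iff] at h
  exact_mod_cast h

theorem isPrimitiveRoot_eight_of_pow_four {A : Type*} [Field A] [CharZero A] {ζ : A}
    (hζ : ζ ^ 4 = -1) : IsPrimitiveRoot ζ 8 := by
  have h : orderOf ζ = 2 ^ (2 + 1) := by
    refine orderOf_eq_prime_pow ?_ ?_
    · norm_num [hζ]
    · rw [show 2 ^ (2 + 1) = 4 * 2 by norm_num, pow_mul, hζ]
      norm_num
  rw [show 8 = orderOf ζ by rw [h]; norm_num]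
  exact IsPrimitiveRoot.orderOf ζ

theorem NumberField.nonempty_sylow_mulEquiv_of_octic {K L : Type*} [Field K] [NumberField K]
    [Field L] [NumberField L] {p q : ℕ} [hpP : Fact p.Prime] [hqP : Fact q.Prime]
    (hp : p % 8 = 5) (hq : q % 8 = 3) (hleg : legendreSym q (p : ℤ) = 1)
    {a b i : L} (ha : a ^ 2 = 2) (hb : b ^ 2 = p * q) (hi : i ^ 2 = -1)
    (htop : IntermediateField.adjoin ℚ {a, b, i} = ⊤) {d : K}
    (hdtop : IntermediateField.adjoin ℚ {d} = ⊤) (ι : K →+* L) (hι : ι d = b * i) {m : ℕ}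
    (hm : (Nat.card (ClassGroup (NumberField.RingOfIntegers K))).factorization 2 = m)
    (P : Sylow 2 (ClassGroup (NumberField.RingOfIntegers L))) :
    Nonempty (P ≃* Multiplicative (ZMod (2 ^ (m + 1)))) := by
  -- the rational squares excluded by the congruence conditions
  have hpq : p ≠ q := by
    rintro rfl
    omega
  have hN : p * q % 4 = 3 := by
    have h1 : p % 4 = 1 := by omega
    have h2 : q % 4 = 3 := by omega
    simp [Nat.mul_mod, h1, h2]
  have hpos : (0 : ℚ) < p * q := by
    exact_mod_cast Nat.mul_pos hpP.out.pos hqP.out.pos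
  have sq1 : ¬IsSquare ((p : ℚ) * q) := by
    have := not_isSquare_rat_mul_of_prime hpP.out (n := q)
      (fun h => hpq ((Nat.prime_dvd_prime_iff_eq hpP.out hqP.out).mp h))
    simpa using this
  have sq2 : ¬IsSquare ((2 : ℚ) * (p * q)) := by
    have := not_isSquare_rat_mul_of_prime Nat.prime_two (n := p * q) (by omega)
    simpa using this
  have sq3 : ¬IsSquare (2 : ℚ) := by
    have := not_isSquare_rat_mul_of_prime Nat.prime_two (n := 1) (by omega)
    simpa using this
  have sqneg : ∀ r : ℚ, r < 0 → ¬IsSquare r := fun r hr h => absurd h.nonneg (not_le.mpr hr)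
  have hgal : IsGalois ℚ L := by
    refine IsGalois.rat_of_adjoin_eq_top (S := {a, b, i}) ?_ htop
    rintro _ (rfl | rfl | rfl)
    · exact ⟨2, by rw [ha]; simp⟩
    · exact ⟨p * q, by rw [hb]; push_cast; rfl⟩
    · exact ⟨-1, by rw [hi]; simp⟩
  have hbi : (b * i) ^ 2 = -(p * q : L) := by rw [mul_pow, hb, hi]; ring
  have hb0 : b ≠ 0 := by
    rintro rfl
    have : ((p * q : ℚ) : L) = 0 := by
      push_cast
      rw [← hb]
      ring
    exact hpos.ne' (by exact_mod_cast this)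
  -- the eighth root of unity and the field it generates
  let z : L := (1 + i) * a / 2
  have hz2 : z ^ 2 = i := by
    simp only [z]
    linear_combination (1 / 4 * (1 + i) ^ 2) * ha + (1 / 2) * hi
  have hz4 : z ^ 4 = -1 := by rw [show z ^ 4 = (z ^ 2) ^ 2 by ring, hz2, hi]
  have hza : z - z ^ 3 = a := by
    rw [show z ^ 3 = z ^ 2 * z by ring, hz2]
    simp only [z]
    linear_combination (-(a / 2)) * hi
  let F : IntermediateField ℚ L := IntermediateField.adjoin ℚ {z}
  have hzF : z ∈ F := IntermediateField.mem_adjoin_simple_self ℚ z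
  have hiF : i ∈ F := hz2 ▸ pow_mem hzF 2
  have haF : a ∈ F := hza ▸ sub_mem hzF (pow_mem hzF 3)
  have hFle : F ≤ IntermediateField.adjoin ℚ {a, i} := by
    rw [IntermediateField.adjoin_simple_le_iff]
    have h1 : a ∈ IntermediateField.adjoin ℚ {a, i} :=
      IntermediateField.subset_adjoin ℚ _ (by simp)
    have h2 : i ∈ IntermediateField.adjoin ℚ {a, i} :=
      IntermediateField.subset_adjoin ℚ _ (by simp)
    exact div_mem (mul_mem (add_mem (one_mem _) h2) h1) (natCast_mem _ 2)
  have hbF : b ∉ F := fun h => by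
    refine IntermediateField.notMem_adjoin_pair_of_not_isSquare (x := b) (y := a) (z := i)
      (X := p * q) (Y := 2) (Z := -1) (by rw [hb]; push_cast; rfl) (by rw [ha]; simp)
      (by rw [hi]; simp) sq1 ?_ ?_ ?_ (hFle h)
    · rwa [mul_comm]
    · exact sqneg _ (by linarith)
    · exact sqneg _ (by linarith)
  have hb2F : b ^ 2 ∈ F := by
    rw [hb]
    exact mul_mem (natCast_mem _ p) (natCast_mem _ q)
  have htop' : IntermediateField.adjoin ℚ (insert b {z}) = ⊤ := by
    rw [eq_top_iff, ← htop, IntermediateField.adjoin_le_iff]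
    have hle : F ≤ IntermediateField.adjoin ℚ (insert b {z}) :=
      IntermediateField.adjoin.mono ℚ _ _ (Set.subset_insert _ _)
    rintro _ (rfl | rfl | rfl)
    · exact hle haF
    · exact IntermediateField.subset_adjoin ℚ _ (Set.mem_insert _ _)
    · exact hle hiF
  have hdec : ∀ x : L, ∃ c ∈ F, ∃ e ∈ F, x = c + e * b := fun x =>
    IntermediateField.exists_add_mul_of_mem_adjoin_insert hb2F
      (htop' ▸ IntermediateField.mem_top)
  have hzprim : IsPrimitiveRoot z 8 := isPrimitiveRoot_eight_of_pow_four hz4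
  have hcyc : IsCyclotomicExtension {8} ℚ F :=
    hzprim.intermediateField_adjoin_isCyclotomicExtension ℚ
  have hFL : Module.finrank F L = 2 := by
    refine finrank_eq_two_of_sq (x := b) (r := ⟨b ^ 2, hb2F⟩) rfl ?_ ?_
    · intro s hs
      have h1 : (s : L) ^ 2 = b ^ 2 := congrArg Subtype.val hs
      rcases sq_eq_sq_iff_eq_or_eq_neg.mp h1 with h | h
      · exact hbF (h ▸ s.2)
      · exact hbF (by simpa [h] using neg_mem s.2)
    · rw [eq_top_iff]
      intro x _
      obtain ⟨c, hc, e, he, rfl⟩ := hdec x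
      have h1 := algebraMap_mem (IntermediateField.adjoin F {b}) (⟨c, hc⟩ : F)
      have h2 := algebraMap_mem (IntermediateField.adjoin F {b}) (⟨e, he⟩ : F)
      exact add_mem h1 (mul_mem h2 (IntermediateField.mem_adjoin_simple_self F b))
  have hL : Module.finrank ℚ L = 8 := by
    have h4 : Module.finrank ℚ F = 4 := by
      rw [IsCyclotomicExtension.finrank (n := 8) F
        (Polynomial.cyclotomic.irreducible_rat (by norm_num))]
      decide
    rw [← Module.finrank_mul_finrank ℚ F L, h4, hFL]
  -- the automorphisms
  obtain ⟨σ, hσb⟩ := IntermediateField.exists_algEquiv_neg hbF hb2F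
  obtain ⟨t, ht⟩ := IntermediateField.exists_algEquiv_neg
    (k := IntermediateField.adjoin ℚ {a, b * i}) (x := i)
    (IntermediateField.notMem_adjoin_pair_of_not_isSquare
      (X := -1) (Y := 2) (Z := -(p * q)) (by rw [hi]; simp) (by rw [ha]; simp)
      (by rw [hbi]; push_cast; rfl) (sqneg _ (by norm_num)) (sqneg _ (by norm_num))
      (by simpa using sq1) (by simpa using sq2))
    (by rw [hi]; exact neg_mem (one_mem _))
  obtain ⟨t', ht'⟩ := IntermediateField.exists_algEquiv_neg
    (k := IntermediateField.adjoin ℚ {i, b * i}) (x := a)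
    (IntermediateField.notMem_adjoin_pair_of_not_isSquare
      (X := 2) (Y := -1) (Z := -(p * q)) (by rw [ha]; simp) (by rw [hi]; simp)
      (by rw [hbi]; push_cast; rfl) sq3 (sqneg _ (by norm_num))
      (sqneg _ (by linarith)) (by simpa using sq2))
    (by rw [ha]; exact natCast_mem _ 2)
  let τ : L ≃ₐ[ℚ] L := t.restrictScalars ℚ
  let τ' : L ≃ₐ[ℚ] L := t'.restrictScalars ℚ
  have hfixt : ∀ x ∈ ({a, b * i} : Set L), τ x = x := fun x hx =>
    t.commutes ⟨x, IntermediateField.subset_adjoin ℚ _ hx⟩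
  have hfixt' : ∀ x ∈ ({i, b * i} : Set L), τ' x = x := fun x hx =>
    t'.commutes ⟨x, IntermediateField.subset_adjoin ℚ _ hx⟩
  have hi0 : i ≠ 0 := by
    rintro rfl
    norm_num at hi
  have hτi : τ i = -i := ht
  have hτa : τ a = a := hfixt a (by simp)
  have hτd : τ (b * i) = b * i := hfixt _ (by simp)
  have hτb : τ b = -b := by
    have h := hτd
    rw [map_mul, hτi] at h
    exact mul_right_cancel₀ hi0 (by linear_combination -h)
  have hτ'a : τ' a = -a := ht'
  have hτ'i : τ' i = i := hfixt' i (by simp)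
  have hτ'd : τ' (b * i) = b * i := hfixt' _ (by simp)
  have hτ'b : τ' b = b := by
    have h := hτ'd
    rw [map_mul, hτ'i] at h
    exact mul_right_cancel₀ hi0 h
  have hττ : ∀ x, τ (τ x) = x := by
    refine IntermediateField.algEquiv_apply_eq_of_adjoin_eq_top htop
      (f := ((τ.trans τ : L ≃ₐ[ℚ] L) : L →ₐ[ℚ] L)) (g := AlgHom.id ℚ L) ?_
    rintro _ (rfl | rfl | rfl) <;> simp [hτa, hτb, hτi]
  have hcomm : ∀ x, τ (τ' x) = τ' (τ x) := by
    refine IntermediateField.algEquiv_apply_eq_of_adjoin_eq_top htop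
      (f := ((τ'.trans τ : L ≃ₐ[ℚ] L) : L →ₐ[ℚ] L))
      (g := ((τ.trans τ' : L ≃ₐ[ℚ] L) : L →ₐ[ℚ] L)) ?_
    rintro _ (rfl | rfl | rfl) <;> simp [hτa, hτb, hτi, hτ'a, hτ'b, hτ'i]
  have hσF : ∀ x ∈ F, σ x = x := fun x hx => σ.commutes ⟨x, hx⟩
  have hσσ : ∀ x, σ (σ x) = x := by
    intro x
    obtain ⟨c, hc, e, he, rfl⟩ := hdec x
    simp [hσF c hc, hσF e he, hσb]
  have hextL : ∀ {x y : NumberField.RingOfIntegers L},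
      algebraMap _ L x = algebraMap _ L y → x = y := NumberField.RingOfIntegers.ext
  have hextK : ∀ {x y : NumberField.RingOfIntegers K},
      algebraMap _ K x = algebraMap _ K y → x = y := NumberField.RingOfIntegers.ext
  have hιd : d ^ 2 = -(p * q : K) := by
    apply ι.injective
    rw [map_pow, hι, hbi, map_neg, map_mul, map_natCast, map_natCast]
  have hιinj : Function.Injective (NumberField.RingOfIntegers.mapRingHom ι) := fun x y h =>
    NumberField.RingOfIntegers.ext (ι.injective (congrArg
      (algebraMap (NumberField.RingOfIntegers L) L) h))
  -- the integral elements
  let θL : NumberField.RingOfIntegers L :=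
    ⟨(1 + b * i) / 2, isIntegral_one_add_div_two (N := p * q) (by rw [hbi]; push_cast; rfl) hN⟩
  let θK : NumberField.RingOfIntegers K :=
    ⟨(1 + d) / 2, isIntegral_one_add_div_two (N := p * q) (by rw [hιd]; push_cast; rfl) hN⟩
  have hθL : algebraMap _ L θL = (1 + b * i) / 2 := rfl
  have hθK : algebraMap _ K θK = (1 + d) / 2 := rfl
  have hδL : algebraMap _ L (2 * θL - 1) = b * i := by
    rw [map_sub, map_mul, map_ofNat, map_one, hθL]
    ring
  have hδK : algebraMap _ K (2 * θK - 1) = d := by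
    rw [map_sub, map_mul, map_ofNat, map_one, hθK]
    ring
  obtain ⟨σO, hO⟩ := NumberField.exists_isQuadraticExtension hp hq hleg (δ := 2 * θK - 1)
    (θ := θK) (hextK (by
      rw [map_pow, hδK, hιd, map_neg, map_mul, map_natCast, map_natCast])) (by ring)
    (by rw [← hδK] at hdtop; exact hdtop)
  have hζint : IsIntegral ℤ (⟨z, hzF⟩ : F) := by
    refine IsIntegral.of_pow (n := 4) (by norm_num) ?_
    rw [show (⟨z, hzF⟩ : F) ^ 4 = -1 from Subtype.ext hz4]
    exact isIntegral_one.neg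
  let ζ : NumberField.RingOfIntegers F := ⟨⟨z, hzF⟩, hζint⟩
  have hζ4 : ζ ^ 4 = -1 := NumberField.RingOfIntegers.ext (Subtype.ext hz4)
  have hζL : algebraMap (NumberField.RingOfIntegers L) L
      (algebraMap (NumberField.RingOfIntegers F) (NumberField.RingOfIntegers L) ζ) = z := rfl
  have hτz : τ z = -z ^ 3 := by
    rw [show z ^ 3 = z ^ 2 * z by ring, hz2]
    simp only [z, map_div₀, map_mul, map_add, map_one, map_ofNat, hτi, hτa]
    linear_combination (a / 2) * hi
  have hτ'z : τ' z = -z := by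
    simp only [z, map_div₀, map_mul, map_add, map_one, map_ofNat, hτ'i, hτ'a]
    ring
  have haL : algebraMap (NumberField.RingOfIntegers L) L (algebraMap (NumberField.RingOfIntegers F)
      (NumberField.RingOfIntegers L) (ζ - ζ ^ 3)) = a := by
    rw [map_sub, map_pow, map_sub, map_pow, hζL, hza]
  have hpid := NumberField.isPrincipalIdealRing_of_isCyclotomicExtension_eight F
  have hS : IsOcticExtension p q (NumberField.RingOfIntegers.mapAlgEquiv σ)
      (NumberField.RingOfIntegers.mapRingEquiv (τ : L ≃+* L))
      (NumberField.RingOfIntegers.mapRingEquiv (τ' : L ≃+* L)) ζ (2 * θL - 1) θL :=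
    { mod_p := hp
      mod_q := hq
      pell := exists_mul_sq_sub_mul_sq_eq_one hp hq hleg
      pell_two := exists_mul_sq_sub_two_mul_sq_eq_one hp hq hleg
      zeta_pow := hζ4
      delta_sq := hextL (by
        rw [map_pow, hδL, hbi, map_neg, map_mul, map_natCast, map_natCast])
      two_mul_theta := by ring
      conj_conj := fun x => hextL (hσσ x)
      conj_fix := by
        intro x hx
        have hx' : σ (x : L) = x := congrArg (algebraMap (NumberField.RingOfIntegers L) L) hx
        obtain ⟨c, hc, e, he, hce⟩ := hdec (x : L)
        have hxF : (x : L) ∈ F := by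
          rw [hce, map_add, map_mul, hσF c hc, hσF e he, hσb] at hx'
          have h0 : e * b = 0 := by linear_combination (-1 / 2) * hx'
          rw [hce, h0, add_zero]
          exact hc
        exact ⟨⟨⟨x, hxF⟩, (isIntegral_algHom_iff (F.val.restrictScalars ℤ)
          Subtype.val_injective).mp x.isIntegral_coe⟩, rfl⟩
      conj_delta := hextL (by
        change σ (algebraMap _ L (2 * θL - 1)) = _
        rw [map_neg, hδL, map_mul, hσb, hσF i hiF, neg_mul])
      tau_tau := fun x => hextL (hττ x)
      tau_zeta := hextL (by
        change τ z = _
        rw [map_neg, map_pow, hζL, hτz])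
      tau_delta := hextL (by
        change τ (algebraMap _ L (2 * θL - 1)) = _
        rw [hδL, hτd])
      tau'_zeta := hextL (by
        change τ' z = _
        rw [map_neg, hζL, hτ'z])
      tau'_delta := hextL (by
        change τ' (algebraMap _ L (2 * θL - 1)) = _
        rw [hδL, hτ'd])
      frob_p := NumberField.natCast_dvd_pow_sub_self_of_isCyclotomicExtension_eight p (by omega)
      frob_q := NumberField.natCast_dvd_pow_sub_self_of_isCyclotomicExtension_eight q (by omega)
      base_units := NumberField.exists_unit_eq_of_isCyclotomicExtension_eight hp hq hζ4
      tau_units := by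
        intro w hw
        have h := NumberField.exists_unit_eq_of_tau_eq_self hL hττ hcomm (i := i) (d := b * i)
          (a := algebraMap (NumberField.RingOfIntegers F) (NumberField.RingOfIntegers L)
            (ζ - ζ ^ 3)) (r := -(p * q)) hi hτi (by rw [hbi]; push_cast; rfl) (by linarith) hτd
          (hextL (by rw [map_pow, haL, ha, map_ofNat]))
          (by rw [← haL] at hτa; exact hτa)
          (by rw [← haL] at hτ'a; exact hτ'a) w
          (congrArg (algebraMap (NumberField.RingOfIntegers L) L) hw)
        rwa [map_add, map_one]
      finrank := by rw [NumberField.RingOfIntegers.rank, hL] }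
  exact hS.nonempty_sylow_mulEquiv hO (NumberField.RingOfIntegers.mapRingHom ι) hιinj
    (hextL (by
      change ι (algebraMap _ K (2 * θK - 1)) = _
      rw [hδK, hι, hδL]))
    (hextL (by
      change ι (algebraMap _ K θK) = _
      rw [hθK, hθL, map_div₀, map_add, map_one,
        map_ofNat, hι])) hm P

theorem IntermediateField.adjoin_preimage_val_eq_top {K L : Type*} [Field K] [Field L]
    [Algebra K L] (S : Set L) :
    adjoin K ((Subtype.val : adjoin K S → L) ⁻¹' S) = ⊤ := by
  refine map_injective (adjoin K S).val ?_
  rw [adjoin_map, ← AlgHom.fieldRange_eq_map, fieldRange_val]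
  congr 1
  exact Set.image_preimage_eq_of_subset fun x hx => ⟨⟨x, subset_adjoin K S hx⟩, rfl⟩

theorem IntermediateField.adjoin_rat_eq_top_congr {E : Type*} [Field E] {A₁ A₂ : Algebra ℚ E}
    {S : Set E} (h : @adjoin ℚ _ E _ A₁ S = ⊤) : @adjoin ℚ _ E _ A₂ S = ⊤ := by
  obtain rfl := Subsingleton.elim A₁ A₂
  exact h

theorem NumberField.of_adjoin_sq {A : Type*} [Field A] [CharZero A] {S : Set A} (hS : S.Finite)
    (h : ∀ s ∈ S, ∃ n : ℤ, s ^ 2 = n) : NumberField (IntermediateField.adjoin ℚ S) := by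
  have := hS.to_subtype
  have hfin := IntermediateField.finiteDimensional_adjoin (K := ℚ) (S := S) fun s hs => by
    obtain ⟨n, hn⟩ := h s hs
    refine IsIntegral.of_pow (n := 2) (by norm_num) ?_
    rw [hn, ← map_intCast (algebraMap ℚ A)]
    exact isIntegral_algebraMap
  exact { to_finiteDimensional := hfin }

theorem twoClassGroup_Qsqrt2_sqrtpq_i_cyclic
    (p q : ℕ) [Fact (Nat.Prime p)] [Fact (Nat.Prime q)]
    (hp : p % 8 = 5) (hq : q % 8 = 3) (hleg : legendreSym q (p : ℤ) = 1)
    (m : ℕ)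
    (hm : 2 ^ m = twoClassNum (IntermediateField.adjoin ℚ
      {((Real.sqrt (p * q) : ℝ) : ℂ) * Complex.I})) :
    TwoClassGroupIsCyclicOfOrder
      (IntermediateField.adjoin ℚ
        {((Real.sqrt 2 : ℝ) : ℂ), ((Real.sqrt (p * q) : ℝ) : ℂ), Complex.I})
      (2 ^ (m + 1)) := by
  set A : ℂ := ((Real.sqrt 2 : ℝ) : ℂ) with hA
  set B : ℂ := ((Real.sqrt (p * q) : ℝ) : ℂ) with hB
  have hA2 : A ^ 2 = 2 := by
    rw [hA, ← Complex.ofReal_pow, Real.sq_sqrt (by norm_num)]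
    norm_num
  have hB2 : B ^ 2 = p * q := by
    rw [hB, ← Complex.ofReal_pow, Real.sq_sqrt (by positivity)]
    push_cast
    rfl
  have hnfL : NumberField (IntermediateField.adjoin ℚ {A, B, Complex.I}) := by
    refine NumberField.of_adjoin_sq (Set.toFinite _) ?_
    rintro _ (rfl | rfl | rfl)
    · exact ⟨2, by rw [hA2]; norm_num⟩
    · exact ⟨p * q, by rw [hB2]; push_cast; rfl⟩
    · exact ⟨-1, by simp⟩
  have hnfK : NumberField (IntermediateField.adjoin ℚ {B * Complex.I}) := by
    refine NumberField.of_adjoin_sq (Set.toFinite _) ?_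
    rintro _ rfl
    exact ⟨-(p * q), by rw [mul_pow, hB2, Complex.I_sq]; push_cast; ring⟩
  have hAL : A ∈ IntermediateField.adjoin ℚ {A, B, Complex.I} :=
    IntermediateField.subset_adjoin ℚ _ (by simp)
  have hBL : B ∈ IntermediateField.adjoin ℚ {A, B, Complex.I} :=
    IntermediateField.subset_adjoin ℚ _ (by simp)
  have hIL : Complex.I ∈ IntermediateField.adjoin ℚ {A, B, Complex.I} :=
    IntermediateField.subset_adjoin ℚ _ (by simp)
  have hle : IntermediateField.adjoin ℚ {B * Complex.I} ≤
      IntermediateField.adjoin ℚ {A, B, Complex.I} := by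
    rw [IntermediateField.adjoin_simple_le_iff]
    exact mul_mem hBL hIL
  have htopL := IntermediateField.adjoin_preimage_val_eq_top (K := ℚ) {A, B, Complex.I}
  have htopK := IntermediateField.adjoin_preimage_val_eq_top (K := ℚ) {B * Complex.I}
  intro P
  refine NumberField.nonempty_sylow_mulEquiv_of_octic hp hq hleg (a := ⟨A, hAL⟩) (b := ⟨B, hBL⟩)
    (i := ⟨Complex.I, hIL⟩) (Subtype.ext hA2) (Subtype.ext hB2) (Subtype.ext Complex.I_sq) ?_
    (d := ⟨B * Complex.I, IntermediateField.mem_adjoin_simple_self ℚ _⟩) ?_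
    (IntermediateField.inclusion hle : _ →+* _) rfl
    (Nat.pow_right_injective le_rfl hm).symm P
  · refine IntermediateField.adjoin_rat_eq_top_congr ((congrArg _ ?_).trans htopL)
    ext x
    simp [Subtype.ext_iff]
  · refine IntermediateField.adjoin_rat_eq_top_congr ((congrArg _ ?_).trans htopK)
    ext x
    simp [Subtype.ext_iff]
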